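/- The only pairs (c, w) ∈ ℚ × ℚ satisfying (−c² − c + 1)w³ + (c² + c − 1)w² + (−2c² + 1)w + c² − c = 0 are (c, w) = (0, 0) and (c, w) = (1, 0). -/

import Mathlib

open Polynomial

namespace N3M2

/-- uniqueness of coefficients in degree at most six -/
lemma coeffs6 {R : Type*} [CommRing R] {a0 a1 a2 a3 a4 a5 a6 b0 b1 b2 b3 b4 b5 b6 : R}
    (h : C a0 + C a1 * X + C a2 * X ^ 2 + C a3 * X ^ 3 + C a4 * X ^ 4 + C a5 * X ^ 5
        + C a6 * X ^ 6 = C b0 + C b1 * X + C b2 * X ^ 2 + C b3 * X ^ 3 + C b4 * X ^ 4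
        + C b5 * X ^ 5 + C b6 * X ^ 6) :
    a0 = b0 ∧ a1 = b1 ∧ a2 = b2 ∧ a3 = b3 ∧ a4 = b4 ∧ a5 = b5 ∧ a6 = b6 := by
  refine ⟨?_, ?_, ?_, ?_, ?_, ?_, ?_⟩
  · simpa [coeff_X, coeff_X_pow, coeff_C] using congrArg (fun p => coeff p 0) h
  · simpa [coeff_X, coeff_X_pow, coeff_C] using congrArg (fun p => coeff p 1) h
  · simpa [coeff_X, coeff_X_pow, coeff_C] using congrArg (fun p => coeff p 2) h
  · simpa [coeff_X, coeff_X_pow, coeff_C] using congrArg (fun p => coeff p 3) h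
  · simpa [coeff_X, coeff_X_pow, coeff_C] using congrArg (fun p => coeff p 4) h
  · simpa [coeff_X, coeff_X_pow, coeff_C] using congrArg (fun p => coeff p 5) h
  · simpa [coeff_X, coeff_X_pow, coeff_C] using congrArg (fun p => coeff p 6) h

lemma deg1 {R : Type*} [CommRing R] {p : R[X]} (h : p.natDegree ≤ 1) :
    p = C (p.coeff 0) + C (p.coeff 1) * X := by
  have h' : p.natDegree < 2 := by omega
  conv_lhs => rw [as_sum_range_C_mul_X_pow' p h']
  simp [Finset.sum_range_succ]

lemma deg2 {R : Type*} [CommRing R] {p : R[X]} (h : p.natDegree ≤ 2) :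
    p = C (p.coeff 0) + C (p.coeff 1) * X + C (p.coeff 2) * X ^ 2 := by
  have h' : p.natDegree < 3 := by omega
  conv_lhs => rw [as_sum_range_C_mul_X_pow' p h']
  simp [Finset.sum_range_succ]

lemma deg3 {R : Type*} [CommRing R] {p : R[X]} (h : p.natDegree ≤ 3) :
    p = C (p.coeff 0) + C (p.coeff 1) * X + C (p.coeff 2) * X ^ 2 + C (p.coeff 3) * X ^ 3 := by
  have h' : p.natDegree < 4 := by omega
  conv_lhs => rw [as_sum_range_C_mul_X_pow' p h']
  simp [Finset.sum_range_succ]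

lemma deg4 {R : Type*} [CommRing R] {p : R[X]} (h : p.natDegree ≤ 4) :
    p = C (p.coeff 0) + C (p.coeff 1) * X + C (p.coeff 2) * X ^ 2 + C (p.coeff 3) * X ^ 3
      + C (p.coeff 4) * X ^ 4 := by
  have h' : p.natDegree < 5 := by omega
  conv_lhs => rw [as_sum_range_C_mul_X_pow' p h']
  simp [Finset.sum_range_succ]

lemma deg5 {R : Type*} [CommRing R] {p : R[X]} (h : p.natDegree ≤ 5) :
    p = C (p.coeff 0) + C (p.coeff 1) * X + C (p.coeff 2) * X ^ 2 + C (p.coeff 3) * X ^ 3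
      + C (p.coeff 4) * X ^ 4 + C (p.coeff 5) * X ^ 5 := by
  have h' : p.natDegree < 6 := by omega
  conv_lhs => rw [as_sum_range_C_mul_X_pow' p h']
  simp [Finset.sum_range_succ]

/-- The sextic, over any commutative ring. -/
noncomputable def gP (R : Type*) [CommRing R] : R[X] :=
  X ^ 6 - 4 * X ^ 5 + 10 * X ^ 4 - 14 * X ^ 3 + 17 * X ^ 2 - 10 * X + 5

/-- `g = h ^ 2 + 4 * q`. -/
noncomputable def hP (R : Type*) [CommRing R] : R[X] := X ^ 3 - 2 * X ^ 2 + 3 * X - 1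

noncomputable def qP (R : Type*) [CommRing R] : R[X] := X ^ 2 - X + 1

lemma gP_eq (R : Type*) [CommRing R] : gP R = hP R ^ 2 + 4 * qP R := by
  unfold gP hP qP; ring

lemma gP_natDegree (R : Type*) [CommRing R] [Nontrivial R] : (gP R).natDegree = 6 := by
  unfold gP; compute_degree!

lemma gP_monic (R : Type*) [CommRing R] [Nontrivial R] : (gP R).Monic := by
  unfold gP; monicity!

lemma gP_map {R S : Type*} [CommRing R] [CommRing S] (f : R →+* S) : (gP R).map f = gP S := by
  unfold gP; simp [Polynomial.map_ofNat]

lemma coeff_monic {R : Type*} [CommRing R] {p : R[X]} (h : p.Monic) {n : ℕ}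
    (hn : p.natDegree = n) : p.coeff n = 1 := by
  rw [← hn]; exact h

lemma no_factor_one : ∀ a b0 b1 b2 b3 b4 : ZMod 2,
    ¬ (a * b0 = 5 ∧ b0 + a * b1 = -10 ∧ b1 + a * b2 = 17 ∧ b2 + a * b3 = -14 ∧
      b3 + a * b4 = 10 ∧ b4 + a = -4) := by decide

lemma no_factor_two : ∀ a b c0 c1 c2 c3 : ZMod 2,
    ¬ (a * c0 = 5 ∧ a * c1 + b * c0 = -10 ∧ a * c2 + b * c1 + c0 = 17 ∧
      a * c3 + b * c2 + c1 = -14 ∧ a + b * c3 + c2 = 10 ∧ b + c3 = -4) := by decide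

lemma no_factor_three : ∀ a b c d e f : ZMod 3,
    ¬ (a * d = 5 ∧ a * e + b * d = -10 ∧ a * f + b * e + c * d = 17 ∧
      a + b * f + c * e + d = -14 ∧ b + c * f + e = 10 ∧ c + f = -4) := by decide

lemma gP_irreducible_int : Irreducible (gP ℤ) := by
  rw [(gP_monic ℤ).irreducible_iff_natDegree']
  refine ⟨fun h => ?_, fun f g hf hg hfg hmem => ?_⟩
  · have := gP_natDegree ℤ
    rw [h] at this; simp at this
  have hdeg : f.natDegree + g.natDegree = 6 := by
    rw [← hf.natDegree_mul hg, hfg, gP_natDegree]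
  rw [gP_natDegree, Finset.mem_Ioc] at hmem
  have h3 : g.natDegree = 1 ∨ g.natDegree = 2 ∨ g.natDegree = 3 := by omega
  rcases h3 with h | h | h
  · have hf5 : f.natDegree = 5 := by omega
    have e1 := deg1 h.le
    have e2 := deg5 hf5.le
    rw [coeff_monic hg h] at e1
    rw [coeff_monic hf hf5] at e2
    rw [e1, e2] at hfg
    generalize g.coeff 0 = a at hfg
    generalize f.coeff 0 = b0 at hfg
    generalize f.coeff 1 = b1 at hfg
    generalize f.coeff 2 = b2 at hfg
    generalize f.coeff 3 = b3 at hfg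
    generalize f.coeff 4 = b4 at hfg
    have := coeffs6 (a0 := a * b0) (a1 := b0 + a * b1) (a2 := b1 + a * b2) (a3 := b2 + a * b3)
      (a4 := b3 + a * b4) (a5 := b4 + a) (a6 := 1) (b0 := 5) (b1 := -10) (b2 := 17) (b3 := -14)
      (b4 := 10) (b5 := -4) (b6 := 1) (by
        unfold gP at hfg
        simp only [map_add, map_mul, map_one, map_neg, C_ofNat] at hfg ⊢
        linear_combination hfg)
    obtain ⟨h0, h1, h2, h3, h4, h5, -⟩ := this
    refine no_factor_one a b0 b1 b2 b3 b4 ⟨?_, ?_, ?_, ?_, ?_, ?_⟩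
    · exact_mod_cast congrArg (Int.cast : ℤ → ZMod 2) h0
    · exact_mod_cast congrArg (Int.cast : ℤ → ZMod 2) h1
    · exact_mod_cast congrArg (Int.cast : ℤ → ZMod 2) h2
    · exact_mod_cast congrArg (Int.cast : ℤ → ZMod 2) h3
    · exact_mod_cast congrArg (Int.cast : ℤ → ZMod 2) h4
    · exact_mod_cast congrArg (Int.cast : ℤ → ZMod 2) h5
  · have hf5 : f.natDegree = 4 := by omega
    have e1 := deg2 h.le
    have e2 := deg4 hf5.le
    rw [coeff_monic hg h] at e1
    rw [coeff_monic hf hf5] at e2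
    rw [e1, e2] at hfg
    generalize g.coeff 0 = a at hfg
    generalize g.coeff 1 = b at hfg
    generalize f.coeff 0 = c0 at hfg
    generalize f.coeff 1 = c1 at hfg
    generalize f.coeff 2 = c2 at hfg
    generalize f.coeff 3 = c3 at hfg
    have := coeffs6 (a0 := a * c0) (a1 := a * c1 + b * c0) (a2 := a * c2 + b * c1 + c0)
      (a3 := a * c3 + b * c2 + c1)
      (a4 := a + b * c3 + c2) (a5 := b + c3) (a6 := 1) (b0 := 5) (b1 := -10) (b2 := 17) (b3 := -14)
      (b4 := 10) (b5 := -4) (b6 := 1) (by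
        unfold gP at hfg
        simp only [map_add, map_mul, map_one, map_neg, C_ofNat] at hfg ⊢
        linear_combination hfg)
    obtain ⟨h0, h1, h2, h3, h4, h5, -⟩ := this
    refine no_factor_two a b c0 c1 c2 c3 ⟨?_, ?_, ?_, ?_, ?_, ?_⟩
    · exact_mod_cast congrArg (Int.cast : ℤ → ZMod 2) h0
    · exact_mod_cast congrArg (Int.cast : ℤ → ZMod 2) h1
    · exact_mod_cast congrArg (Int.cast : ℤ → ZMod 2) h2
    · exact_mod_cast congrArg (Int.cast : ℤ → ZMod 2) h3
    · exact_mod_cast congrArg (Int.cast : ℤ → ZMod 2) h4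
    · exact_mod_cast congrArg (Int.cast : ℤ → ZMod 2) h5
  · have hf5 : f.natDegree = 3 := by omega
    have e1 := deg3 h.le
    have e2 := deg3 hf5.le
    rw [coeff_monic hg h] at e1
    rw [coeff_monic hf hf5] at e2
    rw [e1, e2] at hfg
    generalize g.coeff 0 = a at hfg
    generalize g.coeff 1 = b at hfg
    generalize g.coeff 2 = c at hfg
    generalize f.coeff 0 = d at hfg
    generalize f.coeff 1 = e at hfg
    generalize f.coeff 2 = f at hfg
    have := coeffs6 (a0 := a * d) (a1 := a * e + b * d) (a2 := a * f + b * e + c * d)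
      (a3 := a + b * f + c * e + d)
      (a4 := b + c * f + e) (a5 := c + f) (a6 := 1) (b0 := 5) (b1 := -10) (b2 := 17) (b3 := -14)
      (b4 := 10) (b5 := -4) (b6 := 1) (by
        unfold gP at hfg
        simp only [map_add, map_mul, map_one, map_neg, C_ofNat] at hfg ⊢
        linear_combination hfg)
    obtain ⟨h0, h1, h2, h3, h4, h5, -⟩ := this
    refine no_factor_three a b c d e f ⟨?_, ?_, ?_, ?_, ?_, ?_⟩
    · exact_mod_cast congrArg (Int.cast : ℤ → ZMod 3) h0
    · exact_mod_cast congrArg (Int.cast : ℤ → ZMod 3) h1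
    · exact_mod_cast congrArg (Int.cast : ℤ → ZMod 3) h2
    · exact_mod_cast congrArg (Int.cast : ℤ → ZMod 3) h3
    · exact_mod_cast congrArg (Int.cast : ℤ → ZMod 3) h4
    · exact_mod_cast congrArg (Int.cast : ℤ → ZMod 3) h5

lemma gP_irreducible : Irreducible (gP ℚ) := by
  have := (gP_monic ℤ).irreducible_iff_irreducible_map_fraction_map (K := ℚ)
  rw [gP_map] at this
  exact this.1 gP_irreducible_int

end N3M2

open Polynomial NumberField

namespace N3M2

/-- The sextic field, presented by a generator `θ` and a square root `I` of `-1`. -/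
structure Dat (L : Type) [Field L] [NumberField L] where
  θ : 𝓞 L
  I : 𝓞 L
  hI : I ^ 2 = -1
  hG : θ ^ 3 + (-2 + 2 * I) * θ ^ 2 + (1 - 2 * I) * θ + (-1 + 2 * I) = 0
  hfin : Module.finrank ℚ L = 6
  hpoly : ∀ a0 a1 a2 a3 a4 a5 : ℚ, (a0 : L) + a1 * (θ : L) + a2 * (θ : L) ^ 2 + a3 * (θ : L) ^ 3
    + a4 * (θ : L) ^ 4 + a5 * (θ : L) ^ 5 = 0 →
    a0 = 0 ∧ a1 = 0 ∧ a2 = 0 ∧ a3 = 0 ∧ a4 = 0 ∧ a5 = 0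

instance : Fact (Irreducible (gP ℚ)) := ⟨gP_irreducible⟩

/-- the field itself -/
abbrev KK : Type := AdjoinRoot (gP ℚ)

lemma KK_finrank : Module.finrank ℚ KK = 6 := by
  rw [(AdjoinRoot.powerBasis (gP_irreducible.ne_zero)).finrank, AdjoinRoot.powerBasis_dim,
    gP_natDegree]

instance : FiniteDimensional ℚ KK :=
  Module.finite_of_finrank_pos (by rw [KK_finrank]; norm_num)

instance : NumberField KK where
  to_charZero := charZero_of_injective_algebraMap (algebraMap ℚ KK).injective
  to_finiteDimensional := inferInstance

lemma KK_poly (p : ℚ[X]) (hp : p.natDegree ≤ 5)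
    (h : p.eval₂ (AdjoinRoot.of (gP ℚ)) (AdjoinRoot.root (gP ℚ)) = 0) : p = 0 := by
  rw [← AdjoinRoot.algebraMap_eq, ← aeval_def, AdjoinRoot.aeval_eq, AdjoinRoot.mk_eq_zero] at h
  by_contra h0
  have := natDegree_le_of_dvd h h0
  rw [gP_natDegree] at this
  omega

lemma map_two' {L : Type} [Field L] [NumberField L] : algebraMap (𝓞 L) L 2 = 2 := map_ofNat _ 2

lemma mk_dat {L : Type} [Field L] [NumberField L] (t : L) (hroot : (gP L).eval t = 0)
    (hfin : Module.finrank ℚ L = 6)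
    (hpoly : ∀ p : ℚ[X], p.natDegree ≤ 5 → p.eval₂ (Rat.castHom L) t = 0 → p = 0) :
    Nonempty (Dat L) := by
  have hp' (a0 a1 a2 a3 a4 a5 : ℚ) (h : (a0 : L) + a1 * t +
    a2 * t ^ 2 + a3 * t ^ 3 + a4 * t ^ 4 + a5 * t ^ 5 = 0) :
    a0 = 0 ∧ a1 = 0 ∧ a2 = 0 ∧ a3 = 0 ∧ a4 = 0 ∧ a5 = 0 := by
    have := hpoly (C a0 + C a1 * X + C a2 * X ^ 2 + C a3 * X ^ 3 + C a4 * X ^ 4 + C a5 * X ^ 5)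
      (by compute_degree) (by simpa using h)
    have := coeffs6 (a0 := a0) (a1 := a1) (a2 := a2) (a3 := a3) (a4 := a4) (a5 := a5) (a6 := 0)
      (b0 := 0) (b1 := 0) (b2 := 0) (b3 := 0) (b4 := 0) (b5 := 0) (b6 := 0) (by simp [this])
    tauto
  have hg : t ^ 6 - 4 * t ^ 5 + 10 * t ^ 4 - 14 * t ^ 3 + 17 * t ^ 2 - 10 * t + 5 = 0 := by
    simpa [gP] using hroot
  have hq : (2 : L) * (t ^ 2 - t + 1) ≠ 0 := by
    intro h
    have := hp' 2 (-2) 2 0 0 0 (by push_cast; linear_combination h)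
    norm_num at this
  set i : L := -(t ^ 3 - 2 * t ^ 2 + t - 1) / (2 * (t ^ 2 - t + 1)) with hi
  have hii : i * (2 * (t ^ 2 - t + 1)) = -(t ^ 3 - 2 * t ^ 2 + t - 1) := by
    rw [hi]; exact div_mul_cancel₀ _ hq
  have hi2 : i ^ 2 = -1 := by
    have : (i ^ 2 + 1) * (2 * (t ^ 2 - t + 1)) ^ 2 = 0 := by
      linear_combination (i * (2 * (t ^ 2 - t + 1)) - (t ^ 3 - 2 * t ^ 2 + t - 1)) * hii + hg
    have := (mul_eq_zero.1 this).resolve_right (pow_ne_zero _ hq)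
    linear_combination this
  have tint : IsIntegral ℤ t := by
    refine ⟨gP ℤ, gP_monic ℤ, ?_⟩
    rw [← eval_map, gP_map]; exact hroot
  have iint : IsIntegral ℤ i := by
    refine ⟨X ^ 2 + 1, by monicity!, ?_⟩
    simp [hi2]
  obtain ⟨t', ht'⟩ : ∃ t' : 𝓞 L, (t' : L) = t := ⟨⟨t, tint⟩, rfl⟩
  obtain ⟨i', hi'⟩ : ∃ i' : 𝓞 L, (i' : L) = i := ⟨⟨i, iint⟩, rfl⟩
  refine ⟨⟨t', i', ?_, ?_, hfin, ?_⟩⟩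
  · apply RingOfIntegers.ext; simpa [hi'] using hi2
  · apply RingOfIntegers.ext
    have : t ^ 3 + (-2 + 2 * i) * t ^ 2 + (1 - 2 * i) * t + (-1 + 2 * i) = 0 := by
      linear_combination hii
    simpa [map_two', hi', ht'] using this
  · intro a0 a1 a2 a3 a4 a5 h
    rw [ht'] at h
    exact hp' a0 a1 a2 a3 a4 a5 h

lemma exists_dat : Nonempty (Dat KK) := by
  refine mk_dat (AdjoinRoot.root (gP ℚ)) ?_ KK_finrank ?_
  · have := AdjoinRoot.eval₂_root (gP ℚ)
    rwa [← eval_map, gP_map] at this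
  · intro p hp h
    refine KK_poly p hp ?_
    rw [← h]
    congr 1

namespace Dat

variable {L : Type} [Field L] [NumberField L] (D : Dat L)

lemma hI' : (D.I : L) ^ 2 = -1 := by
  have := congrArg (algebraMap (𝓞 L) L) D.hI
  simpa using this

lemma hG' : (D.θ : L) ^ 3 + (-2 + 2 * D.I) * (D.θ : L) ^ 2 + (1 - 2 * D.I) * (D.θ : L)
    + (-1 + 2 * D.I) = 0 := by
  have := congrArg (algebraMap (𝓞 L) L) D.hG
  simpa [map_two'] using this

/-- elements of the order, as a vector -/
noncomputable def v : Fin 6 → 𝓞 L :=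
  ![1, D.θ, D.θ ^ 2, D.I, D.I * D.θ, D.I * D.θ ^ 2]

lemma indep (a0 a1 a2 b0 b1 b2 : ℚ) (h : (a0 : L) + a1 * (D.θ : L) + a2 * (D.θ : L) ^ 2
    + b0 * (D.I : L) + b1 * ((D.I : L) * (D.θ : L)) + b2 * ((D.I : L) * (D.θ : L) ^ 2) = 0) :
    a0 = 0 ∧ a1 = 0 ∧ a2 = 0 ∧ b0 = 0 ∧ b1 = 0 ∧ b2 = 0 := by
  have hG := D.hG'
  have := D.hpoly (2 * a0 + b0) (2 * a1 - 2 * a0 - b0 + b1) (2 * a2 - 2 * a1 + 2 * a0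
     + 2 * b0 - b1 + b2)
    (2 * a1 - 2 * a2 - b0 + 2 * b1 - b2) (2 * a2 - b1 + 2 * b2) (-b2) (by
      push_cast
      linear_combination (2 * ((D.θ : L) ^ 2 - D.θ + 1)) * h -
        (b0 + b1 * (D.θ : L) + b2 * (D.θ : L) ^ 2) * hG)
  obtain ⟨h0, h1, h2, h3, h4, h5⟩ := this
  have e5 : b2 = 0 := by linarith
  subst e5
  refine ⟨?_, ?_, ?_, ?_, ?_, rfl⟩ <;> linarith

lemma indep_v : LinearIndependent ℚ (fun i => (D.v i : L)) := by
  rw [Fintype.linearIndependent_iff]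
  intro g hg
  simp only [Fin.sum_univ_six, v] at hg
  have := D.indep (g 0) (g 1) (g 2) (g 3) (g 4) (g 5) (by
    simpa [Algebra.smul_def] using hg)
  obtain ⟨h0, h1, h2, h3, h4, h5⟩ := this
  intro i
  fin_cases i <;> assumption

noncomputable def b : Module.Basis (Fin 6) ℚ L :=
  basisOfLinearIndependentOfCardEqFinrank D.indep_v (by rw [D.hfin]; rfl)

lemma b_apply (i : Fin 6) : D.b i = D.v i := by
  simp [b]

end Dat

end N3M2

open Polynomial NumberField

namespace N3M2

def MT : Matrix (Fin 6) (Fin 6) ℤ :=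
  !![0, 0, 1, 0, 0, 2;
     1, 0, -1, 0, 0, -2;
     0, 1, 2, 0, 0, 2;
     0, 0, -2, 0, 0, 1;
     0, 0, 2, 1, 0, -1;
     0, 0, -2, 0, 1, 2]

def MI : Matrix (Fin 6) (Fin 6) ℤ :=
  !![0, 0, 0, -1, 0, 0;
     0, 0, 0, 0, -1, 0;
     0, 0, 0, 0, 0, -1;
     1, 0, 0, 0, 0, 0;
     0, 1, 0, 0, 0, 0;
     0, 0, 1, 0, 0, 0]

/-- matrices of the basis elements -/
def MV : Fin 6 → Matrix (Fin 6) (Fin 6) ℤ :=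
  ![1, MT, MT ^ 2, MI, MI * MT, MI * MT ^ 2]

def TM : Matrix (Fin 6) (Fin 6) ℤ := Matrix.of fun i j => (MV i * MV j).trace

lemma TM_eq : TM = !![6, 4, -4, 0, 4, 8;
     4, -4, -14, 4, 8, 8;
     -4, -14, -28, 8, 8, 0;
     0, 4, 8, -6, -4, 4;
     4, 8, 8, -4, 4, 14;
     8, 8, 0, 4, 14, 28] := by decide +kernel

lemma TM_det : TM.det = -106560 := by
  rw [TM_eq]; decide +kernel

namespace Dat

variable {L : Type} [Field L] [NumberField L] (D : Dat L)

/-- matrix of multiplication, as a ring hom -/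
noncomputable def lm : L →ₐ[ℚ] Matrix (Fin 6) (Fin 6) ℚ := Algebra.leftMulMatrix D.b

lemma lm_eq (x : L) (M : Matrix (Fin 6) (Fin 6) ℤ)
    (h : ∀ j, x * D.b j = ∑ i, (M i j : ℚ) • D.b i) : D.lm x = M.map (Int.cast : ℤ → ℚ) := by
  ext i j
  rw [lm, Algebra.leftMulMatrix_eq_repr_mul, h, Module.Basis.repr_sum_self]
  rfl

lemma lm_θ : D.lm D.θ = MT.map (Int.cast : ℤ → ℚ) := by
  apply lm_eq
  have hG := D.hG'
  have hI := D.hI'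
  intro j
  simp only [b_apply, v, Fin.sum_univ_six]
  fin_cases j <;> simp [MT, Algebra.smul_def]
  · ring
  · linear_combination hG
  · ring
  · ring
  · linear_combination D.I * hG - (2*(D.θ:L)^2 - 2 * D.θ+2) * hI

lemma lm_I : D.lm D.I = MI.map (Int.cast : ℤ → ℚ) := by
  apply lm_eq
  have hI := D.hI'
  intro j
  simp only [b_apply, v, Fin.sum_univ_six]
  fin_cases j <;> simp [MI, Algebra.smul_def]
  · linear_combination hI
  · linear_combination D.θ * hI
  · linear_combination (D.θ : L) ^ 2 * hI

lemma map_int_mul (A B : Matrix (Fin 6) (Fin 6) ℤ) :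
    (A * B).map (Int.cast : ℤ → ℚ) = A.map (Int.cast : ℤ → ℚ) * B.map (Int.cast : ℤ → ℚ) :=
  (Int.castRingHom ℚ).mapMatrix.map_mul A B

lemma map_int_pow (A : Matrix (Fin 6) (Fin 6) ℤ) (n : ℕ) :
    (A ^ n).map (Int.cast : ℤ → ℚ) = A.map (Int.cast : ℤ → ℚ) ^ n :=
  (Int.castRingHom ℚ).mapMatrix.map_pow A n

lemma lm_v (i : Fin 6) : D.lm (D.v i) = (MV i).map (Int.cast : ℤ → ℚ) := by
  fin_cases i
  · simp [v, MV]
  · simpa [v, MV] using D.lm_θ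
  · simp [v, MV, map_int_pow, lm_θ]
  · simpa [v, MV] using D.lm_I
  · simp [v, MV, map_int_mul, lm_θ, lm_I]
  · simp [v, MV, map_int_mul, map_int_pow, lm_θ, lm_I]

lemma traceMatrix_b : Algebra.traceMatrix ℚ D.b = TM.map (Int.cast : ℤ → ℚ) := by
  ext i j
  rw [Algebra.traceMatrix_apply, Algebra.traceForm_apply, Algebra.trace_eq_matrix_trace D.b,
    b_apply, b_apply]
  change (D.lm _).trace = _
  rw [map_mul, lm_v, lm_v, ← map_int_mul]
  simp [TM, Matrix.trace]

lemma discr_b : Algebra.discr ℚ D.b = -106560 := by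
  rw [Algebra.discr_def, traceMatrix_b]
  have := (Int.castRingHom ℚ).map_det TM
  rw [TM_det] at this
  exact this.symm.trans (by norm_num)

lemma discr_le (D : Dat L) : |discr L| ≤ 106560 := by
  have card : Fintype.card (Module.Free.ChooseBasisIndex ℤ (𝓞 L)) = Fintype.card (Fin 6) := by
    rw [← Module.finrank_eq_card_chooseBasisIndex, RingOfIntegers.rank, D.hfin]; rfl
  let e := Fintype.equivOfCardEq card
  let b₀ : Module.Basis (Fin 6) ℤ (𝓞 L) := (RingOfIntegers.basis L).reindex e
  let P : Matrix (Fin 6) (Fin 6) ℤ := b₀.toMatrix D.v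
  have h1 : Algebra.discr ℤ D.v = P.det ^ 2 * discr L := by
    rw [← NumberField.discr_eq_discr L b₀, ← Algebra.discr_of_matrix_vecMul b₀ P,
      Module.Basis.toMatrix_map_vecMul]
  have h2 : Algebra.discr ℤ D.v = -106560 := by
    have : (Algebra.discr ℤ D.v : ℚ) = -106560 := by
      rw [← D.discr_b, Algebra.discr_def, Algebra.discr_def]
      change (Int.castRingHom ℚ) _ = _
      rw [(Int.castRingHom ℚ).map_det]
      congr 1
      ext i j
      simp only [RingHom.mapMatrix_apply, Matrix.map_apply, Algebra.traceMatrix_apply,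
        Algebra.traceForm_apply, b_apply, ← map_mul]
      exact Algebra.trace_localization ℤ (nonZeroDivisors ℤ) (Rₘ := ℚ) (Sₘ := L) (D.v i * D.v j) |>.symm
    exact_mod_cast this
  rw [h2] at h1
  have hne : P.det ≠ 0 := by
    rintro h; rw [h] at h1; norm_num at h1
  have : (1 : ℤ) ≤ P.det ^ 2 := by
    have := sq_pos_of_ne_zero hne |>.trans_eq' rfl
    omega
  have h3 : (106560 : ℤ) = P.det ^ 2 * |discr L| := by
    have := congrArg abs h1
    rw [abs_mul, abs_of_nonneg (sq_nonneg P.det)] at this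
    simpa using this
  nlinarith [abs_nonneg (discr L)]

lemma norm_eq (x : 𝓞 L) (M : Matrix (Fin 6) (Fin 6) ℤ) (h : D.lm x = M.map (Int.cast : ℤ → ℚ)) :
    Algebra.norm ℤ x = M.det := by
  have h1 : ((Algebra.norm ℤ x : ℤ) : ℚ) = Algebra.norm ℚ (x : L) := by
    exact (Algebra.coe_norm_int x)
  have h2 : Algebra.norm ℚ (x : L) = (M.det : ℚ) := by
    rw [Algebra.norm_eq_matrix_det D.b]
    change (D.lm x).det = _
    rw [h]
    exact ((Int.castRingHom ℚ).map_det M).symm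
  rw [h2] at h1
  exact_mod_cast h1

end Dat

end N3M2

open Polynomial NumberField NumberField.InfinitePlace

namespace N3M2

lemma field_cases (k : Type) [Field k] [Finite k] (N : ℕ) (hN : Nat.card k = N)
    (hN10 : N ≤ 10) (t i : k) (hi : i ^ 2 = -1)
    (hG : t ^ 3 + (-2 + 2 * i) * t ^ 2 + (1 - 2 * i) * t + (-1 + 2 * i) = 0) :
    (N = 8 ∧ 1 + i = 0) ∨ (N = 9 ∧ (t - i = 0 ∨ t * (1 - i) - 1 = 0)) ∨
      (N = 5 ∧ (t = 0 ∨ t - 1 = 0)) := by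
  have : Fintype k := Fintype.ofFinite k
  have hc : Fintype.card k = N := by rw [← hN, Nat.card_eq_fintype_card]
  have hpow : ∀ x : k, x ^ N = x := fun x => by rw [← hc]; exact FiniteField.pow_card x
  have hz : (N : k) = 0 := by rw [← hc]; exact FiniteField.cast_card_eq_zero k
  have hpp : IsPrimePow N := by
    obtain ⟨p, -, n, hp, h⟩ := FiniteField.card' k
    rw [hc] at h
    rw [isPrimePow_nat_iff]
    exact ⟨p, n, hp, n.2, h.symm⟩
  have hpt := hpow t
  have hpi := hpow i
  have h2 : (2 : k) = 0 → 1 + i = 0 ∧ t ^ 3 + t + 1 = 0 := fun h => by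
    constructor
    · have : (1 + i) ^ 2 = 0 := by linear_combination hi + i * h
      exact pow_eq_zero_iff (two_ne_zero) |>.1 this
    · linear_combination hG - (-t ^ 2 + i * t ^ 2 - i * t - 1 + i) * h
  clear hpow hc
  have hcases : N = 2 ∨ N = 3 ∨ N = 4 ∨ N = 5 ∨ N = 7 ∨ N = 8 ∨ N = 9 := by
    clear hpt hpi hz hN
    revert hpp
    interval_cases N <;> first | decide | (intro _; norm_num)
  rcases hcases with rfl | rfl | rfl | rfl | rfl | rfl | rfl
  · exfalso
    obtain ⟨h3, h4⟩ := h2 (by exact_mod_cast hz)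
    have hz : (2 : k) = 0 := by exact_mod_cast hz
    have : (1 : k) = 0 := by linear_combination h4 - (t + 1) * hpt - t * hz
    exact one_ne_zero this
  · exfalso
    have hz : (3 : k) = 0 := by exact_mod_cast hz
    have : (1 : k) = 0 := by linear_combination hz - i * hpi + (i ^ 2 - 1) * hi - hi
    exact one_ne_zero this
  · exfalso
    have h4 : (2 : k) * 2 = 0 := by norm_num; exact_mod_cast hz
    have hz : (2 : k) = 0 := by simpa using h4
    obtain ⟨h3, h4⟩ := h2 hz
    have ht : t ^ 2 = 0 := by linear_combination t * h4 - hpt - t * hz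
    have ht : t = 0 := by simpa using ht
    rw [ht] at h4
    simp at h4
  · right; right
    refine ⟨rfl, ?_⟩
    have hz : (5 : k) = 0 := by exact_mod_cast hz
    have h1 : (i - 2) * (i - 3) = 0 := by linear_combination hi + (1 - i) * hz
    rcases mul_eq_zero.1 h1 with h | h
    · exfalso
      have hi2 : i = 2 := by linear_combination h
      subst hi2
      have : (1 : k) = 0 := by
        linear_combination (t + 3 * t ^ 2) * hpt + (-18 + 7 * t - 4 * t ^ 2 + 5 * t ^ 3
          - 3 * t ^ 4) * hG + ((-18 + 7 * t - 4 * t ^ 2 + 5 * t ^ 3 - 3 * t ^ 4) * t + 11 + 3 * t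
          + 7 * t ^ 2) * hz
      exact one_ne_zero this
    · have hi2 : i = 3 := by linear_combination h
      subst hi2
      have : t ^ 2 * (t - 1) = 0 := by linear_combination hG + (-t ^ 2 + t - 1) * hz
      rcases mul_eq_zero.1 this with h | h
      · left; simpa using h
      · right; exact h
  · exfalso
    have hz : (7 : k) = 0 := by exact_mod_cast hz
    have : (1 : k) = 0 := by
      linear_combination hz - 3 * (i * hpi - (i ^ 6 - i ^ 4 + i ^ 2 - 1) * hi + hi)
    exact one_ne_zero this
  · left
    have h4 : (2 : k) * (2 * 2) = 0 := by norm_num; exact_mod_cast hz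
    have hz : (2 : k) = 0 := by simpa using h4
    exact ⟨rfl, (h2 hz).1⟩
  · right; left
    refine ⟨rfl, ?_⟩
    have h4 : (3 : k) * 3 = 0 := by norm_num; exact_mod_cast hz
    have hz : (3 : k) = 0 := by simpa using h4
    have : (t - i) ^ 2 * (t * (1 - i) - 1) = 0 := by
      linear_combination (1 - i) * hG + ((1 - i) * ((1 - i) * t ^ 2 - i) - (t - i) ^ 2) * hz +
        ((t - i) ^ 2 + (1 - i) * (-t + 1 + i)) * hi
    rcases mul_eq_zero.1 this with h | h
    · left; simpa using h
    · right; exact h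

def NM1 : Matrix (Fin 6) (Fin 6) ℤ := 1 + MI
def NM2 : Matrix (Fin 6) (Fin 6) ℤ := MT - MI
def NM3 : Matrix (Fin 6) (Fin 6) ℤ := MT * (1 - MI) - 1
lemma NM1_eq : NM1 = !![1, 0, 0, -1, 0, 0;
     0, 1, 0, 0, -1, 0;
     0, 0, 1, 0, 0, -1;
     1, 0, 0, 1, 0, 0;
     0, 1, 0, 0, 1, 0;
     0, 0, 1, 0, 0, 1] := by decide +kernel
lemma NM1_det : NM1.det = 8 := by rw [NM1_eq]; decide +kernel
lemma NM2_eq : NM2 = !![0, 0, 1, 1, 0, 2;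
     1, 0, -1, 0, 1, -2;
     0, 1, 2, 0, 0, 3;
     -1, 0, -2, 0, 0, 1;
     0, -1, 2, 1, 0, -1;
     0, 0, -3, 0, 1, 2] := by decide +kernel
lemma NM2_det : NM2.det = 9 := by rw [NM2_eq]; decide +kernel
lemma NM3_eq : NM3 = !![-1, 0, -1, 0, 0, 3;
     1, -1, 1, 1, 0, -3;
     0, 1, -1, 0, 1, 4;
     0, 0, -3, -1, 0, -1;
     -1, 0, 3, 1, -1, 1;
     0, -1, -4, 0, 1, -1] := by decide +kernel
lemma NM3_det : NM3.det = 9 := by rw [NM3_eq]; decide +kernel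
lemma MT_det : MT.det = 5 := by decide +kernel
lemma MT1_eq : MT - 1 = !![-1, 0, 1, 0, 0, 2;
     1, -1, -1, 0, 0, -2;
     0, 1, 1, 0, 0, 2;
     0, 0, -2, -1, 0, 1;
     0, 0, 2, 1, -1, -1;
     0, 0, -2, 0, 1, 1] := by decide +kernel
lemma MT1_det : (MT - 1).det = 5 := by rw [MT1_eq]; decide +kernel

namespace Dat

variable {L : Type} [Field L] [NumberField L] (D : Dat L)

lemma map_int_add (A B : Matrix (Fin 6) (Fin 6) ℤ) :
    (A + B).map (Int.cast : ℤ → ℚ) = A.map (Int.cast : ℤ → ℚ) + B.map (Int.cast : ℤ → ℚ) :=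
  (Int.castRingHom ℚ).mapMatrix.map_add A B

lemma map_int_sub (A B : Matrix (Fin 6) (Fin 6) ℤ) :
    (A - B).map (Int.cast : ℤ → ℚ) = A.map (Int.cast : ℤ → ℚ) - B.map (Int.cast : ℤ → ℚ) :=
  (Int.castRingHom ℚ).mapMatrix.map_sub A B

lemma map_int_one : (1 : Matrix (Fin 6) (Fin 6) ℤ).map (Int.cast : ℤ → ℚ) = 1 :=
  (Int.castRingHom ℚ).mapMatrix.map_one

lemma norm1 : Algebra.norm ℤ (1 + D.I) = 8 := by
  rw [D.norm_eq _ NM1 (by simp [NM1, map_int_add, lm_I]), NM1_det]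

lemma norm2 : Algebra.norm ℤ (D.θ - D.I) = 9 := by
  rw [D.norm_eq _ NM2 (by simp [NM2, map_int_sub, lm_I, lm_θ]), NM2_det]

lemma norm3 : Algebra.norm ℤ (D.θ * (1 - D.I) - 1) = 9 := by
  rw [D.norm_eq _ NM3 (by simp [NM3, map_int_sub, map_int_mul, lm_I, lm_θ]), NM3_det]

lemma norm4 : Algebra.norm ℤ D.θ = 5 := by
  rw [D.norm_eq _ MT (by simp [lm_θ]), MT_det]

lemma norm5 : Algebra.norm ℤ (D.θ - 1) = 5 := by
  rw [D.norm_eq _ (MT - 1) (by simp [map_int_sub, lm_θ]), MT1_det]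

lemma principal_of (P : Ideal (𝓞 L)) (x : 𝓞 L) (hx : x ∈ P)
    (hN : (Ideal.absNorm P : ℤ) = Algebra.norm ℤ x) (h0 : Ideal.absNorm P ≠ 0) :
    Submodule.IsPrincipal P := by
  have h1 : Ideal.span {x} ≤ P := (Ideal.span_singleton_le_iff_mem P).2 hx
  obtain ⟨J, hJ⟩ := Ideal.dvd_iff_le.2 h1
  have h2 : Ideal.absNorm (Ideal.span {x}) = Ideal.absNorm P := by
    rw [Ideal.absNorm_span_singleton, ← hN]; rfl
  rw [hJ, map_mul] at h2
  have h3 : Ideal.absNorm J = 1 := by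
    exact Nat.eq_of_mul_eq_mul_left (Nat.pos_of_ne_zero h0) (by rw [h2, mul_one])
  rw [Ideal.absNorm_eq_one_iff] at h3
  rw [h3, Ideal.mul_top] at hJ
  exact ⟨⟨x, hJ.symm⟩⟩

lemma totallyComplex (D : Dat L) : nrRealPlaces L = 0 := by
  rw [nrRealPlaces_eq_zero_iff, isTotallyComplex_iff]
  intro v
  by_contra h
  rw [not_isComplex_iff_isReal] at h
  have := D.hI'
  have h2 := congrArg (embedding_of_isReal h) this
  simp only [map_pow, map_neg, map_one] at h2
  nlinarith [sq_nonneg (embedding_of_isReal h (D.I : L))]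

lemma nrComplex (D : Dat L) : nrComplexPlaces L = 3 := by
  have := card_add_two_mul_card_eq_rank L
  rw [D.totallyComplex, D.hfin] at this
  omega

lemma pid (D : Dat L) : IsPrincipalIdealRing (𝓞 L) := by
  apply RingOfIntegers.isPrincipalIdealRing_of_isPrincipal_of_norm_le_of_isPrime
  intro P hP hN
  have hd : |(discr L : ℝ)| ≤ 106560 := by exact_mod_cast D.discr_le
  rw [D.hfin, D.nrComplex] at hN
  have hlt : (Ideal.absNorm (P : Ideal (𝓞 L)) : ℝ) < 11 := by
    refine hN.trans_lt ?_
    have h1 : √|(discr L : ℝ)| ≤ 327 := by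
      rw [Real.sqrt_le_left (by norm_num)]; linarith
    have h2 : 4 / Real.pi ≤ 4 / 3.14 := by
      have := Real.pi_gt_d2
      gcongr
    have h3 : (4 / Real.pi) ^ 3 ≤ (4 / 3.14) ^ 3 := by
      have := Real.pi_pos
      gcongr
    have h4 : (((Nat.factorial 6 : ℕ) : ℝ)) / ((6 : ℕ) : ℝ) ^ 6 = 720 / 46656 := by
      norm_num [Nat.factorial]
    rw [h4]
    calc (4 / Real.pi) ^ 3 * (720 / 46656 * √|(discr L : ℝ)|)
        ≤ (4 / 3.14) ^ 3 * (720 / 46656 * 327) := by gcongr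
      _ < 11 := by norm_num
  have hle : Ideal.absNorm (P : Ideal (𝓞 L)) ≤ 10 := by
    have : Ideal.absNorm (P : Ideal (𝓞 L)) < 11 := by exact_mod_cast hlt
    omega
  have hP0 : (P : Ideal (𝓞 L)) ≠ ⊥ := nonZeroDivisors.coe_ne_zero P
  have hmax : (P : Ideal (𝓞 L)).IsMaximal := hP.isMaximal hP0
  have h0 : Ideal.absNorm (P : Ideal (𝓞 L)) ≠ 0 := by
    rw [Ne, Ideal.absNorm_eq_zero_iff]; exact hP0
  have hfin : Finite (𝓞 L ⧸ (P : Ideal (𝓞 L))) := (Ideal.absNorm_ne_zero_iff _).1 h0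
  let _ := Ideal.Quotient.field (P : Ideal (𝓞 L))
  let φ := Ideal.Quotient.mk (P : Ideal (𝓞 L))
  have key := field_cases (𝓞 L ⧸ (P : Ideal (𝓞 L))) (Ideal.absNorm (P : Ideal (𝓞 L))) rfl hle
    (φ D.θ) (φ D.I) (by rw [← map_pow, D.hI]; simp)
    (by have := congrArg φ D.hG; simpa [map_ofNat] using this)
  have hmem : ∀ x, φ x = 0 → x ∈ (P : Ideal (𝓞 L)) := fun x hx => Ideal.Quotient.eq_zero_iff_mem.1 hx
  rcases key with ⟨h, h1⟩ | ⟨h, h1 | h1⟩ | ⟨h, h1 | h1⟩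
  · exact principal_of _ (1 + D.I) (hmem _ (by simpa using h1)) (by rw [h, norm1]; rfl) h0
  · exact principal_of _ (D.θ - D.I) (hmem _ (by simpa using h1)) (by rw [h, norm2]; rfl) h0
  · exact principal_of _ (D.θ * (1 - D.I) - 1) (hmem _ (by simpa using h1))
      (by rw [h, norm3]; rfl) h0
  · exact principal_of _ D.θ (hmem _ (by simpa using h1)) (by rw [h, norm4]; rfl) h0
  · exact principal_of _ (D.θ - 1) (hmem _ (by simpa using h1)) (by rw [h, norm5]; rfl) h0

end Dat

end N3M2

open Polynomial NumberField NumberField.InfinitePlace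

namespace N3M2

namespace Dat

variable {L : Type} [Field L] [NumberField L] (D : Dat L)

/-- an element of the order with given coordinates -/
noncomputable def vec (a0 a1 a2 a3 a4 a5 : ℤ) : 𝓞 L :=
  a0 + a1 * D.θ + a2 * D.θ ^ 2 + a3 * D.I + a4 * (D.I * D.θ) + a5 * (D.I * D.θ ^ 2)

lemma θ3 : D.θ ^ 3 = (2 - 2 * D.I) * D.θ ^ 2 + (2 * D.I - 1) * D.θ + (1 - 2 * D.I) := by
  linear_combination D.hG

lemma θ4 : D.θ ^ 4 = -2 + 3 * D.θ - D.θ ^ 2 - 6 * D.I + 4 * (D.I * D.θ) - 6 * (D.I * D.θ ^ 2) := by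
  linear_combination D.θ * D.θ3 + (2 - 2 * D.I) * D.θ3 + (4 * D.θ ^ 2 - 4 * D.θ + 4) * D.hI

lemma vec_mul (a0 a1 a2 a3 a4 a5 b0 b1 b2 b3 b4 b5 : ℤ) :
    D.vec a0 a1 a2 a3 a4 a5 * D.vec b0 b1 b2 b3 b4 b5 = D.vec
      (a0 * b0 + a1 * b2 + 2 * a1 * b5 + a2 * b1 - 2 * a2 * b2 + 2 * a2 * b4 + 6 * a2 * b5 - a3
      * b3 + 2 * a4 * b2 - a4 * b5 + 2 * a5 * b1 + 6 * a5 * b2 - a5 * b4 + 2 * a5 * b5)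
      (a0 * b1 + a1 * b0 - a1 * b2 - 2 * a1 * b5 - a2 * b1 + 3 * a2 * b2 - 2 * a2 * b4 - 4 * a2
      * b5 - a3 * b4 - 2 * a4 * b2 - a4 * b3 + a4 * b5 - 2 * a5 * b1 - 4 * a5 * b2 + a5 * b4 -
      3 * a5 * b5)
      (a0 * b2 + a1 * b1 + 2 * a1 * b2 + 2 * a1 * b5 + a2 * b0 + 2 * a2 * b1 - a2 * b2 + 2 * a2
      * b4 + 6 * a2 * b5 - a3 * b5 + 2 * a4 * b2 - a4 * b4 - 2 * a4 * b5 + 2 * a5 * b1 + 6 * a5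
      * b2 - a5 * b3 - 2 * a5 * b4 + a5 * b5)
      (a0 * b3 - 2 * a1 * b2 + a1 * b5 - 2 * a2 * b1 - 6 * a2 * b2 + a2 * b4 - 2 * a2 * b5 + a3
      * b0 + a4 * b2 + 2 * a4 * b5 + a5 * b1 - 2 * a5 * b2 + 2 * a5 * b4 + 6 * a5 * b5)
      (a0 * b4 + 2 * a1 * b2 + a1 * b3 - a1 * b5 + 2 * a2 * b1 + 4 * a2 * b2 - a2 * b4 + 3 * a2
      * b5 + a3 * b1 + a4 * b0 - a4 * b2 - 2 * a4 * b5 - a5 * b1 + 3 * a5 * b2 - 2 * a5 * b4 -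
      4 * a5 * b5)
      (a0 * b5 - 2 * a1 * b2 + a1 * b4 + 2 * a1 * b5 - 2 * a2 * b1 - 6 * a2 * b2 + a2 * b3 + 2
      * a2 * b4 - a2 * b5 + a3 * b2 + a4 * b1 + 2 * a4 * b2 + 2 * a4 * b5 + a5 * b0 + 2 * a5 *
      b1 - a5 * b2 + 2 * a5 * b4 + 6 * a5 * b5) := by
  have h3 := D.θ3
  have h4 := D.θ4
  have hI := D.hI
  unfold vec
  push_cast
  linear_combination (a1 * b2 + a2 * b1 - a4 * b5 - a5 * b4
      + D.I * (a1 * b5 + a2 * b4 + a4 * b2 + a5 * b1)) * h3 +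
    (a2 * b2 - a5 * b5 + D.I * (a2 * b5 + a5 * b2)) * h4 +
    ((a3 + a4 * D.θ + a5 * D.θ ^ 2) * (b3 + b4 * D.θ + b5 * D.θ ^ 2)
      + (a1 * b5 + a2 * b4 + a4 * b2 + a5 * b1) * (-2 * D.θ ^ 2 + 2 * D.θ - 2)
      + (a2 * b5 + a5 * b2) * (-6 + 4 * D.θ - 6 * D.θ ^ 2)) * hI

lemma zero_eq : (0 : 𝓞 L) = D.vec 0 0 0 0 0 0 := by simp [vec]
lemma one_eq : (1 : 𝓞 L) = D.vec 1 0 0 0 0 0 := by simp [vec]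

lemma vec_sub (a0 a1 a2 a3 a4 a5 b0 b1 b2 b3 b4 b5 : ℤ) :
    D.vec a0 a1 a2 a3 a4 a5 - D.vec b0 b1 b2 b3 b4 b5 =
      D.vec (a0 - b0) (a1 - b1) (a2 - b2) (a3 - b3) (a4 - b4) (a5 - b5) := by
  unfold vec; push_cast; ring

noncomputable def uI : (𝓞 L)ˣ where
  val := D.I
  inv := -D.I
  val_inv := by linear_combination -D.hI
  inv_val := by linear_combination -D.hI

noncomputable def u1 : (𝓞 L)ˣ where
  val := D.vec 0 1 0 1 0 0
  inv := D.vec 2 (-2) 1 0 1 0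
  val_inv := by rw [vec_mul, D.one_eq]; norm_num
  inv_val := by rw [vec_mul, D.one_eq]; norm_num

noncomputable def u2 : (𝓞 L)ˣ where
  val := D.vec (-1) 1 0 1 0 0
  inv := D.vec 0 (-1) 0 1 (-1) 1
  val_inv := by rw [vec_mul, D.one_eq]; norm_num
  inv_val := by rw [vec_mul, D.one_eq]; norm_num

lemma two_eq : (2 : 𝓞 L) = (1 + D.I) ^ 2 * (-D.I) := by
  linear_combination (D.I + 2) * D.hI

lemma not_unit : ¬ (1 + D.I) ∣ 1 := by
  intro h
  have := map_dvd (Algebra.norm ℤ) h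
  rw [D.norm1, map_one] at this
  norm_num at this

lemma span_maximal : (Ideal.span {1 + D.I}).IsMaximal ∧ Ideal.absNorm (Ideal.span {1 + D.I}) = 8 := by
  have h8 : Ideal.absNorm (Ideal.span {1 + D.I}) = 8 := by
    rw [Ideal.absNorm_span_singleton, D.norm1]; rfl
  refine ⟨?_, h8⟩
  obtain ⟨P, hmax, hle⟩ := Ideal.exists_le_maximal (Ideal.span {1 + D.I}) (by
    intro h
    rw [h, Ideal.absNorm_top] at h8
    norm_num at h8)
  have hdvd := Ideal.absNorm_dvd_absNorm_of_le hle
  rw [h8] at hdvd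
  have hN8 : Ideal.absNorm P ≤ 8 := Nat.le_of_dvd (by norm_num) hdvd
  have h0 : Ideal.absNorm P ≠ 0 := by
    rintro h; rw [h] at hdvd; norm_num at hdvd
  have hfin : Finite (𝓞 L ⧸ P) := (Ideal.absNorm_ne_zero_iff _).1 h0
  let _ := Ideal.Quotient.field P
  let φ := Ideal.Quotient.mk P
  have key := field_cases (𝓞 L ⧸ P) (Ideal.absNorm P) rfl (by omega)
    (φ D.θ) (φ D.I) (by rw [← map_pow, D.hI]; simp)
    (by have := congrArg φ D.hG; simpa [map_ofNat] using this)
  have hP : Ideal.absNorm P = 8 := by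
    rcases key with h | h | h
    · exact h.1
    · omega
    · rw [h.1] at hdvd; norm_num at hdvd
  obtain ⟨J, hJ⟩ := Ideal.dvd_iff_le.2 hle
  have h2 := h8
  rw [hJ, map_mul, hP] at h2
  have h3 : Ideal.absNorm J = 1 := by omega
  rw [Ideal.absNorm_eq_one_iff] at h3
  rw [hJ, h3, Ideal.mul_top]
  exact hmax

lemma pow8 (w : 𝓞 L) : ∃ s, w ^ 8 = w + (1 + D.I) * s := by
  obtain ⟨hmax, h8⟩ := D.span_maximal
  set P := Ideal.span {1 + D.I} with hP
  have hfin : Finite (𝓞 L ⧸ P) := (Ideal.absNorm_ne_zero_iff _).1 (by rw [h8]; norm_num)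
  let _ := Ideal.Quotient.field P
  let _ : Fintype (𝓞 L ⧸ P) := Fintype.ofFinite _
  have hc : Fintype.card (𝓞 L ⧸ P) = 8 := by
    rw [← Nat.card_eq_fintype_card]; exact h8
  have h := FiniteField.pow_card (Ideal.Quotient.mk P w)
  rw [hc, ← map_pow, Ideal.Quotient.eq, hP, Ideal.mem_span_singleton] at h
  obtain ⟨s, hs⟩ := h
  exact ⟨s, by linear_combination hs⟩

lemma sq_pow8 (D : Dat L) (w z : 𝓞 L) : ∃ r, (w ^ 2 + 2 * z) ^ 8 - (w ^ 2 + 2 * z) = 2 * r := by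
  obtain ⟨s, hs⟩ := D.pow8 w
  have h1 : ∃ r, (w ^ 2 + 2 * z) ^ 8 = (w ^ 2) ^ 8 + 2 * r := by
    have : (2 : 𝓞 L) ∣ (w ^ 2 + 2 * z) ^ 8 - (w ^ 2) ^ 8 :=
      dvd_trans ⟨z, by ring⟩ (sub_dvd_pow_sub_pow _ _ 8)
    obtain ⟨r, hr⟩ := this
    exact ⟨r, by linear_combination hr⟩
  obtain ⟨r, hr⟩ := h1
  refine ⟨r - z + (1 + D.I) * w * s + D.I * s ^ 2, ?_⟩
  rw [hr]
  linear_combination (w ^ 8 + w + (1 + D.I) * s) * hs + s ^ 2 * D.hI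

lemma pi_dvd_two : (1 + D.I) ∣ (2 : 𝓞 L) := ⟨1 - D.I, by linear_combination D.hI⟩

lemma h2rel : (1 + D.I) ∣ D.θ ^ 3 + D.θ + 1 := by
  have : D.θ ^ 3 + D.θ + 1 = 2 * (D.θ ^ 2 - D.I * D.θ ^ 2 + D.I * D.θ + 1 - D.I) := by
    linear_combination D.hG
  rw [this]; exact D.pi_dvd_two.mul_right _

lemma even_of_dvd (n0 n1 n2 : ℤ) (h : (1 + D.I) ∣ (n0 : 𝓞 L) + n1 * D.θ + n2 * D.θ ^ 2) :
    2 ∣ n0 ∧ 2 ∣ n1 ∧ 2 ∣ n2 := by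
  have e (n : ℤ) : ∃ r m : ℤ, n = r + 2 * m ∧ (r = 0 ∨ r = 1) :=
    ⟨n % 2, n / 2, by omega, by omega⟩
  obtain ⟨r0, m0, rfl, h0⟩ := e n0
  obtain ⟨r1, m1, rfl, h1⟩ := e n1
  obtain ⟨r2, m2, rfl, h2⟩ := e n2
  have h' : (1 + D.I) ∣ (r0 : 𝓞 L) + r1 * D.θ + r2 * D.θ ^ 2 := by
    have := h.sub (D.pi_dvd_two.mul_right (m0 + m1 * D.θ + m2 * D.θ ^ 2))
    convert this using 1
    push_cast; ring
  have hc := D.h2rel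
  have htwo := D.pi_dvd_two
  have hn := D.not_unit
  have H (x y z : 𝓞 L) (hx : ((r0 : 𝓞 L) + r1 * D.θ + r2 * D.θ ^ 2) * x
      + (D.θ ^ 3 + D.θ + 1) * y + 2 * z = 1) : False := by
    apply hn
    have := ((h'.mul_right x).add (hc.mul_right y)).add (htwo.mul_right z)
    rwa [hx] at this
  rcases h0 with rfl | rfl <;> rcases h1 with rfl | rfl <;> rcases h2 with rfl | rfl
  · exact ⟨⟨m0, by ring⟩, ⟨m1, by ring⟩, ⟨m2, by ring⟩⟩
  · exact (H (-D.θ ^ 2 - D.θ - 1) (D.θ + 1) (-D.θ) (by push_cast; ring)).elim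
  · exact (H (-D.θ ^ 2 - 1) 1 0 (by push_cast; ring)).elim
  · exact (H (-D.θ - 1) 1 (D.θ ^ 2 ) (by push_cast; ring)).elim
  · exact (H 1 0 0 (by push_cast; ring)).elim
  · exact (H (-D.θ) 1 0 (by push_cast; ring)).elim
  · exact (H (D.θ ^ 2 + D.θ) (-1) (1 - D.θ ^ 2) (by push_cast; ring)).elim
  · exact (H (D.θ ^ 2) (-D.θ - 1) (D.θ + 1) (by push_cast; ring)).elim

lemma vec_even (n0 n1 n2 n3 n4 n5 : ℤ) (r : 𝓞 L) (h : D.vec n0 n1 n2 n3 n4 n5 = 2 * r) :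
    2 ∣ n0 ∧ 2 ∣ n1 ∧ 2 ∣ n2 ∧ 2 ∣ n3 ∧ 2 ∣ n4 ∧ 2 ∣ n5 := by
  obtain ⟨a, b, c⟩ := D.even_of_dvd (n0 - n3) (n1 - n4) (n2 - n5) (by
    obtain ⟨s, hs⟩ := D.pi_dvd_two
    refine ⟨s * r - (n3 + n4 * D.θ + n5 * D.θ ^ 2), ?_⟩
    unfold vec at h
    push_cast
    linear_combination h + r * hs)
  obtain ⟨a', ha'⟩ := a
  obtain ⟨b', hb'⟩ := b
  obtain ⟨c', hc'⟩ := c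
  have e1 : n0 = n3 + 2 * a' := by omega
  have e2 : n1 = n4 + 2 * b' := by omega
  have e3 : n2 = n5 + 2 * c' := by omega
  subst e1 e2 e3
  obtain ⟨a, b, c⟩ := D.even_of_dvd n3 n4 n5 (by
    refine ⟨-D.I * (r - (a' + b' * D.θ + c' * D.θ ^ 2)), ?_⟩
    have hne : (1 + D.I) ≠ 0 := by
      intro h
      have hn := D.norm1
      rw [h, Algebra.norm_zero] at hn
      norm_num at hn
    apply mul_left_cancel₀ hne
    unfold vec at h
    push_cast at h
    linear_combination h + (r - (a' + b' * D.θ + c' * D.θ ^ 2)) * D.two_eq)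
  omega

/-- being a square modulo two -/
def SqMod (u : 𝓞 L) : Prop := ∃ w z : 𝓞 L, u = w ^ 2 + 2 * z

lemma SqMod.of_mul {u : 𝓞 L} (v : (𝓞 L)ˣ) (h : SqMod (u * (v : 𝓞 L) ^ 2)) : SqMod u := by
  obtain ⟨w, z, h⟩ := h
  refine ⟨w * (v⁻¹ : (𝓞 L)ˣ), z * ((v⁻¹ : (𝓞 L)ˣ) : 𝓞 L) ^ 2, ?_⟩
  have hv : (v : 𝓞 L) * ((v⁻¹ : (𝓞 L)ˣ) : 𝓞 L) = 1 := v.mul_inv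
  linear_combination ((v⁻¹ : (𝓞 L)ˣ) : 𝓞 L) ^ 2 * h - u * (v * ((v⁻¹ : (𝓞 L)ˣ) : 𝓞 L) + 1) * hv

lemma not_sqmod (n0 n1 n2 n3 n4 n5 m0 m1 m2 m3 m4 m5 : ℤ)
    (h8 : D.vec n0 n1 n2 n3 n4 n5 ^ 8 = D.vec m0 m1 m2 m3 m4 m5) 
    (h : SqMod (D.vec n0 n1 n2 n3 n4 n5)) : 2 ∣ m0 - n0 ∧ 2 ∣ m1 - n1 := by
  obtain ⟨w, z, hw⟩ := h
  obtain ⟨r, hr⟩ := D.sq_pow8 w z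
  rw [← hw, h8, vec_sub] at hr
  have := D.vec_even _ _ _ _ _ _ r hr
  exact ⟨this.1, this.2.1⟩

lemma not_sqmod' (n0 n1 n2 n3 n4 n5 k0 k1 k2 k3 k4 k5 l0 l1 l2 l3 l4 l5 m0 m1 m2 m3 m4 m5 : ℤ)
    (h2 : D.vec n0 n1 n2 n3 n4 n5 * D.vec n0 n1 n2 n3 n4 n5 = D.vec k0 k1 k2 k3 k4 k5)
    (h4 : D.vec k0 k1 k2 k3 k4 k5 * D.vec k0 k1 k2 k3 k4 k5 = D.vec l0 l1 l2 l3 l4 l5)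
    (h8 : D.vec l0 l1 l2 l3 l4 l5 * D.vec l0 l1 l2 l3 l4 l5 = D.vec m0 m1 m2 m3 m4 m5)
    (h : SqMod (D.vec n0 n1 n2 n3 n4 n5)) : 2 ∣ m0 - n0 ∧ 2 ∣ m1 - n1 := by
  refine D.not_sqmod _ _ _ _ _ _ m0 m1 m2 m3 m4 m5 ?_ h
  rw [← h8, ← h4, ← h2]; ring

lemma gens_even (a b c : ℕ) (h : SqMod ((D.uI ^ a * D.u1 ^ b * D.u2 ^ c : (𝓞 L)ˣ) : 𝓞 L)) :
    2 ∣ a ∧ 2 ∣ b ∧ 2 ∣ c := by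
  have e (n : ℕ) : ∃ r m : ℕ, n = r + 2 * m ∧ (r = 0 ∨ r = 1) :=
    ⟨n % 2, n / 2, by omega, by omega⟩
  obtain ⟨r0, m0, rfl, h0⟩ := e a
  obtain ⟨r1, m1, rfl, h1⟩ := e b
  obtain ⟨r2, m2, rfl, h2⟩ := e c
  have h' : SqMod ((D.uI ^ r0 * D.u1 ^ r1 * D.u2 ^ r2 : (𝓞 L)ˣ) : 𝓞 L) := by
    apply SqMod.of_mul (D.uI ^ m0 * D.u1 ^ m1 * D.u2 ^ m2)
    convert h using 1
    push_cast
    ring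
  clear h
  have hI : (D.uI : 𝓞 L) = D.vec 0 0 0 1 0 0 := by simp [vec, uI]
  have hu1 : (D.u1 : 𝓞 L) = D.vec 0 1 0 1 0 0 := rfl
  have hu2 : (D.u2 : 𝓞 L) = D.vec (-1) 1 0 1 0 0 := rfl
  rcases h0 with rfl | rfl <;> rcases h1 with rfl | rfl <;> rcases h2 with rfl | rfl
  · simp
  · exfalso
    have he : ((D.uI ^ 0 * D.u1 ^ 0 * D.u2 ^ 1 : (𝓞 L)ˣ) : 𝓞 L) = D.vec (-1) 1 0 1 0 0 := by
      simp [hI, hu1, hu2, vec_mul]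
    rw [he] at h'
    have := D.not_sqmod' _ _ _ _ _ _ 0 (-2) 1 (-2) 2 0 (-2) 7 (-1) 6 0 (-2) (-72) 17 20 (-14) 84 (-18)
      (by rw [vec_mul]; norm_num) (by rw [vec_mul]; norm_num) (by rw [vec_mul]; norm_num) h'
    norm_num at this
  · exfalso
    have he : ((D.uI ^ 0 * D.u1 ^ 1 * D.u2 ^ 0 : (𝓞 L)ˣ) : 𝓞 L) = D.vec 0 1 0 1 0 0 := by
      simp [hI, hu1, hu2, vec_mul]
    rw [he] at h'
    have := D.not_sqmod' _ _ _ _ _ _ (-1) 0 1 0 2 0 7 (-5) 1 (-2) (-4) 2 25 (-61) 14 (-58) 4 10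
      (by rw [vec_mul]; norm_num) (by rw [vec_mul]; norm_num) (by rw [vec_mul]; norm_num) h'
    norm_num at this
  · exfalso
    have he : ((D.uI ^ 0 * D.u1 ^ 1 * D.u2 ^ 1 : (𝓞 L)ˣ) : 𝓞 L) = D.vec (-1) (-1) 1 (-1) 2 0 := by
      simp [hI, hu1, hu2, vec_mul]
    rw [he] at h'
    have := D.not_sqmod' _ _ _ _ _ _ 4 3 (-2) 4 (-6) 0 28 48 (-23) 56 (-56) (-4) (-546) 8035 (-2009) 7194 (-2660) (-1742)
      (by rw [vec_mul]; norm_num) (by rw [vec_mul]; norm_num) (by rw [vec_mul]; norm_num) h'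
    norm_num at this
  · exfalso
    have he : ((D.uI ^ 1 * D.u1 ^ 0 * D.u2 ^ 0 : (𝓞 L)ˣ) : 𝓞 L) = D.vec 0 0 0 1 0 0 := by
      simp [hI, hu1, hu2, vec_mul]
    rw [he] at h'
    have := D.not_sqmod' _ _ _ _ _ _ (-1) 0 0 0 0 0 1 0 0 0 0 0 1 0 0 0 0 0
      (by rw [vec_mul]; norm_num) (by rw [vec_mul]; norm_num) (by rw [vec_mul]; norm_num) h'
    norm_num at this
  · exfalso
    have he : ((D.uI ^ 1 * D.u1 ^ 0 * D.u2 ^ 1 : (𝓞 L)ˣ) : 𝓞 L) = D.vec (-1) 0 0 (-1) 1 0 := by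
      simp [hI, hu1, hu2, vec_mul]
    rw [he] at h'
    have := D.not_sqmod' _ _ _ _ _ _ 0 2 (-1) 2 (-2) 0 (-2) 7 (-1) 6 0 (-2) (-72) 17 20 (-14) 84 (-18)
      (by rw [vec_mul]; norm_num) (by rw [vec_mul]; norm_num) (by rw [vec_mul]; norm_num) h'
    norm_num at this
  · exfalso
    have he : ((D.uI ^ 1 * D.u1 ^ 1 * D.u2 ^ 0 : (𝓞 L)ˣ) : 𝓞 L) = D.vec (-1) 0 0 0 1 0 := by
      simp [hI, hu1, hu2, vec_mul]
    rw [he] at h'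
    have := D.not_sqmod' _ _ _ _ _ _ 1 0 (-1) 0 (-2) 0 7 (-5) 1 (-2) (-4) 2 25 (-61) 14 (-58) 4 10
      (by rw [vec_mul]; norm_num) (by rw [vec_mul]; norm_num) (by rw [vec_mul]; norm_num) h'
    norm_num at this
  · exfalso
    have he : ((D.uI ^ 1 * D.u1 ^ 1 * D.u2 ^ 1 : (𝓞 L)ˣ) : 𝓞 L) = D.vec 1 (-2) 0 (-1) (-1) 1 := by
      simp [hI, hu1, hu2, vec_mul]
    rw [he] at h'
    have := D.not_sqmod' _ _ _ _ _ _ (-4) (-3) 2 (-4) 6 0 28 48 (-23) 56 (-56) (-4) (-546) 8035 (-2009) 7194 (-2660) (-1742)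
      (by rw [vec_mul]; norm_num) (by rw [vec_mul]; norm_num) (by rw [vec_mul]; norm_num) h'
    norm_num at this

/-- every unit is a product of three generators modulo squares -/
lemma sq_of_sqmod (D : Dat L) (u : (𝓞 L)ˣ) (hu : SqMod (u : 𝓞 L)) : ∃ v : (𝓞 L)ˣ, u = v ^ 2 := by
  obtain ⟨τ, hτ⟩ := IsCyclic.exists_generator (α := Units.torsion L)
  let r := Units.rank L
  have hr : r = 2 := by
    have h1 : Fintype.card (InfinitePlace L) = 3 := by
      rw [card_eq_nrRealPlaces_add_nrComplexPlaces, D.totallyComplex, D.nrComplex]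
    change Fintype.card (InfinitePlace L) - 1 = 2
    rw [h1]
  let f : Fin 2 × (Fin r → Fin 2) → (𝓞 L)ˣ := fun s =>
    (τ : (𝓞 L)ˣ) ^ (s.1 : ℕ) * ∏ i, (Units.fundSystem L i) ^ (s.2 i : ℕ)
  let g : Fin 2 × Fin 2 × Fin 2 → (𝓞 L)ˣ := fun s =>
    D.uI ^ (s.1 : ℕ) * D.u1 ^ (s.2.1 : ℕ) * D.u2 ^ (s.2.2 : ℕ)
  have par (x : (𝓞 L)ˣ) (n : ℤ) : ∃ (e : Fin 2) (y : (𝓞 L)ˣ), x ^ n = x ^ (e : ℕ) * y ^ 2 := by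
    rcases Int.even_or_odd' n with ⟨k, rfl | rfl⟩
    · exact ⟨0, x ^ k, by simp [two_mul, zpow_add, pow_two]⟩
    · exact ⟨1, x ^ k, by simp [two_mul, zpow_add, pow_two]; rw [mul_comm]⟩
  have hf (x : (𝓞 L)ˣ) : ∃ s y, x = f s * y ^ 2 := by
    obtain ⟨⟨ζ, e⟩, hx, -⟩ := Units.exist_unique_eq_mul_prod L x
    obtain ⟨n, hn⟩ := Subgroup.mem_zpowers_iff.1 (hτ ζ)
    obtain ⟨e0, y0, h0⟩ := par (τ : (𝓞 L)ˣ) n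
    choose e1 y1 h1 using fun i => par (Units.fundSystem L i) (e i)
    refine ⟨⟨e0, e1⟩, y0 * ∏ i, y1 i, ?_⟩
    rw [hx]
    simp only [← hn, Subgroup.coe_zpow, h0, h1, f, Finset.prod_mul_distrib, mul_pow,
      Finset.prod_pow]
    exact mul_mul_mul_comm _ _ _ _
  choose σ y hσ using fun s => hf (g s)
  have hinj : Function.Injective σ := by
    intro s s' h
    have h1 := hσ s
    have h2 := hσ s'
    rw [← h] at h2
    have h3 : g s * g s' = (f (σ s) * y s * y s') ^ 2 := by
      rw [h1, h2, mul_pow, mul_pow, pow_two (f (σ s))]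
      exact (mul_mul_mul_comm _ _ _ _).trans (mul_assoc _ _ _).symm
    have h4 := D.gens_even (s.1 + s'.1) (s.2.1 + s'.2.1) (s.2.2 + s'.2.2) (by
      refine ⟨(f (σ s) * y s * y s' : (𝓞 L)ˣ), 0, ?_⟩
      rw [mul_zero, add_zero, ← Units.val_pow_eq_pow_val, ← h3]
      congr 1
      simp only [g, pow_add]
      ac_rfl)
    obtain ⟨a, b, c⟩ := s
    obtain ⟨a', b', c'⟩ := s'
    simp only at h4
    have e1 : a = a' := by omega
    have e2 : b = b' := by omega
    have e3 : c = c' := by omega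
    rw [e1, e2, e3]
  have hbij : Function.Bijective σ := by
    rw [Fintype.bijective_iff_injective_and_card]
    refine ⟨hinj, ?_⟩
    simp [hr]
  obtain ⟨s, z, hs⟩ := hf u
  obtain ⟨s', rfl⟩ := hbij.2 s
  have h5 := hσ s'
  have h6 : g s' * z ^ 2 = u * y s' ^ 2 := by
    rw [h5, hs]; exact mul_right_comm _ _ _
  have h7 : SqMod (g s' : 𝓞 L) := by
    obtain ⟨w, z', hw⟩ := hu
    apply SqMod.of_mul z
    refine ⟨w * y s', z' * (y s' : 𝓞 L) ^ 2, ?_⟩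
    have := congrArg (fun x : (𝓞 L)ˣ => (x : 𝓞 L)) h6
    simp only [Units.val_mul, Units.val_pow_eq_pow_val] at this
    rw [this, hw]; ring
  obtain ⟨a, b, c⟩ := s'
  have h8 := D.gens_even a b c h7
  have e1 : a = 0 := by omega
  have e2 : b = 0 := by omega
  have e3 : c = 0 := by omega
  subst e1 e2 e3
  refine ⟨z * (y (0, 0, 0))⁻¹, ?_⟩
  have hg : g (0, 0, 0) = 1 := by simp [g]
  rw [hg, one_mul] at h6
  rw [mul_pow, h6, inv_pow, mul_inv_cancel_right]

end Dat

end N3M2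

open Polynomial NumberField

namespace N3M2

/-- square part decomposition -/
lemma exists_sq_mul {R : Type*} [CommRing R] [IsDomain R] [WfDvdMonoid R] (a : R) (ha : a ≠ 0) :
    ∃ s t : R, a = s ^ 2 * t ∧ Squarefree t := by
  induction a using (IsWellFounded.induction (α := R) DvdNotUnit) with
  | _ a ih =>
    by_cases h : Squarefree a
    · exact ⟨1, a, by ring, h⟩
    · rw [Squarefree] at h
      push Not at h
      obtain ⟨x, ⟨y, hy⟩, hx⟩ := h
      have hy0 : y ≠ 0 := by rintro rfl; simp [hy] at ha
      obtain ⟨s, t, h1, h2⟩ := ih y ⟨hy0, x * x, by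
        intro h; exact hx (isUnit_of_mul_isUnit_left h), by rw [hy]; ring⟩ hy0
      exact ⟨x * s, t, by rw [hy, h1]; ring, h2⟩

lemma prime_dvd_of_sq {R : Type*} [CommRing R] [IsDomain R] [IsPrincipalIdealRing R] {s t w B C : R}
    (hs : s ≠ 0) (ht : Squarefree t) (hw : Prime w) (hwt : w ∣ t) (h : B ^ 2 = s ^ 2 * t * C) :
    w ∣ B ∧ w ∣ C := by
  have hsB : s ∣ B := by
    rw [← IsIntegrallyClosed.pow_dvd_pow_iff (n := 2) two_ne_zero]
    exact ⟨t * C, by rw [h]; ring⟩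
  obtain ⟨B1, rfl⟩ := hsB
  have h1 : B1 ^ 2 = t * C := by
    apply mul_left_cancel₀ (pow_ne_zero 2 hs); linear_combination h
  obtain ⟨t', rfl⟩ := hwt
  have h2 : w ∣ B1 := hw.dvd_of_dvd_pow (n := 2) ⟨t' * C, by rw [h1]; ring⟩
  refine ⟨h2.mul_left s, ?_⟩
  obtain ⟨B2, rfl⟩ := h2
  have h3 : w * B2 ^ 2 = t' * C := by
    apply mul_left_cancel₀ hw.ne_zero; linear_combination h1
  rcases hw.dvd_or_dvd (Dvd.intro _ h3) with h4 | h4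
  · exfalso
    obtain ⟨t2, rfl⟩ := h4
    exact hw.not_isUnit (ht w ⟨t2, by ring⟩)
  · exact h4

/-- over a field: common root forces divisibility -/
lemma form_dvd {F k : Type*} [Field F] [Field k] [Algebra F k] (t : k) (A B C : F[X]) (hA0 : A ≠ 0)
    (hA : A.natDegree ≤ 2) (hB : B.natDegree ≤ 3) (hC : C.natDegree ≤ 4)
    (e : B ^ 2 = A * C) (h1 : aeval t A = 0) (h2 : aeval t B = 0) (h3 : aeval t C = 0) :
    ∃ R : F[X], R.natDegree ≤ 1 ∧ B = A * R := by
  by_cases hB0 : B = 0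
  · exact ⟨0, by simp, by simp [hB0]⟩
  have h_isint : IsIntegral F t := IsAlgebraic.isIntegral ⟨A, hA0, h1⟩
  obtain ⟨A1, hA1⟩ := minpoly.dvd F t h1
  obtain ⟨B1, hB1⟩ := minpoly.dvd F t h2
  obtain ⟨C1, hC1⟩ := minpoly.dvd F t h3
  set m := minpoly F t with hm
  have hm0 : m ≠ 0 := minpoly.ne_zero h_isint
  have hmpos : 0 < m.natDegree := minpoly.natDegree_pos h_isint
  have hA10 : A1 ≠ 0 := by rintro rfl; simp [hA1] at hA0
  have hB10 : B1 ≠ 0 := by rintro rfl; simp [hB1] at hB0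
  have e1 : B1 ^ 2 = A1 * C1 := by
    apply mul_left_cancel₀ (pow_ne_zero 2 hm0)
    rw [hA1, hB1, hC1] at e; linear_combination e
  have hC10 : C1 ≠ 0 := by rintro rfl; simp [hB10] at e1
  have dA : A.natDegree = m.natDegree + A1.natDegree := by rw [hA1, natDegree_mul hm0 hA10]
  have dB : B.natDegree = m.natDegree + B1.natDegree := by rw [hB1, natDegree_mul hm0 hB10]
  have dC : C.natDegree = m.natDegree + C1.natDegree := by rw [hC1, natDegree_mul hm0 hC10]
  have d1 : 2 * B1.natDegree = A1.natDegree + C1.natDegree := by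
    rw [← natDegree_mul hA10 hC10, ← e1, natDegree_pow]
  have hdvd : A1 ∣ B1 := by
    rcases Nat.eq_zero_or_pos A1.natDegree with h | h
    · have : IsUnit A1 := by
        rw [isUnit_iff_degree_eq_zero, degree_eq_natDegree hA10, h]; rfl
      exact this.dvd
    · have hd : A1.degree = 1 := by
        rw [degree_eq_natDegree hA10, show A1.natDegree = 1 by omega]; rfl
      exact (Polynomial.prime_of_degree_eq_one hd).dvd_of_dvd_pow (n := 2) ⟨C1, e1⟩
  obtain ⟨R, hR⟩ := hdvd
  have hR0 : R ≠ 0 := by rintro rfl; simp [hR] at hB10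
  have dR : B1.natDegree = A1.natDegree + R.natDegree := by rw [hR, natDegree_mul hA10 hR0]
  exact ⟨R, by omega, by rw [hB1, hR, hA1]; ring⟩

/-- lifting a polynomial mod p with degree bound -/
lemma lift_zmod (p : ℕ) [Fact p.Prime] (R : (ZMod p)[X]) (n : ℕ) (hn : R.natDegree ≤ n) :
    ∃ R' : ℤ[X], R'.map (Int.castRingHom (ZMod p)) = R ∧ R'.natDegree ≤ n := by
  have : R ∈ Polynomial.lifts (Int.castRingHom (ZMod p)) :=
    mem_lifts_of_surjective (ZMod.ringHom_surjective _) R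
  obtain ⟨q, h1, h2⟩ := Polynomial.exists_degree_eq_of_mem_lifts this
  exact ⟨q, h1, by rwa [natDegree_eq_of_degree_eq h2]⟩

lemma eq_of_map_eq (p : ℕ) [Fact p.Prime] (P Q : ℤ[X]) (n : ℕ) (hP : P.natDegree ≤ n)
    (hQ : Q.natDegree ≤ n)
    (h : P.map (Int.castRingHom (ZMod p)) = Q.map (Int.castRingHom (ZMod p))) :
    ∃ S : ℤ[X], S.natDegree ≤ n ∧ P = Q + C (p : ℤ) * S := by
  have h1 : C (p : ℤ) ∣ P - Q := by
    rw [C_dvd_iff_dvd_coeff]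
    intro i
    have := congrArg (fun r => r.coeff i) h
    simp only [coeff_map, eq_intCast] at this
    rw [coeff_sub]
    exact (ZMod.intCast_eq_intCast_iff_dvd_sub _ _ p).1 this.symm
  obtain ⟨S, hS⟩ := h1
  refine ⟨S, ?_, by linear_combination hS⟩
  have hp : (p : ℤ) ≠ 0 := by exact_mod_cast (Fact.out : p.Prime).ne_zero
  rw [← natDegree_C_mul (a := (p : ℤ)) hp, ← hS]
  exact (natDegree_sub_le _ _).trans (max_le hP hQ)

lemma prim_map_ne (p : ℕ) [Fact p.Prime] (A : ℤ[X]) (hA : A.IsPrimitive) :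
    A.map (Int.castRingHom (ZMod p)) ≠ 0 := by
  intro h
  have h1 : C (p : ℤ) ∣ A := by
    rw [C_dvd_iff_dvd_coeff]
    intro i
    have := congrArg (fun r => r.coeff i) h
    simp only [coeff_map, eq_intCast, coeff_zero] at this
    exact (ZMod.intCast_zmod_eq_zero_iff_dvd _ p).1 this
  have := hA _ h1
  exact (Nat.prime_iff_prime_int.1 (Fact.out : p.Prime)).not_isUnit this

/-- cancelling an integer against a primitive polynomial -/
lemma prim_cancel (A Q S : ℤ[X]) (hA : A.IsPrimitive) (n : ℤ) (h : C n * S = A * Q) :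
    ∃ Q', Q = C n * Q' := by
  have h1 : n ∣ (A * Q).content := by
    rw [← h]; rw [dvd_content_iff_C_dvd]; exact Dvd.intro _ rfl
  rw [content_mul, hA.content_eq_one, one_mul, dvd_content_iff_C_dvd] at h1
  exact h1

/-- reduce `b` until it is prime to `p` -/
lemma rep_reduce {k : Type*} [Field k] (p : ℕ) [Fact p.Prime] [CharP k p] (t : k)
    (A : ℤ[X]) (hA : A.IsPrimitive) (hA2 : A.natDegree ≤ 2)
    (H : ∀ (b : ℤ) (B Q : ℤ[X]), B.natDegree ≤ 3 → Q.natDegree ≤ 4 → B ^ 2 - C b ^ 2 * gP ℤ = A * Q →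
      aeval t A = 0 ∧ aeval t B = 0 ∧ aeval t Q = 0) :
    ∀ (n : ℕ) (b : ℤ) (B Q : ℤ[X]), b.natAbs = n → b ≠ 0 → B.natDegree ≤ 3 → Q.natDegree ≤ 4 →
      B ^ 2 - C b ^ 2 * gP ℤ = A * Q →
      ∃ (b : ℤ) (B Q : ℤ[X]), ¬ (p : ℤ) ∣ b ∧ B.natDegree ≤ 3 ∧ Q.natDegree ≤ 4 ∧
        B ^ 2 - C b ^ 2 * gP ℤ = A * Q := by
  intro n
  induction n using Nat.strong_induction_on with
  | _ n ih =>
    intro b B Q hn hb hB hQ e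
    by_cases hpb : (p : ℤ) ∣ b
    swap
    · exact ⟨b, B, Q, hpb, hB, hQ, e⟩
    obtain ⟨b1, rfl⟩ := hpb
    obtain ⟨h1, h2, h3⟩ := H _ B Q hB hQ e
    let φ := Int.castRingHom (ZMod p)
    let _ : Algebra (ZMod p) k := ZMod.algebra k p
    have key (P : ℤ[X]) : aeval t (P.map φ) = aeval t P := by
      rw [aeval_def, eval₂_map, aeval_def]
      congr 1
      exact RingHom.ext_int _ _
    have e' := congrArg (Polynomial.map φ) e
    have hpφ : φ (p : ℤ) = 0 := by simp [φ]
    rw [Polynomial.map_sub, Polynomial.map_mul, Polynomial.map_pow, Polynomial.map_pow,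
      Polynomial.map_mul, Polynomial.map_C, map_mul, hpφ] at e'
    obtain ⟨R, hR, hBR⟩ := form_dvd t (A.map φ) (B.map φ) (Q.map φ) (prim_map_ne p A hA)
      (natDegree_map_le.trans hA2) (natDegree_map_le.trans hB) (natDegree_map_le.trans hQ)
      (by rw [← e']; simp) (by rw [key, h1]) (by rw [key, h2]) (by rw [key, h3])
    obtain ⟨R', hR', hR1⟩ := lift_zmod p R 1 hR
    obtain ⟨S, hS, hBS⟩ := eq_of_map_eq p B (A * R') 3 hB
      (natDegree_mul_le.trans (by omega)) (by rw [Polynomial.map_mul, hR']; exact hBR)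
    have e2 : C ((p : ℤ) ^ 2) * (S ^ 2 - C b1 ^ 2 * gP ℤ)
        = A * (Q - A * R' ^ 2 - 2 * C (p : ℤ) * R' * S) := by
      rw [hBS] at e
      simp only [C_mul, C_pow] at e ⊢
      linear_combination e
    obtain ⟨Q', hQ'⟩ := prim_cancel _ _ _ hA _ e2
    have hp0 : (p : ℤ) ≠ 0 := by exact_mod_cast (Fact.out : p.Prime).ne_zero
    have hp2 : (p : ℤ) ^ 2 ≠ 0 := pow_ne_zero _ hp0
    have e3 : S ^ 2 - C b1 ^ 2 * gP ℤ = A * Q' := by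
      apply mul_left_cancel₀ (a := C ((p : ℤ) ^ 2)) (by simpa using hp0)
      rw [e2, hQ']; ring
    have hb1 : b1 ≠ 0 := by rintro rfl; simp at hb
    refine ih b1.natAbs ?_ b1 S Q' rfl hb1 hS ?_ e3
    · rw [← hn, Int.natAbs_mul, Int.natAbs_natCast]
      have := (Fact.out : p.Prime).two_le
      have : 0 < b1.natAbs := Int.natAbs_pos.2 hb1
      nlinarith
    · rw [← natDegree_C_mul (a := (p : ℤ) ^ 2) hp2, ← hQ']
      refine (natDegree_sub_le _ _).trans (max_le ((natDegree_sub_le _ _).trans (max_le hQ ?_)) ?_)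
      · refine natDegree_mul_le.trans ?_
        have := natDegree_pow_le (p := R') (n := 2)
        omega
      · have : natDegree (2 * C (p : ℤ)) = 0 := by
          rw [show (2 : ℤ[X]) * C (p : ℤ) = C (2 * (p : ℤ)) by simp]; exact natDegree_C _
        refine natDegree_mul_le.trans ?_
        have := natDegree_mul_le (p := 2 * C (p : ℤ)) (q := R')
        omega

end N3M2

open Polynomial NumberField

namespace N3M2

lemma gP_eval (R : Type*) [CommRing R] (t : R) :
    (gP R).eval t = t ^ 6 - 4 * t ^ 5 + 10 * t ^ 4 - 14 * t ^ 3 + 17 * t ^ 2 - 10 * t + 5 := by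
  simp [gP]

/-- contradiction at a rational double point -/
lemma bad_int {k : Type*} [Field k] (p : ℕ) (hp : p.Prime) [CharP k p] (t : k) (r : ℤ)
    (htr : t = (r : k)) (A B Q : ℤ[X]) (b : ℤ) (hb : ¬ (p : ℤ) ∣ b)
    (e : B ^ 2 - C b ^ 2 * gP ℤ = A * Q)
    (h1 : aeval t A = 0) (h2 : aeval t B = 0) (h3 : aeval t Q = 0) :
    (p : ℤ) ^ 2 ∣ (gP ℤ).eval r := by
  have key (P : ℤ[X]) (h : aeval t P = 0) : (p : ℤ) ∣ P.eval r := by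
    rw [← CharP.intCast_eq_zero_iff k p]
    rw [htr, aeval_def, eq_intCast (algebraMap ℤ k) r |>.symm, eval₂_at_apply] at h
    simpa using h
  obtain ⟨a, ha⟩ := key A h1
  obtain ⟨c, hc⟩ := key B h2
  obtain ⟨d, hd⟩ := key Q h3
  have e1 := congrArg (eval r) e
  simp only [eval_sub, eval_mul, eval_pow, eval_C] at e1
  rw [ha, hc, hd] at e1
  have h4 : (p : ℤ) ^ 2 ∣ b ^ 2 * (gP ℤ).eval r := ⟨c ^ 2 - a * d, by linear_combination -e1⟩
  refine IsCoprime.dvd_of_dvd_mul_left ?_ h4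
  exact (((Nat.prime_iff_prime_int.1 hp).coprime_iff_not_dvd).2 hb).pow

lemma gauss_three (x y : ℤ) (h : (3 : ℤ) ∣ x ^ 2 + y ^ 2) : (3 : ℤ) ∣ x ∧ (3 : ℤ) ∣ y := by
  have h1 : x % 3 = 0 ∨ x % 3 = 1 ∨ x % 3 = 2 := by omega
  have h2 : y % 3 = 0 ∨ y % 3 = 1 ∨ y % 3 = 2 := by omega
  have h3 : (x ^ 2 + y ^ 2) % 3 = 0 := Int.emod_eq_zero_of_dvd h
  rcases h1 with h1 | h1 | h1 <;> rcases h2 with h2 | h2 | h2 <;>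
    simp [pow_two, Int.add_emod, Int.mul_emod, h1, h2] at h3 <;> omega

lemma bad_three {k : Type*} [Field k] [CharP k 3] (t : k)
    (ht : t ^ 2 = -1) (A B Q : ℤ[X]) (b : ℤ) (hb : ¬ (3 : ℤ) ∣ b)
    (e : B ^ 2 - C b ^ 2 * gP ℤ = A * Q)
    (h1 : aeval t A = 0) (h2 : aeval t B = 0) (h3 : aeval t Q = 0) : False := by
  let ι : GaussianInt := ⟨0, 1⟩
  have hι : ι * ι = ((-1 : ℤ) : GaussianInt) := by decide
  let f : GaussianInt →+* k := Zsqrtd.lift ⟨t, by push_cast; rw [← pow_two]; exact ht⟩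
  have key (P : ℤ[X]) (h : aeval t P = 0) : (3 : GaussianInt) ∣ aeval ι P := by
    have h' : f (aeval ι P) = 0 := by
      rw [← h]
      have : t = f ι := by simp [f, ι, Zsqrtd.lift]
      conv_rhs => rw [this]
      rw [aeval_def, aeval_def, hom_eval₂]
      congr 1
      exact RingHom.ext_int _ _
    set z := aeval ι P
    have h5 : ((z.re ^ 2 + z.im ^ 2 : ℤ) : k) = 0 := by
      have : (z.re : k) + z.im * t = 0 := by simpa [f, Zsqrtd.lift] using h'
      push_cast
      linear_combination ((z.re : k) - z.im * t) * this + (z.im : k) ^ 2 * ht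
    have h6 : ((3 : ℕ) : ℤ) ∣ z.re ^ 2 + z.im ^ 2 := (CharP.intCast_eq_zero_iff k 3 _).1 h5
    obtain ⟨h7, h8⟩ := gauss_three _ _ (by exact_mod_cast h6)
    have := (Zsqrtd.intCast_dvd (d := -1) 3 z).2 ⟨h7, h8⟩
    exact_mod_cast this
  obtain ⟨a, ha⟩ := key A h1
  obtain ⟨c, hc⟩ := key B h2
  obtain ⟨d, hd⟩ := key Q h3
  have e1 := congrArg (aeval ι) e
  simp only [map_sub, map_mul, map_pow, aeval_C] at e1
  rw [ha, hc, hd] at e1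
  have hg : aeval ι (gP ℤ) = ((-3 : ℤ) : GaussianInt) := by
    simp only [gP, map_add, map_sub, map_mul, map_pow, aeval_X, map_ofNat]
    decide
  rw [hg] at e1
  have h9 : ((9 : ℤ) : GaussianInt) ∣ ((b ^ 2 * 3 : ℤ) : GaussianInt) := by
    refine ⟨a * d - c ^ 2, ?_⟩
    push_cast at e1 ⊢
    simp only [eq_intCast] at e1
    linear_combination e1
  have h10 := (Zsqrtd.intCast_dvd_intCast (d := -1) _ _).1 h9
  have h11 : (3 : ℤ) ∣ b ^ 2 := by omega
  exact hb (Int.prime_three.dvd_of_dvd_pow h11)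

/-- no odd residue field carries a common zero -/
lemma residue_contra {k : Type*} [Field k] (p : ℕ) (hp : p.Prime) [CharP k p] (h2p : p ≠ 2)
    (t i : k) (hi : i ^ 2 = -1)
    (hG : t ^ 3 + (-2 + 2 * i) * t ^ 2 + (1 - 2 * i) * t + (-1 + 2 * i) = 0)
    (A B Q : ℤ[X]) (b : ℤ) (hb : ¬ (p : ℤ) ∣ b)
    (e : B ^ 2 - C b ^ 2 * gP ℤ = A * Q)
    (h1 : aeval t A = 0) (h2 : aeval t B = 0) (h3 : aeval t Q = 0) : False := by
  have cast0 (n : ℤ) (h : (n : k) = 0) : (p : ℤ) ∣ n := (CharP.intCast_eq_zero_iff k p n).1 h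
  have h20 : (2 : k) ≠ 0 := by
    intro h
    have := cast0 2 (by exact_mod_cast h)
    have := (Nat.prime_dvd_prime_iff_eq hp Nat.prime_two).1 (by exact_mod_cast this)
    exact h2p this
  have hb0 : (b : k) ≠ 0 := fun h => hb (cast0 b h)
  have hi' : i ^ 2 + 1 = 0 := by rw [hi]; ring
  have hi0 : i ≠ 0 := by rintro rfl; simp at hi
  -- the derivative
  have e1 := congrArg (fun P => aeval t (derivative P)) e
  simp only [derivative_sub, derivative_mul, derivative_pow, derivative_C, map_add, map_sub,
    map_mul, map_pow, h1, h2, h3, gP, aeval_C] at e1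
  have hg' : 6 * t ^ 5 - 20 * t ^ 4 + 40 * t ^ 3 - 42 * t ^ 2 + 34 * t - 10 = 0 := by
    have : (b : k) ^ 2 * (6 * t ^ 5 - 20 * t ^ 4 + 40 * t ^ 3 - 42 * t ^ 2 + 34 * t - 10) = 0 := by
      simp [hb0, map_ofNat] at e1
      rw [show 6 * t ^ 5 - 20 * t ^ 4 + 40 * t ^ 3 - 42 * t ^ 2 + 34 * t - 10 = 0 by
        linear_combination e1, mul_zero]
    exact (mul_eq_zero.1 this).resolve_left (pow_ne_zero 2 hb0)
  have hq0 : t ^ 2 - t + 1 ≠ 0 := by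
    intro h
    have ht : t = 0 := by linear_combination -hG + (t - 1 + 2 * i) * h
    rw [ht] at h; norm_num at h
  have hG' : 3 * t ^ 2 + (-4 + 4 * i) * t + (1 - 2 * i) = 0 := by
    have : (-4 * i * (t ^ 2 - t + 1)) * (3 * t ^ 2 + (-4 + 4 * i) * t + (1 - 2 * i)) = 0 := by
      linear_combination hg' - (3 * t ^ 2 + (-4 - 4 * i) * t + (1 + 2 * i)) * hG
        - (3 * t ^ 2 + (-4 + 4 * i) * t + (1 - 2 * i)) * hG + (8 - 24 * t + 24 * t ^ 2 - 16 * t ^ 3) * hi'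
    exact (mul_eq_zero.1 this).resolve_left
      (mul_ne_zero (mul_ne_zero (by
        rw [show (-4 : k) = -(2 * 2) by norm_num]; exact neg_ne_zero.2 (mul_ne_zero h20 h20)) hi0) hq0)
  have hlin : (6 + 4 * i) * t = 11 - 12 * i := by
    linear_combination 9 * hG - (3 * t + (-2 + 2 * i)) * hG' + (8 * t - 4) * hi'
  have hD : (27 : k) * (11 + 8 * i) = 0 := by
    linear_combination (432 - 224 * i) * hi' - (6 + 4 * i) ^ 2 * hG' +
      (3 * ((6 + 4 * i) * t + (11 - 12 * i)) + (-4 + 4 * i) * (6 + 4 * i)) * hlin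
  rcases mul_eq_zero.1 hD with h27 | h11
  · have h3p : p ∣ 3 ^ 3 := by exact_mod_cast cast0 27 (by exact_mod_cast h27)
    have h3 : p = 3 := (Nat.prime_dvd_prime_iff_eq hp Nat.prime_three).1 (hp.dvd_of_dvd_pow h3p)
    subst h3
    have h30 : (3 : k) = 0 := by exact_mod_cast CharP.cast_eq_zero k 3
    have hti : t = i := by
      linear_combination -i * hlin + (4 * t - 12) * hi' + (2 * i * t - t - 4 * i + 4 + 8 * i ^ 2) * h30
    exact bad_three t (by rw [hti, hi]) A B Q b hb e h1 h2 ‹_›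
  · have h185 : (185 : k) = 0 := by linear_combination (11 - 8 * i) * h11 + 64 * hi'
    have h5p : p ∣ 5 * 37 := by exact_mod_cast cast0 185 (by exact_mod_cast h185)
    rcases (hp.dvd_mul).1 h5p with h | h
    · have h5 : p = 5 := (Nat.prime_dvd_prime_iff_eq hp Nat.prime_five).1 h
      subst h5
      have h50 : (5 : k) = 0 := by exact_mod_cast CharP.cast_eq_zero k 5
      have hi3 : i = 3 := by linear_combination 2 * h11 + (-3 * i - 5) * h50
      have ht : t = ((0 : ℤ) : k) := by
        rw [hi3] at hlin
        push_cast
        linear_combination 2 * hlin + (-7 * t - 10) * h50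
      have := bad_int 5 hp t 0 ht A B Q b hb e h1 h2 h3
      rw [gP_eval] at this
      norm_num at this
    · have h37 : p = 37 := (Nat.prime_dvd_prime_iff_eq hp (by norm_num)).1 h
      subst h37
      have h50 : (37 : k) = 0 := by exact_mod_cast CharP.cast_eq_zero k 37
      have hi3 : i = 31 := by linear_combination 14 * h11 + (-3 * i - 5) * h50
      have ht : t = ((18 : ℤ) : k) := by
        rw [hi3] at hlin
        push_cast
        linear_combination 2 * hlin + (-7 * t - 20) * h50
      have := bad_int 37 hp t 18 ht A B Q b hb e h1 h2 h3
      rw [gP_eval] at this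
      norm_num at this

lemma prim2 (A : ℤ[X]) (hA : A.IsPrimitive) (hA2 : A.natDegree ≤ 2) :
    ¬ (2 ∣ A.coeff 0 ∧ 2 ∣ A.coeff 1 ∧ 2 ∣ A.coeff 2) := by
  rintro ⟨h0, h1, h2⟩
  have : C (2 : ℤ) ∣ A := by
    rw [C_dvd_iff_dvd_coeff]
    intro i
    match i with
    | 0 => exact h0
    | 1 => exact h1
    | 2 => exact h2
    | n + 3 => rw [coeff_eq_zero_of_natDegree_lt (by omega)]; exact dvd_zero _
  exact Int.prime_two.not_isUnit (hA _ this)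

namespace Dat

variable {L : Type} [Field L] [NumberField L] (D : Dat L)

lemma aeval2 (A : ℤ[X]) (hA2 : A.natDegree ≤ 2) :
    aeval D.θ A = (A.coeff 0 : 𝓞 L) + A.coeff 1 * D.θ + A.coeff 2 * D.θ ^ 2 := by
  conv_lhs => rw [deg2 hA2]
  simp

lemma aeval_not_dvd (A : ℤ[X]) (hA : A.IsPrimitive) (hA2 : A.natDegree ≤ 2) :
    ¬ (1 + D.I) ∣ aeval D.θ A := by
  intro h
  rw [D.aeval2 A hA2] at h
  exact prim2 A hA hA2 (D.even_of_dvd _ _ _ h)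

lemma gP_zero : aeval D.θ (gP ℤ) = 0 := by
  simp only [gP, map_add, map_sub, map_mul, map_pow, aeval_X, map_ofNat]
  linear_combination (D.θ ^ 3 + (-2 - 2 * D.I) * D.θ ^ 2 + (1 + 2 * D.I) * D.θ + (-1 - 2 * D.I))
    * D.hG + 4 * (D.θ ^ 2 - D.θ + 1) ^ 2 * D.hI

/-- step IV: the value at `θ` is a unit times a square -/
lemma unit_sq (A : ℤ[X]) (hA : A.IsPrimitive) (hA2 : A.natDegree ≤ 2) (b : ℤ) (hb : b ≠ 0)
    (B Q : ℤ[X]) (hB : B.natDegree ≤ 3) (hQ : Q.natDegree ≤ 4)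
    (e : B ^ 2 - C b ^ 2 * gP ℤ = A * Q) :
    ∃ (u : (𝓞 L)ˣ) (s : 𝓞 L), aeval D.θ A = u * s ^ 2 := by
  have := D.pid
  have hA0 : aeval D.θ A ≠ 0 := by
    intro h
    exact D.aeval_not_dvd A hA hA2 (by rw [h]; exact dvd_zero _)
  obtain ⟨s, t, hst, ht⟩ := exists_sq_mul _ hA0
  have ht0 : t ≠ 0 := by rintro rfl; simp [hst] at hA0
  have hs0 : s ≠ 0 := by rintro rfl; simp [hst] at hA0
  by_cases hu : IsUnit t
  · obtain ⟨u, rfl⟩ := hu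
    exact ⟨u, s, by rw [hst]; ring⟩
  exfalso
  obtain ⟨w, hw, hwt⟩ := WfDvdMonoid.exists_irreducible_factor hu ht0
  have hwp : Prime w := hw.prime
  have H (b : ℤ) (B Q : ℤ[X]) (e : B ^ 2 - C b ^ 2 * gP ℤ = A * Q) :
      w ∣ aeval D.θ A ∧ w ∣ aeval D.θ B ∧ w ∣ aeval D.θ Q := by
    have e1 := congrArg (aeval D.θ) e
    simp only [map_sub, map_mul, map_pow, D.gP_zero, mul_zero, sub_zero] at e1
    rw [hst] at e1
    refine ⟨by rw [hst]; exact hwt.mul_left _, prime_dvd_of_sq hs0 ht hwp hwt e1⟩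
  have hmax : (Ideal.span {w}).IsMaximal :=
    PrincipalIdealRing.isMaximal_of_irreducible hw
  let _ : Field (𝓞 L ⧸ Ideal.span {w}) := Ideal.Quotient.field _
  have : Finite (𝓞 L ⧸ Ideal.span {w}) :=
    Ideal.finiteQuotientOfFreeOfNeBot _ (by simpa using hwp.ne_zero)
  let π := Ideal.Quotient.mk (Ideal.span {w})
  have hπ (x : 𝓞 L) : π x = 0 ↔ w ∣ x := by
    rw [Ideal.Quotient.eq_zero_iff_mem, Ideal.mem_span_singleton]
  have key (P : ℤ[X]) (h : w ∣ aeval D.θ P) : aeval (π D.θ) P = 0 := by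
    have h' := (hπ _).2 h
    rw [aeval_def, hom_eval₂] at h'
    rw [aeval_def, ← h']
    congr 1
  obtain ⟨p, hp⟩ := CharP.exists (𝓞 L ⧸ Ideal.span {w})
  have hpp : p.Prime := CharP.char_is_prime (𝓞 L ⧸ Ideal.span {w}) p
  have : Fact p.Prime := ⟨hpp⟩
  by_cases h2p : p = 2
  · subst h2p
    have h2 : w ∣ 2 := by
      rw [← hπ, map_ofNat]
      exact_mod_cast CharP.cast_eq_zero (𝓞 L ⧸ Ideal.span {w}) 2
    have hI : IsUnit (-D.I) := IsUnit.of_mul_eq_one D.I (by linear_combination -D.hI)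
    rw [D.two_eq, hI.dvd_mul_right] at h2
    have h3 := hwp.dvd_of_dvd_pow h2
    have hirr : Prime (1 + D.I) := by
      have := D.span_maximal.1.isPrime
      rwa [Ideal.span_singleton_prime] at this
      intro h
      have hn := D.norm1
      rw [h] at hn
      simp at hn
    have h4 : (1 + D.I) ∣ w := (hwp.associated_of_dvd hirr h3).symm.dvd
    exact D.aeval_not_dvd A hA hA2 (h4.trans (H b B Q e).1)
  obtain ⟨b, B, Q, hb, hB, hQ, e⟩ := rep_reduce p (π D.θ) A hA hA2 (fun b B Q _ _ e => by
    obtain ⟨h1, h2, h3⟩ := H b B Q e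
    exact ⟨key _ h1, key _ h2, key _ h3⟩) _ b B Q rfl hb hB hQ e
  obtain ⟨h1, h2, h3⟩ := H b B Q e
  refine residue_contra p hpp h2p (π D.θ) (π D.I) ?_ ?_ A B Q b hb e (key _ h1) (key _ h2) (key _ h3)
  · rw [← map_pow, D.hI, map_neg, map_one]
  · have := congrArg π D.hG
    simpa [map_ofNat] using this

lemma inv_mod_two (s : 𝓞 L) (hs : ¬ (1 + D.I) ∣ s) : ∃ s' z, s * s' = 1 + 2 * z := by
  have hmax := D.span_maximal.1
  obtain ⟨y, j, hj, h⟩ := hmax.exists_inv (x := s) (by rwa [Ideal.mem_span_singleton])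
  obtain ⟨r, rfl⟩ := Ideal.mem_span_singleton.1 hj
  refine ⟨y * (1 + (1 + D.I) * r), -D.I * r ^ 2, ?_⟩
  linear_combination (1 + (1 + D.I) * r) * h - r ^ 2 * D.hI

/-- step IV, conclusion -/
lemma is_sq (A : ℤ[X]) (hA : A.IsPrimitive) (hA2 : A.natDegree ≤ 2) (b : ℤ) (hb : b ≠ 0)
    (B Q : ℤ[X]) (hB : B.natDegree ≤ 3) (hQ : Q.natDegree ≤ 4)
    (e : B ^ 2 - C b ^ 2 * gP ℤ = A * Q) (h1 : 2 ∣ A.coeff 1) :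
    ∃ ξ : 𝓞 L, aeval D.θ A = ξ ^ 2 := by
  obtain ⟨u, s, hu⟩ := D.unit_sq A hA hA2 b hb B Q hB hQ e
  have hs : ¬ (1 + D.I) ∣ s := by
    intro h
    exact D.aeval_not_dvd A hA hA2 (by rw [hu, pow_two]; exact (h.mul_right s).mul_left _)
  obtain ⟨s', z, hz⟩ := D.inv_mod_two s hs
  have ev (a : ℤ) : ∃ m, a = a ^ 2 + 2 * m := by
    obtain ⟨m, hm⟩ := Int.even_mul_succ_self a
    exact ⟨a - m, by linear_combination -hm⟩
  obtain ⟨m0, h0⟩ := ev (A.coeff 0)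
  obtain ⟨m2, h2⟩ := ev (A.coeff 2)
  obtain ⟨m1, h1⟩ := h1
  have h0' : ((A.coeff 0 : ℤ) : 𝓞 L) = (A.coeff 0) ^ 2 + 2 * m0 := by exact_mod_cast h0
  have h2' : ((A.coeff 2 : ℤ) : 𝓞 L) = (A.coeff 2) ^ 2 + 2 * m2 := by exact_mod_cast h2
  have h1' : ((A.coeff 1 : ℤ) : 𝓞 L) = 2 * m1 := by exact_mod_cast h1
  rw [D.aeval2 A hA2] at hu ⊢
  have hsq : SqMod (u : 𝓞 L) := by
    refine ⟨((A.coeff 0 : ℤ) + (A.coeff 2 : ℤ) * D.θ) * s',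
      (m0 + m1 * D.θ + m2 * D.θ ^ 2 - (A.coeff 0 : ℤ) * (A.coeff 2 : ℤ) * D.θ) * s' ^ 2 -
        u * (2 * z + 2 * z ^ 2), ?_⟩
    linear_combination (-s' ^ 2) * hu + s' ^ 2 * h0' + s' ^ 2 * D.θ ^ 2 * h2' + s' ^ 2 * D.θ * h1'
      - (u : 𝓞 L) * (s * s' + 1 + 2 * z) * hz
  obtain ⟨v, rfl⟩ := D.sq_of_sqmod u hsq
  exact ⟨v * s, by rw [hu]; push_cast; ring⟩

end Dat

end N3M2

open Polynomial NumberField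

namespace N3M2

/-- the homogenized value of a polynomial -/
noncomputable def hm {F : Type*} [Field F] (n : ℕ) (P : ℤ[X]) (x z : F) : F :=
  MvPolynomial.aeval ![x, z] (P.homogenize n)

section hm
variable {F : Type*} [Field F] (x z : F)

lemma hm_add (n : ℕ) (P Q : ℤ[X]) : hm n (P + Q) x z = hm n P x z + hm n Q x z := by
  simp [hm]

lemma hm_mul (m n : ℕ) (P Q : ℤ[X]) (hP : P.natDegree ≤ m) (hQ : Q.natDegree ≤ n) :
    hm (m + n) (P * Q) x z = hm m P x z * hm n Q x z := by
  rw [hm, homogenize_mul P Q hP hQ, map_mul]; rfl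

lemma hm_C_mul (n : ℕ) (c : ℤ) (P : ℤ[X]) : hm n (C c * P) x z = c * hm n P x z := by
  rw [hm, homogenize_C_mul, map_mul, MvPolynomial.aeval_C]; simp [hm]

lemma hm_sq (n : ℕ) (P : ℤ[X]) (hP : P.natDegree ≤ n) :
    hm (n + n) (P ^ 2) x z = hm n P x z ^ 2 := by
  rw [pow_two, hm_mul x z n n P P hP hP, pow_two]

lemma hm2 (P : ℤ[X]) :
    hm 2 P x z = P.coeff 0 * z ^ 2 + P.coeff 1 * (x * z) + P.coeff 2 * x ^ 2 := by
  simp [hm, homogenize, Finset.Nat.antidiagonal_succ, MvPolynomial.aeval_monomial]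
  ring

lemma hm3 (P : ℤ[X]) :
    hm 3 P x z = P.coeff 0 * z ^ 3 + P.coeff 1 * (x * z ^ 2) + P.coeff 2 * (x ^ 2 * z)
      + P.coeff 3 * x ^ 3 := by
  simp [hm, homogenize, Finset.Nat.antidiagonal_succ, MvPolynomial.aeval_monomial]
  ring

lemma hm6g : hm 6 (gP ℤ) x z = (x ^ 3 - 2 * x ^ 2 * z + x * z ^ 2 - z ^ 3) ^ 2
    + 4 * (z * (x ^ 2 - x * z + z ^ 2)) ^ 2 := by
  have : gP ℤ = (C (-1) + C 1 * X + C (-2) * X ^ 2 + C 1 * X ^ 3) ^ 2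
      + C 4 * (C 1 + C (-1) * X + C 1 * X ^ 2 + C 0 * X ^ 3) ^ 2 := by
    simp [gP]; ring
  rw [this, hm_add, hm_C_mul, hm_sq x z 3 _ (by compute_degree), hm_sq x z 3 _ (by compute_degree),
    hm3, hm3]
  simp only [coeff_add, coeff_C_mul, coeff_X, coeff_C, coeff_X_pow]
  norm_num
  ring

end hm

lemma hm6g_pos (x z : ℝ) (h : ¬ (x = 0 ∧ z = 0)) : 0 < hm 6 (gP ℤ) x z := by
  rw [hm6g]
  by_cases hz : z = 0
  · subst hz
    have hx : x ≠ 0 := fun hx => h ⟨hx, rfl⟩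
    have : 0 < (x ^ 3) ^ 2 := by positivity
    nlinarith
  · have hq : 0 < x ^ 2 - x * z + z ^ 2 := by
      have : 0 < z ^ 2 := by positivity
      nlinarith [sq_nonneg (2 * x - z)]
    have : 0 < (z * (x ^ 2 - x * z + z ^ 2)) ^ 2 := by positivity
    nlinarith [sq_nonneg (x ^ 3 - 2 * x ^ 2 * z + x * z ^ 2 - z ^ 3)]

/-- two cubics proportional at the two roots of a quadratic are dependent modulo the quadratic -/
lemma dependent {F : Type*} [Field F] [CharZero F] (A P Q : ℤ[X]) (hA2 : A.natDegree ≤ 2)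
    (hP : P.natDegree ≤ 3) (hQ : Q.natDegree ≤ 3)
    (x1 z1 x2 z2 : F) (hw : x1 * z2 - x2 * z1 ≠ 0)
    (h1 : hm 2 A x1 z1 = 0) (h2 : hm 2 A x2 z2 = 0) (hQ1 : hm 3 Q x1 z1 ≠ 0)
    (h : hm 3 P x1 z1 * hm 3 Q x2 z2 = hm 3 P x2 z2 * hm 3 Q x1 z1) :
    ∃ (l m : ℤ) (T : ℤ[X]), T.natDegree ≤ 1 ∧ C l * P + C m * Q + A * T = 0 ∧
      ¬ (l = 0 ∧ m = 0 ∧ T = 0) := by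
  let Mt : Matrix (Fin 4) (Fin 4) ℤ := !![A.coeff 0, A.coeff 1, A.coeff 2, 0;
    0, A.coeff 0, A.coeff 1, A.coeff 2; P.coeff 0, P.coeff 1, P.coeff 2, P.coeff 3;
    Q.coeff 0, Q.coeff 1, Q.coeff 2, Q.coeff 3]
  have hdet : Mt.det = 0 := by
    have : (Mt.map (Int.castRingHom F)).det = 0 := by
      rw [← Matrix.exists_mulVec_eq_zero_iff]
      set Q1 := hm 3 Q x1 z1
      set Q2 := hm 3 Q x2 z2
      refine ⟨![Q2 * z1 ^ 3 - Q1 * z2 ^ 3, Q2 * (x1 * z1 ^ 2) - Q1 * (x2 * z2 ^ 2),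
        Q2 * (x1 ^ 2 * z1) - Q1 * (x2 ^ 2 * z2), Q2 * x1 ^ 3 - Q1 * x2 ^ 3], ?_, ?_⟩
      · intro h0
        have c0 := congrFun h0 0
        have c1 := congrFun h0 1
        have c2 := congrFun h0 2
        have c3 := congrFun h0 3
        simp at c0 c1 c2 c3
        have : Q1 * (x1 * z2 - x2 * z1) ^ 3 = 0 := by
          linear_combination -x1 ^ 3 * c0 + 3 * x1 ^ 2 * z1 * c1 - 3 * x1 * z1 ^ 2 * c2
            + z1 ^ 3 * c3
        exact (mul_ne_zero hQ1 (pow_ne_zero 3 hw)) this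
      · have e1 : Q1 = _ := hm3 x1 z1 Q
        have e2 : Q2 = _ := hm3 x2 z2 Q
        rw [hm2] at h1 h2
        rw [hm3, hm3] at h
        ext i
        fin_cases i
        · simp [Mt, Matrix.mulVec, dotProduct, Fin.sum_univ_four]
          linear_combination Q2 * z1 * h1 - Q1 * z2 * h2
        · simp [Mt, Matrix.mulVec, dotProduct, Fin.sum_univ_four]
          linear_combination Q2 * x1 * h1 - Q1 * x2 * h2
        · simp [Mt, Matrix.mulVec, dotProduct, Fin.sum_univ_four]
          linear_combination h
        · simp [Mt, Matrix.mulVec, dotProduct, Fin.sum_univ_four]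
          linear_combination Q1 * e2 - Q2 * e1
    rw [← RingHom.mapMatrix_apply, ← RingHom.map_det] at this
    simpa using this
  obtain ⟨v, hv, hv0⟩ := Matrix.exists_vecMul_eq_zero_iff.2 hdet
  have c0 := congrFun hv0 0
  have c1 := congrFun hv0 1
  have c2 := congrFun hv0 2
  have c3 := congrFun hv0 3
  simp [Mt, Matrix.vecMul, dotProduct, Fin.sum_univ_four] at c0 c1 c2 c3
  refine ⟨v 2, v 3, C (v 0) + C (v 1) * X, by compute_degree, ?_, ?_⟩
  · have d0 := congrArg (C : ℤ →+* ℤ[X]) c0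
    have d1 := congrArg (C : ℤ →+* ℤ[X]) c1
    have d2 := congrArg (C : ℤ →+* ℤ[X]) c2
    have d3 := congrArg (C : ℤ →+* ℤ[X]) c3
    simp only [map_add, map_mul, map_zero] at d0 d1 d2 d3
    conv_lhs => rw [deg2 hA2, deg3 hP, deg3 hQ]
    linear_combination d0 + X * d1 + X ^ 2 * d2 + X ^ 3 * d3
  · rintro ⟨h2, h3, h01⟩
    have e0 : v 0 = 0 := by simpa using congrArg (fun p => coeff p 0) h01
    have e1 : v 1 = 0 := by
      have := congrArg (fun p => coeff p 1) h01
      simpa only [coeff_add, coeff_C_mul, coeff_X_one, coeff_C_succ, zero_add, mul_one,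
        coeff_zero] using this
    apply hv
    ext i
    fin_cases i <;> assumption

/-- the sign argument on a segment -/
lemma segment_sign (x1 z1 x2 z2 : ℝ) (M : ℤ[X])
    (h : ∀ s : ℝ, 0 ≤ s → s ≤ 1 →
      hm 3 M ((1 - s) * x1 + s * x2) ((1 - s) * z1 + s * z2) ≠ 0) :
    0 < hm 3 M x1 z1 * hm 3 M x2 z2 := by
  by_contra hneg
  push Not at hneg
  let f : ℝ → ℝ := fun s => hm 3 M ((1 - s) * x1 + s * x2) ((1 - s) * z1 + s * z2)
  have hf : Continuous f := by
    simp only [f, hm3]; fun_prop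
  have f0 : f 0 = hm 3 M x1 z1 := by simp [f]
  have f1 : f 1 = hm 3 M x2 z2 := by simp [f]
  rw [← f0, ← f1] at hneg
  have : ∃ s ∈ Set.Icc (0 : ℝ) 1, f s = 0 := by
    rcases mul_nonpos_iff.1 hneg with ⟨ha, hb⟩ | ⟨ha, hb⟩
    · exact intermediate_value_Icc' zero_le_one hf.continuousOn ⟨hb, ha⟩
    · exact intermediate_value_Icc zero_le_one hf.continuousOn ⟨ha, hb⟩
  obtain ⟨s, ⟨hs0, hs1⟩, hs⟩ := this
  exact h s hs0 hs1 hs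

end N3M2

open Polynomial NumberField

namespace N3M2

lemma hm_identB {F : Type*} [Field F] (x z : F) (A B Q : ℤ[X]) (b : ℤ) (hA2 : A.natDegree ≤ 2)
    (hB : B.natDegree ≤ 3) (hQ : Q.natDegree ≤ 4) (e : B ^ 2 - C b ^ 2 * gP ℤ = A * Q) :
    hm 3 B x z ^ 2 = b ^ 2 * hm 6 (gP ℤ) x z + hm 2 A x z * hm 4 Q x z := by
  have h : B ^ 2 = C (b ^ 2) * gP ℤ + A * Q := by rw [C_pow]; linear_combination e
  have := congrArg (fun P => hm 6 P x z) h
  simp only [hm_add, hm_C_mul] at this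
  rw [hm_sq x z 3 B hB, hm_mul x z 2 4 A Q hA2 hQ] at this
  exact_mod_cast this

lemma hm_identM {F : Type*} [Field F] (x z : F) (A M U : ℤ[X]) (k e : ℤ) (hA2 : A.natDegree ≤ 2)
    (hM : M.natDegree ≤ 3) (hU : U.natDegree ≤ 2) (h : M ^ 2 - C k * A * U ^ 2 = C e * gP ℤ) :
    hm 3 M x z ^ 2 = e * hm 6 (gP ℤ) x z + k * hm 2 A x z * hm 2 U x z ^ 2 := by
  have h : M ^ 2 = C e * gP ℤ + C k * (A * U ^ 2) := by linear_combination h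
  have := congrArg (fun P => hm 6 P x z) h
  simp only [hm_add, hm_C_mul] at this
  rw [hm_sq x z 3 M hM, hm_mul x z 2 4 A (U ^ 2) hA2 (natDegree_pow_le.trans (by omega)),
    hm_sq x z 2 U hU] at this
  linear_combination this

/-- no root of `g` is a root of a nonconstant polynomial of small degree -/
lemma no_common_root (α : ℂ) (A : ℤ[X]) (hA0 : A ≠ 0) (hA2 : A.natDegree ≤ 2) (h : aeval α A = 0)
    (hg : aeval α (gP ℤ) = 0) : False := by
  have h1 : aeval α (gP ℚ) = 0 := by
    rw [← gP_map (Int.castRingHom ℚ), aeval_def, eval₂_map, ← hg, aeval_def]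
    congr 1
  have h2 := minpoly.eq_of_irreducible_of_monic gP_irreducible h1 (gP_monic ℚ)
  have h3 : aeval α (A.map (Int.castRingHom ℚ)) = 0 := by
    rw [aeval_def, eval₂_map, ← h, aeval_def]
    congr 1
  have h4 := minpoly.dvd ℚ α h3
  rw [← h2] at h4
  have h5 := natDegree_le_of_dvd h4 (by
    rwa [Ne, Polynomial.map_eq_zero_iff (RingHom.injective_int _)])
  rw [gP_natDegree] at h5
  have := natDegree_map_le (p := A) (f := Int.castRingHom ℚ)
  omega

/-- the conclusion of the real argument -/
def Concl (A B : ℤ[X]) (k : ℤ) : Prop :=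
  ∀ (M U : ℤ[X]) (e : ℤ), M.natDegree ≤ 3 → U.natDegree ≤ 2 → e ≠ 0 →
    M ^ 2 - C k * A * U ^ 2 = C e * gP ℤ →
    ∃ (l m : ℤ) (T : ℤ[X]), T.natDegree ≤ 1 ∧ C l * M + C m * B + A * T = 0 ∧
      ¬ (l = 0 ∧ m = 0 ∧ T = 0)

lemma real_pos (A B Q : ℤ[X]) (b : ℤ) (hb : b ≠ 0) (hA2 : A.natDegree ≤ 2)
    (hB : B.natDegree ≤ 3) (hQ : Q.natDegree ≤ 4) (eB : B ^ 2 - C b ^ 2 * gP ℤ = A * Q)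
    (hΔ : 0 < A.coeff 1 ^ 2 - 4 * A.coeff 0 * A.coeff 2) :
    ∃ k : ℤ, (k = 1 ∨ k = -1) ∧ Concl A B k := by
  obtain ⟨a0, h0⟩ : ∃ a, a = (A.coeff 0 : ℝ) := ⟨_, rfl⟩
  obtain ⟨a1, h1⟩ : ∃ a, a = (A.coeff 1 : ℝ) := ⟨_, rfl⟩
  obtain ⟨a2, h2⟩ : ∃ a, a = (A.coeff 2 : ℝ) := ⟨_, rfl⟩
  have hΔ' : 0 < a1 ^ 2 - 4 * a0 * a2 := by rw [h0, h1, h2]; exact_mod_cast hΔ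
  have hAf (x z : ℝ) : hm 2 A x z = a0 * z ^ 2 + a1 * (x * z) + a2 * x ^ 2 := by
    rw [hm2, h0, h1, h2]
  have hb' : (0 : ℝ) < (b : ℝ) ^ 2 := by positivity
  -- the root vectors
  obtain ⟨τ, hτ0, hτ⟩ : ∃ τ : ℝ, τ ≠ 0 ∧ (τ + a1) ^ 2 = a1 ^ 2 - 4 * a0 * a2 := by
    have hs := Real.sq_sqrt hΔ'.le
    have hs0 := Real.sqrt_pos.2 hΔ'
    by_cases h : -a1 + √(a1 ^ 2 - 4 * a0 * a2) = 0
    · refine ⟨-a1 - √(a1 ^ 2 - 4 * a0 * a2), by intro h'; linarith, by linear_combination hs⟩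
    · exact ⟨_, h, by linear_combination hs⟩
  have hτ1 : τ + a1 ≠ 0 := by
    intro h; rw [h] at hτ; norm_num at hτ; linarith
  obtain ⟨x1, z1, x2, z2, hA1, hA2', hw, hpol, hBB⟩ : ∃ x1 z1 x2 z2 : ℝ, hm 2 A x1 z1 = 0 ∧
      hm 2 A x2 z2 = 0 ∧ x1 * z2 - x2 * z1 ≠ 0 ∧
      2 * a2 * x1 * x2 + a1 * (x1 * z2 + x2 * z1) + 2 * a0 * z1 * z2 ≠ 0 ∧
      0 < hm 3 B x1 z1 * hm 3 B x2 z2 := by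
    have r1 : hm 2 A τ (2 * a2) = 0 := by rw [hAf]; linear_combination a2 * hτ
    have r2 : hm 2 A (2 * a0) τ = 0 := by rw [hAf]; linear_combination a0 * hτ
    have w : τ * τ - (2 * a0) * (2 * a2) ≠ 0 := by
      have : τ * τ - (2 * a0) * (2 * a2) = 2 * τ * (τ + a1) := by linear_combination -hτ
      rw [this]; exact mul_ne_zero (mul_ne_zero two_ne_zero hτ0) hτ1
    have pol : 2 * a2 * τ * (2 * a0) + a1 * (τ * τ + (2 * a0) * (2 * a2)) + 2 * a0 * (2 * a2) * τ ≠ 0 := by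
      have : 2 * a2 * τ * (2 * a0) + a1 * (τ * τ + (2 * a0) * (2 * a2)) + 2 * a0 * (2 * a2) * τ
        = -(2 * τ * (a1 ^ 2 - 4 * a0 * a2)) := by linear_combination a1 * hτ
      rw [this]; exact neg_ne_zero.2 (mul_ne_zero (mul_ne_zero two_ne_zero hτ0) hΔ'.ne')
    have nz (x z : ℝ) (hx : ¬ (x = 0 ∧ z = 0)) (hr : hm 2 A x z = 0) : hm 3 B x z ≠ 0 := by
      intro h
      have := hm_identB x z A B Q b hA2 hB hQ eB
      rw [h, hr] at this
      have := mul_pos hb' (hm6g_pos x z hx)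
      linarith
    have n1 := nz τ (2 * a2) (fun h => hτ0 h.1) r1
    have n2 := nz (2 * a0) τ (fun h => hτ0 h.2) r2
    rcases lt_or_gt_of_ne (mul_ne_zero n1 n2) with h | h
    · refine ⟨τ, 2 * a2, -(2 * a0), -τ, r1, ?_, ?_, ?_, ?_⟩
      · rw [← r2, hAf, hAf]; ring
      · intro h; apply w; linear_combination -h
      · intro h; apply pol; linear_combination -h
      · have : hm 3 B (-(2 * a0)) (-τ) = - hm 3 B (2 * a0) τ := by rw [hm3, hm3]; ring
        rw [this]; linarith
    · exact ⟨_, _, _, _, r1, r2, w, pol, h⟩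
  obtain ⟨pol, hpol'⟩ : ∃ p, p = 2 * a2 * x1 * x2 + a1 * (x1 * z2 + x2 * z1) + 2 * a0 * z1 * z2 :=
    ⟨_, rfl⟩
  rw [← hpol'] at hpol
  have nv (s : ℝ) : ¬ ((1 - s) * x1 + s * x2 = 0 ∧ (1 - s) * z1 + s * z2 = 0) := by
    rintro ⟨u1, u2⟩
    have v1 : (1 - s) * (x1 * z2 - x2 * z1) = 0 := by linear_combination z2 * u1 - x2 * u2
    have v2 : s * (x1 * z2 - x2 * z1) = 0 := by linear_combination x1 * u2 - z1 * u1
    have := (mul_eq_zero.1 v1).resolve_right hw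
    have := (mul_eq_zero.1 v2).resolve_right hw
    linarith
  have hseg (s : ℝ) : hm 2 A ((1 - s) * x1 + s * x2) ((1 - s) * z1 + s * z2)
      = (1 - s) * s * pol := by
    rw [hAf] at hA1 hA2' ⊢
    rw [hpol']
    linear_combination (1 - s) ^ 2 * hA1 + s ^ 2 * hA2'
  obtain ⟨k, hk, hkp⟩ : ∃ k : ℤ, (k = 1 ∨ k = -1) ∧ 0 < (k : ℝ) * pol := by
    rcases lt_or_gt_of_ne hpol with h | h
    · exact ⟨-1, Or.inr rfl, by push_cast; linarith⟩
    · exact ⟨1, Or.inl rfl, by push_cast; linarith⟩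
  refine ⟨k, hk, ?_⟩
  intro M U e hM hU he hMU
  have id1 := hm_identM x1 z1 A M U k e hA2 hM hU hMU
  have id2 := hm_identM x2 z2 A M U k e hA2 hM hU hMU
  have jd1 := hm_identB x1 z1 A B Q b hA2 hB hQ eB
  have jd2 := hm_identB x2 z2 A B Q b hA2 hB hQ eB
  rw [hA1] at id1 jd1
  rw [hA2'] at id2 jd2
  have he' : (e : ℝ) ≠ 0 := by exact_mod_cast he
  have g1 : 0 < hm 6 (gP ℤ) x1 z1 := hm6g_pos _ _ (by
    rintro ⟨rfl, rfl⟩; simp at hw)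
  have hepos : (0 : ℝ) < e := by
    refine lt_of_le_of_ne ?_ he'.symm
    by_contra hneg
    push Not at hneg
    nlinarith [sq_nonneg (hm 3 M x1 z1), mul_pos_of_neg_of_neg hneg (neg_neg_of_pos g1)]
  have hMM := segment_sign x1 z1 x2 z2 M (by
    intro s hs0 hs1 h0
    have := hm_identM ((1 - s) * x1 + s * x2) ((1 - s) * z1 + s * z2) A M U k e hA2 hM hU hMU
    rw [h0, hseg] at this
    have p1 := mul_pos hepos (hm6g_pos _ _ (nv s))
    have p2 : 0 ≤ (k : ℝ) * ((1 - s) * s * pol) := by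
      have : (k : ℝ) * ((1 - s) * s * pol) = (1 - s) * s * (k * pol) := by ring
      rw [this]
      exact mul_nonneg (mul_nonneg (by linarith) hs0) hkp.le
    have p3 := mul_nonneg p2 (sq_nonneg
      (hm 2 U ((1 - s) * x1 + s * x2) ((1 - s) * z1 + s * z2)))
    linarith)
  have hB1 : hm 3 B x1 z1 ≠ 0 := by intro h; rw [h] at hBB; simp at hBB
  refine dependent A M B hA2 hM hB x1 z1 x2 z2 hw hA1 hA2' hB1 ?_
  set M1 := hm 3 M x1 z1
  set M2 := hm 3 M x2 z2
  set B1 := hm 3 B x1 z1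
  set B2 := hm 3 B x2 z2
  have hsq : (M1 * B2) ^ 2 = (M2 * B1) ^ 2 := by
    rw [mul_pow, mul_pow, id1, id2, jd1, jd2]; ring
  rcases sq_eq_sq_iff_eq_or_eq_neg.1 hsq with h | h
  · exact h
  · exfalso
    have p := mul_pos hMM hBB
    have : M1 * M2 * (B1 * B2) = -(M2 * B1) ^ 2 := by linear_combination M2 * B1 * h
    rw [this] at p
    nlinarith [sq_nonneg (M2 * B1)]

lemma real_neg (A B Q : ℤ[X]) (b : ℤ) (hb : b ≠ 0) (hA2 : A.natDegree ≤ 2)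
    (hB : B.natDegree ≤ 3) (hQ : Q.natDegree ≤ 4) (eB : B ^ 2 - C b ^ 2 * gP ℤ = A * Q)
    (hΔ : A.coeff 1 ^ 2 - 4 * A.coeff 0 * A.coeff 2 < 0) :
    ∃ k : ℤ, (k = 1 ∨ k = -1) ∧ Concl A B k := by
  have ha2 : A.coeff 2 ≠ 0 := by
    intro h; rw [h] at hΔ; nlinarith [sq_nonneg (A.coeff 1)]
  obtain ⟨k, hk, hk2⟩ : ∃ k : ℤ, (k = 1 ∨ k = -1) ∧ k * A.coeff 2 < 0 := by
    rcases lt_or_gt_of_ne ha2 with h | h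
    · exact ⟨1, Or.inl rfl, by linarith⟩
    · exact ⟨-1, Or.inr rfl, by linarith⟩
  refine ⟨k, hk, ?_⟩
  intro M U e hM hU he hMU
  have hepos : (0 : ℝ) < e := by
    have := hm_identM (1 : ℝ) 0 A M U k e hA2 hM hU hMU
    rw [hm6g, hm2 1 0 A] at this
    have h3 : (k : ℝ) * (A.coeff 2 : ℝ) < 0 := by exact_mod_cast hk2
    have he' : (e : ℝ) ≠ 0 := by exact_mod_cast he
    refine lt_of_le_of_ne ?_ he'.symm
    norm_num at this
    nlinarith [sq_nonneg (hm 3 M (1 : ℝ) 0), mul_nonneg (neg_nonneg.2 h3.le) (sq_nonneg (hm 2 U (1 : ℝ) 0))]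
  have ha2' : (A.coeff 2 : ℂ) ≠ 0 := by exact_mod_cast ha2
  obtain ⟨s, hs⟩ : ∃ s : ℂ, s * s = (A.coeff 1 : ℂ) ^ 2 - 4 * A.coeff 0 * A.coeff 2 := by
    obtain ⟨s, hs⟩ := IsAlgClosed.exists_pow_nat_eq
      ((A.coeff 1 : ℂ) ^ 2 - 4 * A.coeff 0 * A.coeff 2) (n := 2) (by norm_num)
    exact ⟨s, by rw [← hs]; ring⟩
  obtain ⟨α, hα⟩ : ∃ α : ℂ, hm 2 A α 1 = 0 := by
    refine ⟨(-A.coeff 1 + s) / (2 * A.coeff 2), ?_⟩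
    rw [hm2]
    field_simp
    linear_combination hs
  have hcj2 (P : ℤ[X]) : hm 2 P (starRingEnd ℂ α) 1 = starRingEnd ℂ (hm 2 P α 1) := by
    rw [hm2, hm2]; simp
  have hcj3 (P : ℤ[X]) : hm 3 P (starRingEnd ℂ α) 1 = starRingEnd ℂ (hm 3 P α 1) := by
    rw [hm3, hm3]; simp
  have hw : α * 1 - starRingEnd ℂ α * 1 ≠ 0 := by
    intro h
    have him : α = (α.re : ℂ) := by
      rw [mul_one, mul_one, sub_eq_zero] at h
      exact (Complex.conj_eq_iff_re.1 h.symm).symm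
    rw [him, hm2] at hα
    have hα' : (A.coeff 0 : ℝ) + A.coeff 1 * α.re + A.coeff 2 * α.re ^ 2 = 0 := by
      have : (((A.coeff 0 : ℝ) + A.coeff 1 * α.re + A.coeff 2 * α.re ^ 2 : ℝ) : ℂ) = 0 := by
        push_cast; linear_combination hα
      exact_mod_cast this
    have hΔ' : (A.coeff 1 : ℝ) ^ 2 - 4 * A.coeff 0 * A.coeff 2 < 0 := by exact_mod_cast hΔ
    have hid : (2 * (A.coeff 2 : ℝ) * α.re + A.coeff 1) ^ 2
        = (A.coeff 1 : ℝ) ^ 2 - 4 * A.coeff 0 * A.coeff 2 := by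
      linear_combination 4 * (A.coeff 2 : ℝ) * hα'
    have := sq_nonneg (2 * (A.coeff 2 : ℝ) * α.re + A.coeff 1)
    rw [hid] at this
    linarith
  have id1 := hm_identM α 1 A M U k e hA2 hM hU hMU
  have jd1 := hm_identB α 1 A B Q b hA2 hB hQ eB
  rw [hα] at id1 jd1
  have hb' : (b : ℂ) ≠ 0 := by exact_mod_cast hb
  have hone (n : ℕ) (P : ℤ[X]) (hP : P.natDegree ≤ n) : hm n P α 1 = aeval α P := by
    rw [hm, aeval_homogenize_of_eq_one hP _ (by simp)]; simp
  have hB1 : hm 3 B α 1 ≠ 0 := by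
    intro h
    rw [h] at jd1
    have hg : hm 6 (gP ℤ) α 1 = 0 := by
      have : (b : ℂ) ^ 2 * hm 6 (gP ℤ) α 1 = 0 := by linear_combination -jd1
      exact (mul_eq_zero.1 this).resolve_left (pow_ne_zero 2 hb')
    rw [hone 6 _ (gP_natDegree ℤ).le] at hg
    rw [hone 2 _ hA2] at hα
    exact no_common_root α A (by rintro rfl; simp at ha2) hA2 hα hg
  refine dependent A M B hA2 hM hB α 1 (starRingEnd ℂ α) 1 hw hα (by rw [hcj2, hα, map_zero]) hB1 ?_
  rw [hcj3, hcj3]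
  set M1 := hm 3 M α 1
  set B1 := hm 3 B α 1
  obtain ⟨ρ, hρ⟩ : ∃ ρ : ℂ, M1 = ρ * B1 := ⟨M1 / B1, by field_simp⟩
  have hρ2 : (b : ℂ) ^ 2 * ρ ^ 2 = e := by
    have : ((b : ℂ) ^ 2 * ρ ^ 2 - e) * B1 ^ 2 = 0 := by
      rw [hρ] at id1
      linear_combination (b : ℂ) ^ 2 * id1 - e * jd1
    have := (mul_eq_zero.1 this).resolve_right (pow_ne_zero 2 hB1)
    linear_combination this
  have hre : starRingEnd ℂ ρ = ρ := by
    rw [Complex.conj_eq_iff_im]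
    have c1 := congrArg Complex.re hρ2
    have c2 := congrArg Complex.im hρ2
    have e1 : (b : ℂ) ^ 2 * ρ ^ 2 = ((b : ℝ) * ρ) * ((b : ℝ) * ρ) := by push_cast; ring
    rw [e1] at c1 c2
    simp at c1 c2
    by_contra him
    have hbr : (b : ℝ) ≠ 0 := by exact_mod_cast hb
    have : ρ.re = 0 := by
      have : (b : ℝ) ^ 2 * ρ.im * (2 * ρ.re) = 0 := by linear_combination c2
      simpa [hbr, him] using this
    rw [this] at c1
    nlinarith [sq_nonneg ((b : ℝ) * ρ.im)]
  rw [hρ, map_mul, hre]; ring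

end N3M2

open Polynomial NumberField

namespace N3M2

namespace Dat

variable {L : Type} [Field L] [NumberField L] (D : Dat L)

lemma exists_MU (ζ : 𝓞 L) : ∃ M U : ℤ[X], M.natDegree ≤ 3 ∧ U.natDegree ≤ 2 ∧ ¬ (M = 0 ∧ U = 0) ∧
    aeval D.θ M = ζ * aeval D.θ U := by
  set w : Fin 7 → L := ![1, D.θ, (D.θ : L) ^ 2, (D.θ : L) ^ 3, -ζ, -ζ * D.θ, -ζ * (D.θ : L) ^ 2]
    with hw
  have h1 : ¬ LinearIndependent ℤ w := by
    intro h
    rw [LinearIndependent.iff_fractionRing ℤ ℚ] at h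
    have := h.fintype_card_le_finrank
    rw [D.hfin, Fintype.card_fin] at this
    omega
  rw [Fintype.not_linearIndependent_iff] at h1
  obtain ⟨c, hc, i, hi⟩ := h1
  refine ⟨C (c 0) + C (c 1) * X + C (c 2) * X ^ 2 + C (c 3) * X ^ 3,
    C (c 4) + C (c 5) * X + C (c 6) * X ^ 2, by compute_degree, by compute_degree, ?_, ?_⟩
  · rintro ⟨hM, hU⟩
    have hM' := coeffs6 (a0 := c 0) (a1 := c 1) (a2 := c 2) (a3 := c 3) (a4 := 0) (a5 := 0) (a6 := 0)
      (b0 := 0) (b1 := 0) (b2 := 0) (b3 := 0) (b4 := 0) (b5 := 0) (b6 := 0) (by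
        simp only [C_0]; linear_combination hM)
    have hU' := coeffs6 (a0 := c 4) (a1 := c 5) (a2 := c 6) (a3 := 0) (a4 := 0) (a5 := 0) (a6 := 0)
      (b0 := 0) (b1 := 0) (b2 := 0) (b3 := 0) (b4 := 0) (b5 := 0) (b6 := 0) (by
        simp only [C_0]; linear_combination hU)
    apply hi
    fin_cases i
    · exact hM'.1
    · exact hM'.2.1
    · exact hM'.2.2.1
    · exact hM'.2.2.2.1
    · exact hU'.1
    · exact hU'.2.1
    · exact hU'.2.2.1
  · apply RingOfIntegers.coe_injective
    simp [Fin.sum_univ_succ, hw] at hc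
    simp
    linear_combination hc

lemma hpolyZ (P : ℤ[X]) (hP : P.natDegree ≤ 5) (h : aeval D.θ P = 0) : P = 0 := by
  have h' := congrArg (algebraMap (𝓞 L) L) h
  rw [deg5 hP] at h'
  simp at h'
  obtain ⟨h0, h1, h2, h3, h4, h5⟩ := D.hpoly (P.coeff 0) (P.coeff 1) (P.coeff 2) (P.coeff 3)
    (P.coeff 4) (P.coeff 5) (by push_cast; linear_combination h')
  rw [deg5 hP]
  norm_cast at h0 h1 h2 h3 h4 h5
  simp [h0, h1, h2, h3, h4, h5]

lemma mul_g (P : ℤ[X]) (hP : P.natDegree ≤ 6) (h : aeval D.θ P = 0) :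
    P = C (P.coeff 6) * gP ℤ := by
  rw [← sub_eq_zero]
  apply D.hpolyZ
  · have : (P - C (P.coeff 6) * gP ℤ).natDegree ≤ 6 := by
      refine (natDegree_sub_le _ _).trans (max_le hP ?_)
      refine (natDegree_C_mul_le _ _).trans (gP_natDegree ℤ).le
    by_contra hc
    have h6 : (P - C (P.coeff 6) * gP ℤ).natDegree = 6 := by omega
    have h0 : (P - C (P.coeff 6) * gP ℤ).coeff 6 = 0 := by
      have hg : (gP ℤ).coeff 6 = 1 := by
        have := gP_monic ℤ
        rwa [Monic, leadingCoeff, gP_natDegree] at this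
      rw [coeff_sub, coeff_C_mul, hg]; ring
    have : P - C (P.coeff 6) * gP ℤ = 0 := leadingCoeff_eq_zero.1 (by rw [leadingCoeff, h6, h0])
    rw [this] at h6; simp at h6
  · rw [map_sub, map_mul, D.gP_zero, h]; simp

end Dat

/-- discriminant -/
def dsc (A : ℤ[X]) : ℤ := A.coeff 1 ^ 2 - 4 * A.coeff 0 * A.coeff 2

lemma not_dvd_g (A : ℤ[X]) (hA2 : A.natDegree ≤ 2) (hd : dsc A ≠ 0) (n : ℤ) (hn : n ≠ 0)
    (Q : ℤ[X]) (h : C n * gP ℤ = A * Q) : False := by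
  have h1 : A.natDegree ≠ 0 := by
    intro h0
    apply hd
    rw [dsc, coeff_eq_zero_of_natDegree_lt (n := 1) (by omega),
      coeff_eq_zero_of_natDegree_lt (n := 2) (by omega)]; ring
  have h2 : (A.map (algebraMap ℤ ℂ)).degree ≠ 0 := by
    rw [degree_map_eq_of_injective (RingHom.injective_int _)]
    intro h
    exact h1 (natDegree_eq_of_degree_eq_some h)
  obtain ⟨α, hα⟩ := IsAlgClosed.exists_root (A.map (algebraMap ℤ ℂ)) h2
  have hα' : aeval α A = 0 := by
    rw [aeval_def, ← eval_map]; exact hα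
  refine no_common_root α A ?_ hA2 hα' ?_
  · rintro rfl; simp at h1
  · have := congrArg (aeval α) h
    rw [map_mul, map_mul, hα', zero_mul, aeval_C] at this
    refine (mul_eq_zero.1 this).resolve_left ?_
    simpa using hn

lemma dsc_sq (T A : ℤ[X]) (k : ℤ) (hk : k = 1 ∨ k = -1) (hA2 : A.natDegree ≤ 2)
    (h : T ^ 2 = C k * A) : dsc A = 0 := by
  have hT : T.natDegree ≤ 1 := by
    have h1 : (T ^ 2).natDegree ≤ 2 := by rw [h]; exact (natDegree_C_mul_le _ _).trans hA2
    rw [natDegree_pow] at h1; omega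
  have hA : A = C k * T ^ 2 := by
    rw [h, ← mul_assoc, ← C_mul]
    rcases hk with rfl | rfl <;> simp
  have e := deg2 hA2
  have h0 : C (A.coeff 0) + C (A.coeff 1) * X + C (A.coeff 2) * X ^ 2
    = C k * (C (T.coeff 0) + C (T.coeff 1) * X) ^ 2 := by
    rw [← deg1 hT, ← deg2 hA2, hA]
  obtain ⟨c0, c1, c2, -⟩ := coeffs6 (a0 := A.coeff 0) (a1 := A.coeff 1) (a2 := A.coeff 2) (a3 := 0)
    (a4 := 0) (a5 := 0) (a6 := 0) (b0 := k * T.coeff 0 ^ 2) (b1 := k * (2 * T.coeff 0 * T.coeff 1))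
    (b2 := k * T.coeff 1 ^ 2) (b3 := 0) (b4 := 0) (b5 := 0) (b6 := 0) (by
      simp only [C_0, C_mul, C_pow, map_ofNat]; linear_combination h0)
  rw [dsc, c0, c1, c2]; ring

/-- step VI, first half -/
lemma Dat.exists_rel {L : Type} [Field L] [NumberField L] (D : Dat L) (A : ℤ[X])
    (hA : A.IsPrimitive) (hA2 : A.natDegree ≤ 2) (hd : dsc A ≠ 0) (b : ℤ) (hb : b ≠ 0)
    (B Q : ℤ[X]) (hB : B.natDegree ≤ 3) (hQ : Q.natDegree ≤ 4)
    (eB : B ^ 2 - C b ^ 2 * gP ℤ = A * Q) (h1 : 2 ∣ A.coeff 1) :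
    ∃ (k l m e : ℤ) (M U T : ℤ[X]), (k = 1 ∨ k = -1) ∧ l ≠ 0 ∧ m ≠ 0 ∧ M.natDegree ≤ 3 ∧
      U.natDegree ≤ 2 ∧ U ≠ 0 ∧ T.natDegree ≤ 1 ∧ M ^ 2 - C k * A * U ^ 2 = C e * gP ℤ ∧
      C l * M + C m * B + A * T = 0 ∧ l ^ 2 * e = m ^ 2 * b ^ 2 := by
  have hA0 : A ≠ 0 := hA.ne_zero
  obtain ⟨ξ, hξ⟩ := D.is_sq A hA hA2 b hb B Q hB hQ eB h1
  obtain ⟨k, hk, hcon⟩ : ∃ k : ℤ, (k = 1 ∨ k = -1) ∧ Concl A B k := by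
    rcases lt_or_gt_of_ne hd with h | h
    · exact real_neg A B Q b hb hA2 hB hQ eB h
    · exact real_pos A B Q b hb hA2 hB hQ eB h
  obtain ⟨ζ, hζ⟩ : ∃ ζ : 𝓞 L, ζ ^ 2 = k * aeval D.θ A := by
    rcases hk with rfl | rfl
    · exact ⟨ξ, by rw [hξ]; simp⟩
    · exact ⟨D.I * ξ, by rw [hξ, mul_pow, D.hI]; simp⟩
  obtain ⟨M, U, hM, hU, hMU0, hMU⟩ := D.exists_MU ζ
  have hU0 : U ≠ 0 := by
    rintro rfl
    rw [map_zero, mul_zero] at hMU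
    exact hMU0 ⟨D.hpolyZ M (by omega) hMU, rfl⟩
  have hE := D.mul_g (M ^ 2 - C k * A * U ^ 2) (by
      refine (natDegree_sub_le _ _).trans (max_le (natDegree_pow_le.trans (by omega)) ?_)
      refine natDegree_mul_le.trans ?_
      have := (natDegree_C_mul_le k A)
      have := natDegree_pow_le (p := U) (n := 2)
      omega) (by
      rw [map_sub, map_mul, map_mul, map_pow, map_pow, hMU, mul_pow, hζ, aeval_C]; simp)
  set e := (M ^ 2 - C k * A * U ^ 2).coeff 6
  have he : e ≠ 0 := by
    intro he
    rw [he, C_0, zero_mul, sub_eq_zero] at hE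
    have hdv : U ∣ M := by
      rw [← IsIntegrallyClosed.pow_dvd_pow_iff (n := 2) (by norm_num)]
      exact ⟨C k * A, by rw [hE]; ring⟩
    obtain ⟨T, rfl⟩ := hdv
    refine hd (dsc_sq T A k hk hA2 ?_)
    refine mul_left_cancel₀ (pow_ne_zero 2 hU0) ?_
    linear_combination hE
  obtain ⟨l, m, T, hT, hrel, hne⟩ := hcon M U e hM hU he hE
  have hkey : C (l ^ 2 * e - m ^ 2 * b ^ 2) * gP ℤ
      = A * (C m ^ 2 * Q - C l ^ 2 * C k * U ^ 2 + T * (2 * C m * B + A * T)) := by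
    have hlM : C l * M = -(C m * B + A * T) := by linear_combination hrel
    simp only [C_sub, C_mul, C_pow]
    linear_combination -C l ^ 2 * hE + C m ^ 2 * eB + (C l * M - (C m * B + A * T)) * hlM
  have hlm : l ^ 2 * e = m ^ 2 * b ^ 2 := by
    by_contra hc
    exact not_dvd_g A hA2 hd _ (sub_ne_zero.2 hc) _ hkey
  have hiff : l = 0 ↔ m = 0 := by
    constructor
    · rintro rfl
      have : m ^ 2 * b ^ 2 = 0 := by rw [← hlm]; ring
      simpa [hb] using this
    · rintro rfl
      have : l ^ 2 * e = 0 := by rw [hlm]; ring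
      simpa [he] using this
  have hl : l ≠ 0 := by
    intro hl
    have hm := hiff.1 hl
    rw [hl, hm, C_0] at hrel
    have : A * T = 0 := by linear_combination hrel
    exact hne ⟨hl, hm, (mul_eq_zero.1 this).resolve_left hA0⟩
  exact ⟨k, l, m, e, M, U, T, hk, hl, fun h => hl (hiff.2 h), hM, hU, hU0, hT, hE, hrel, hlm⟩

/-- dividing out common factors -/
lemma gcd_out (e : ℤ) (N : ℤ[X]) (he : e ≠ 0) : ∃ (d e' : ℤ) (N' : ℤ[X]), d ≠ 0 ∧ e = d * e' ∧
    N = C d * N' ∧ ¬ (2 ∣ e' ∧ C 2 ∣ N') := by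
  induction' hn : e.natAbs using Nat.strong_induction_on with n ih generalizing e N
  by_cases h : 2 ∣ e ∧ C 2 ∣ N
  · obtain ⟨⟨e1, rfl⟩, N1, rfl⟩ := h
    obtain ⟨d, e', N', hd, h1, h2, h3⟩ := ih e1.natAbs (by omega) e1 N1 (by omega) rfl
    exact ⟨2 * d, e', N', by omega, by rw [h1]; ring, by rw [h2, C_mul]; ring, h3⟩
  · exact ⟨1, e, N, one_ne_zero, by ring, by simp, h⟩

/-- step VI, conclusion -/
lemma stepA (A : ℤ[X])
    (hA : A.IsPrimitive) (hA2 : A.natDegree ≤ 2) (hd : dsc A ≠ 0) (b : ℤ) (hb : b ≠ 0)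
    (N Q : ℤ[X]) (hN : N.natDegree ≤ 3) (hQ : Q.natDegree ≤ 4)
    (eN : N ^ 2 + C b * hP ℤ * N - C b ^ 2 * qP ℤ = A * Q) (h1 : 2 ∣ A.coeff 1) :
    ∃ (k e : ℤ) (U N' T : ℤ[X]), e ≠ 0 ∧ U.natDegree ≤ 2 ∧ U.IsPrimitive ∧ N'.natDegree ≤ 3 ∧
      T.natDegree ≤ 1 ∧ ¬ (2 ∣ e ∧ C 2 ∣ N') ∧
      N' ^ 2 + C e * hP ℤ * N' - C e ^ 2 * qP ℤ = C k * A * U ^ 2 ∧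
      C b * N' = C e * N - A * T := by
  obtain ⟨D⟩ := exists_dat
  have hhd : (hP ℤ).natDegree ≤ 3 := by rw [hP]; compute_degree
  have hBd : (C b * hP ℤ + 2 * N).natDegree ≤ 3 := by
    refine (natDegree_add_le _ _).trans (max_le ((natDegree_C_mul_le _ _).trans hhd) ?_)
    exact (natDegree_C_mul_le 2 _).trans hN
  obtain ⟨k, l, m, e, M, U, T, hk, hl, hm, hM, hU, hU0, hT, hE, hrel, hlm⟩ :=
    D.exists_rel A hA hA2 hd b hb (C b * hP ℤ + 2 * N) (4 * Q) hBd
      ((natDegree_C_mul_le 4 _).trans hQ) (by rw [gP_eq]; linear_combination 4 * eN) h1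
  obtain ⟨d, e', N', hd0, h2, h3, h4⟩ := gcd_out (-2 * m * b) (C l * M + C (m * b) * hP ℤ) (by
    simp [hm, hb])
  have h2C : -2 * C m * C b = C d * C e' := by
    rw [← C_mul, ← h2]; simp
  have hlmC : C l ^ 2 * C e = C m ^ 2 * C b ^ 2 := by
    simp only [← C_pow, ← C_mul]; rw [hlm]
  rw [C_mul] at h3
  have hUp : U = C U.content * U.primPart := U.eq_C_content_mul_primPart
  set c := U.content
  set U' := U.primPart
  have hpU : U'.IsPrimitive := U.isPrimitive_primPart
  have key : C (d ^ 2) * (N' ^ 2 + C e' * hP ℤ * N' - C e' ^ 2 * qP ℤ)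
      = (A * U' ^ 2) * C (l ^ 2 * k * c ^ 2) := by
    have hE' := hE
    rw [hUp, gP_eq] at hE'
    simp only [C_mul, C_pow]
    linear_combination C l ^ 2 * hE' - (C l * M + C m * C b * hP ℤ + C d * N' - 2 * C m * C b * hP ℤ) * h3
      + (hP ℤ ^ 2 + 4 * qP ℤ) * hlmC
      - (C d * N' * hP ℤ  - C d * C e' * qP ℤ + 2 * C m * C b * qP ℤ) * h2C
  obtain ⟨K, hK⟩ := prim_cancel _ _ _ (hA.mul (by rw [pow_two]; exact hpU.mul hpU)) _ key
  have hC0 (n : ℤ) (hn : n ≠ 0) : (C n : ℤ[X]) ≠ 0 := by rwa [Ne, C_eq_zero]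
  have hKd : K.natDegree ≤ 0 := by
    rw [← natDegree_C_mul (a := d ^ 2) (pow_ne_zero 2 hd0), ← hK, natDegree_C]
  obtain ⟨k', rfl⟩ : ∃ k', K = C k' := ⟨_, eq_C_of_natDegree_le_zero hKd⟩
  have hT' : C d * (C e' * N - C b * N') = A * (C b * T) := by
    linear_combination - N * h2C + C b * h3 - C b * hrel
  obtain ⟨T', hT''⟩ := prim_cancel _ _ _ hA _ hT'
  refine ⟨k', e', U', N', T', ?_, ?_, hpU, ?_, ?_, h4, ?_, ?_⟩
  · rintro rfl
    rw [mul_zero] at h2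
    simp [hm, hb] at h2
  · rw [natDegree_primPart]; exact hU
  · rw [← natDegree_C_mul (a := d) hd0, ← h3]
    refine (natDegree_add_le _ _).trans (max_le ((natDegree_C_mul_le _ _).trans hM) ?_)
    rw [← C_mul]
    exact (natDegree_C_mul_le _ _).trans hhd
  · rw [← natDegree_C_mul (a := d) hd0, ← hT'']
    exact (natDegree_C_mul_le _ _).trans hT
  · refine mul_left_cancel₀ (hC0 _ (pow_ne_zero 2 hd0)) ?_
    rw [key, hK]; ring
  · refine mul_left_cancel₀ (hC0 _ hd0) ?_
    linear_combination -hT' - A * hT''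

end N3M2

open Polynomial NumberField

namespace N3M2

/-- `N` is a multiple of `A` modulo two, as forms of degrees three and two -/
def Mult (A N : ℤ[X]) : Prop := ∃ R S : ℤ[X], R.natDegree ≤ 1 ∧ N = A * R + C 2 * S

lemma mult_of_map (A N : ℤ[X]) (R : (ZMod 2)[X]) (hA : A.natDegree ≤ 2) (hN : N.natDegree ≤ 3)
    (hR : R.natDegree ≤ 1)
    (h : N.map (Int.castRingHom (ZMod 2)) = A.map (Int.castRingHom (ZMod 2)) * R) : Mult A N := by
  have : Fact (Nat.Prime 2) := ⟨Nat.prime_two⟩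
  obtain ⟨R', h1, h2⟩ := lift_zmod 2 R 1 hR
  obtain ⟨S, -, hS⟩ := eq_of_map_eq 2 N (A * R') 3 hN (natDegree_mul_le.trans (by omega))
    (by rw [h, Polynomial.map_mul, h1])
  exact ⟨R', S, h2, by exact_mod_cast hS⟩

lemma cast_even (n : ℤ) : ((n : ℤ) : ZMod 2) = 0 ↔ 2 ∣ n := by
  exact_mod_cast ZMod.intCast_zmod_eq_zero_iff_dvd n 2

lemma dec1 : ∀ a0 a2 n0 n1 n2 n3 q0 q1 q2 q3 q4 : ZMod 2,
    n0 ^ 2 = a0 * q0 → 2 * n0 * n1 = a0 * q1 + q0 → n1 ^ 2 + 2 * n0 * n2 = a0 * q2 + q1 + a2 * q0 →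
    2 * n0 * n3 + 2 * n1 * n2 = a0 * q3 + q2 + a2 * q1 →
    n2 ^ 2 + 2 * n1 * n3 = a0 * q4 + q3 + a2 * q2 →
    2 * n2 * n3 = q4 + a2 * q3 → n3 ^ 2 = a2 * q4 →
    ∃ r0 r1 : ZMod 2, n0 = a0 * r0 ∧ n1 = a0 * r1 + r0 ∧ n2 = a2 * r0 + r1 ∧ n3 = a2 * r1 := by
  decide +kernel

lemma dec2 : ∀ t n0 n1 n2 n3 q0 q1 q2 q3 q4 : ZMod 2,
    n0 ^ 2 = t * q0 → 2 * n0 * n1 = t * q1 → n1 ^ 2 + 2 * n0 * n2 = t * q2 + q0 →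
    2 * n0 * n3 + 2 * n1 * n2 = t * q3 + q1 →
    n2 ^ 2 + 2 * n1 * n3 = t * q4 + q2 →
    2 * n2 * n3 = q3 → n3 ^ 2 = q4 →
    n0 + n1 * t + n2 * t ^ 2 + n3 * t ^ 3 = 0 ∧
    ((n1 + 2 * n2 * t + 3 * n3 * t ^ 2 = 1 ∧ q0 + q1 * t + q2 * t ^ 2 + q3 * t ^ 3 + q4 * t ^ 4 = 1) ∨
    ∃ r0 r1 : ZMod 2, n0 = t * r0 ∧ n1 = t * r1 ∧ n2 = r0 ∧ n3 = r1) := by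
  decide +kernel

lemma dec3 : ∀ u0 u1 u2 r0 r1 r2 a0 a2 : ZMod 2,
    u0 * r0 = a0 → u0 * r1 + u1 * r0 = a0 + a2 → u0 * r2 + u1 * r1 + u2 * r0 = a2 →
    u1 * r2 + u2 * r1 = a0 → u2 * r2 = a2 → (u0 = 0 ∧ u1 = 0 ∧ u2 = 0) ∨ (a0 = 0 ∧ a2 = 0) := by
  decide +kernel

lemma map_deg {P : ℤ[X]} {n : ℕ} (h : P.natDegree ≤ n) :
    (P.map (Int.castRingHom (ZMod 2))).natDegree ≤ n := natDegree_map_le.trans h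

lemma map_sq_eq (A N Q X0 : ℤ[X]) (h : N ^ 2 + C 2 * X0 = A * Q) :
    N.map (Int.castRingHom (ZMod 2)) ^ 2
      = A.map (Int.castRingHom (ZMod 2)) * Q.map (Int.castRingHom (ZMod 2)) := by
  rw [← Polynomial.map_pow, ← Polynomial.map_mul, ← h]
  simp only [Polynomial.map_add, Polynomial.map_mul, map_C]
  have : Int.castRingHom (ZMod 2) 2 = 0 := by decide
  rw [this]; simp

lemma sq_coeffs (A N Q : (ZMod 2)[X]) (hA : A.natDegree ≤ 2) (hN : N.natDegree ≤ 3)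
    (hQ : Q.natDegree ≤ 4) (h : N ^ 2 = A * Q) :
    N.coeff 0 ^ 2 = A.coeff 0 * Q.coeff 0 ∧
    2 * N.coeff 0 * N.coeff 1 = A.coeff 0 * Q.coeff 1 + A.coeff 1 * Q.coeff 0 ∧
    N.coeff 1 ^ 2 + 2 * N.coeff 0 * N.coeff 2
      = A.coeff 0 * Q.coeff 2 + A.coeff 1 * Q.coeff 1 + A.coeff 2 * Q.coeff 0 ∧
    2 * N.coeff 0 * N.coeff 3 + 2 * N.coeff 1 * N.coeff 2
      = A.coeff 0 * Q.coeff 3 + A.coeff 1 * Q.coeff 2 + A.coeff 2 * Q.coeff 1 ∧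
    N.coeff 2 ^ 2 + 2 * N.coeff 1 * N.coeff 3
      = A.coeff 0 * Q.coeff 4 + A.coeff 1 * Q.coeff 3 + A.coeff 2 * Q.coeff 2 ∧
    2 * N.coeff 2 * N.coeff 3 = A.coeff 1 * Q.coeff 4 + A.coeff 2 * Q.coeff 3 ∧
    N.coeff 3 ^ 2 = A.coeff 2 * Q.coeff 4 := by
  apply coeffs6
  have h' := h
  rw [deg2 hA, deg3 hN, deg4 hQ] at h'
  simp only [C_add, C_mul, C_pow, map_ofNat]
  linear_combination h'

lemma a1_even (A N Q X0 : ℤ[X]) (hA : A.natDegree ≤ 2) (hN : N.natDegree ≤ 3)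
    (hQ : Q.natDegree ≤ 4) (h : N ^ 2 + C 2 * X0 = A * Q) (hm : ¬ Mult A N) : 2 ∣ A.coeff 1 := by
  by_contra hodd
  have h1 := map_sq_eq A N Q X0 h
  obtain ⟨c0, c1, c2, c3, c4, c5, c6⟩ := sq_coeffs _ _ _ (map_deg hA) (map_deg hN) (map_deg hQ) h1
  have ha : (A.map (Int.castRingHom (ZMod 2))).coeff 1 = 1 := by
    rw [coeff_map, eq_intCast]
    rw [← cast_even] at hodd
    generalize (A.coeff 1 : ZMod 2) = z at hodd
    revert z; decide
  rw [ha] at c1 c2 c3 c4 c5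
  simp only [one_mul] at c1 c2 c3 c4 c5
  obtain ⟨r0, r1, d0, d1, d2, d3⟩ := dec1 _ _ _ _ _ _ _ _ _ _ _ c0 c1 c2 c3 c4 c5 c6
  refine hm (mult_of_map A N (C r0 + C r1 * X) hA hN (by compute_degree) ?_)
  rw [deg3 (map_deg hN), deg2 (map_deg hA), d0, d1, d2, d3, ha]
  simp only [C_add, C_mul, C_1]; ring

lemma arith (r : ℕ) (f F F' V V' W h h' q q' l : ℤ) (hF : F = V + f * h) (hF' : F' = V' + f * h')
    (hV : 2 ∣ V) (hV' : ¬ 2 ∣ V') (hW : ¬ 2 ∣ W) (hh : ¬ 2 ∣ h)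
    (E1 : (2 : ℤ) ^ (r + 2) ∣ F ^ 2 - f ^ 2 * (h ^ 2 + 4 * q))
    (E2 : (2 : ℤ) ^ (r + 2) ∣ l * F + 2 ^ r * W)
    (E3 : (2 : ℤ) ^ (r + 1) ∣ F * F' - f ^ 2 * (h * h' + 2 * q')) : False := by
  have hF2 : ¬ (2 : ℤ) ^ (r + 1) ∣ F := by
    intro hd
    have h1 : (2 : ℤ) ^ (r + 1) ∣ 2 ^ r * W :=
      (dvd_add_right (hd.mul_left l)).1 ((pow_dvd_pow 2 (by omega)).trans E2)
    rw [pow_succ] at h1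
    exact hW (Int.dvd_of_mul_dvd_mul_left (by positivity) h1)
  have cop (x : ℤ) (hx : ¬ 2 ∣ x) (n : ℕ) : IsCoprime ((2 : ℤ) ^ n) x :=
    IsCoprime.pow_left ((Int.prime_two.coprime_iff_not_dvd).2 hx)
  have E3' : (2 : ℤ) ∣ F * F' - f ^ 2 * (h * h' + 2 * q') := (dvd_pow_self 2 (by omega)).trans E3
  by_cases hf : 2 ∣ f
  · have hF'o : ¬ 2 ∣ F' := by
      intro hd; rw [hF'] at hd
      exact hV' ((dvd_add_left (hf.mul_right _)).1 hd)
    have key (n : ℕ) (hn : n ≤ r + 1) (hd : (2 : ℤ) ^ n ∣ f ^ 2) : (2 : ℤ) ^ n ∣ F := by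
      have h1 : (2 : ℤ) ^ n ∣ F * F' :=
        (dvd_sub_left (hd.mul_right _)).1 ((pow_dvd_pow 2 hn).trans E3)
      exact (cop F' hF'o n).dvd_of_dvd_mul_right h1
    by_cases hf0 : f = 0
    · exact hF2 (key _ le_rfl (by rw [hf0]; simp))
    obtain ⟨φ, f1, hf1, rfl⟩ : ∃ (φ : ℕ) (f1 : ℤ), ¬ 2 ∣ f1 ∧ f = 2 ^ φ * f1 := by
      obtain ⟨φ, f1, h1, h2⟩ := WfDvdMonoid.max_power_factor hf0 Int.prime_two.irreducible
      exact ⟨φ, f1, h1, h2⟩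
    have hφ : φ ≠ 0 := by
      rintro rfl; rw [pow_zero, one_mul] at hf; exact hf1 hf
    have e2 : ((2 : ℤ) ^ φ * f1) ^ 2 = 2 ^ (2 * φ) * f1 ^ 2 := by rw [mul_pow, ← pow_mul, mul_comm φ]
    by_cases hc : r + 1 ≤ 2 * φ
    · exact hF2 (key _ le_rfl (by rw [e2]; exact (pow_dvd_pow 2 hc).mul_right _))
    · have h1 := key (2 * φ) (by omega) (by rw [e2]; exact Dvd.intro _ rfl)
      have h2 : (2 : ℤ) ^ (2 * φ + 1) ∣ F ^ 2 := by
        have := pow_dvd_pow_of_dvd h1 2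
        rw [← pow_mul] at this
        exact (pow_dvd_pow 2 (by omega)).trans this
      have h3 : (2 : ℤ) ^ (2 * φ + 1) ∣ (2 ^ φ * f1) ^ 2 * (h ^ 2 + 4 * q) :=
        (dvd_sub_right h2).1 ((pow_dvd_pow 2 (by omega)).trans E1)
      rw [e2, pow_succ, mul_assoc] at h3
      have h4 := Int.dvd_of_mul_dvd_mul_left (by positivity) h3
      rcases Int.prime_two.dvd_or_dvd h4 with h5 | h5
      · exact hf1 (Int.prime_two.dvd_of_dvd_pow h5)
      · have : (2 : ℤ) ∣ h ^ 2 := (dvd_add_left (by omega)).1 h5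
        exact hh (Int.prime_two.dvd_of_dvd_pow this)
  · rw [← cast_even] at *
    subst hF hF'
    push_cast at *
    have h2 : (2 : ZMod 2) = 0 := by decide
    rw [hV, h2] at E3'
    generalize (f : ZMod 2) = f at *
    generalize (V' : ZMod 2) = V' at *
    generalize (h : ZMod 2) = h at *
    generalize (h' : ZMod 2) = h' at *
    generalize (q' : ZMod 2) = q' at *
    clear hW hV E1 E2 E3 hF2 cop
    revert f V' h h' q'
    decide +kernel

lemma core (r : ℕ) (f : ℤ) (U V W L R h q : ℤ[X]) (hU : U.natDegree ≤ 2) (hV : V.natDegree ≤ 3)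
    (hW : W.natDegree ≤ 4) (hh : ∀ t : ℤ, ¬ 2 ∣ h.eval t)
    (e1 : V ^ 2 + C (2 * f) * h * V - C (2 * f) ^ 2 * q = U * W)
    (e2 : L * (V + C f * h) + C (2 ^ r) * W = U * R)
    (hu1 : 2 ∣ U.coeff 1) (hu2 : ¬ 2 ∣ U.coeff 2) (hd : 2 ^ (r + 4) ∣ dsc U) (hm : ¬ Mult U V) :
    False := by
  obtain ⟨v, hv⟩ := hu1
  have hd' : (2 : ℤ) ^ (r + 2) ∣ v ^ 2 - U.coeff 0 * U.coeff 2 := by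
    rw [dsc, hv, show (2 * v) ^ 2 - 4 * U.coeff 0 * U.coeff 2
      = 4 * (v ^ 2 - U.coeff 0 * U.coeff 2) by ring,
      show (2 : ℤ) ^ (r + 4) = 4 * 2 ^ (r + 2) by ring] at hd
    exact Int.dvd_of_mul_dvd_mul_left (by norm_num) hd
  have cop : IsCoprime ((2 : ℤ) ^ (r + 2)) (U.coeff 2) :=
    IsCoprime.pow_left ((Int.prime_two.coprime_iff_not_dvd).2 hu2)
  obtain ⟨t, ht⟩ : ∃ t : ℤ, (2 : ℤ) ^ (r + 2) ∣ U.coeff 2 * t + v := by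
    obtain ⟨a, b, hab⟩ := cop
    exact ⟨-v * b, v * a, by linear_combination -v * hab⟩
  have hUt : U.eval t = U.coeff 0 + 2 * v * t + U.coeff 2 * t ^ 2 := by
    conv_lhs => rw [deg2 hU]
    simp [hv]
  have hU't : U.derivative.eval t = 2 * (U.coeff 2 * t + v) := by
    conv_lhs => rw [deg2 hU]
    simp [hv]; ring
  have h1 : (2 : ℤ) ^ (r + 2) ∣ U.eval t := by
    refine cop.dvd_of_dvd_mul_left (z := U.eval t) ?_
    rw [hUt, show U.coeff 2 * (U.coeff 0 + 2 * v * t + U.coeff 2 * t ^ 2)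
      = (U.coeff 2 * t + v) * (U.coeff 2 * t + v) - (v ^ 2 - U.coeff 0 * U.coeff 2) by ring]
    exact dvd_sub (ht.mul_right _) hd'
  obtain ⟨d1, hd1⟩ := h1
  obtain ⟨d2, hd2⟩ := ht
  -- parities
  have hsq := map_sq_eq U V W (C f * h * V - 2 * C f ^ 2 * q) (by
    rw [← e1]; simp only [C_mul, map_ofNat]; ring)
  obtain ⟨c0, c1, c2, c3, c4, c5, c6⟩ := sq_coeffs _ _ _ (map_deg hU) (map_deg hV) (map_deg hW) hsq
  have hb1 : (U.map (Int.castRingHom (ZMod 2))).coeff 1 = 0 := by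
    rw [coeff_map, eq_intCast, cast_even, hv]; exact Dvd.intro _ rfl
  have hb2 : (U.map (Int.castRingHom (ZMod 2))).coeff 2 = 1 := by
    rw [coeff_map, eq_intCast]
    rw [← cast_even] at hu2
    generalize (U.coeff 2 : ZMod 2) = z at hu2
    revert z; decide
  have hb0 : (U.map (Int.castRingHom (ZMod 2))).coeff 0 = (t : ZMod 2) := by
    have h2 : (2 : ZMod 2) = 0 := by decide
    have e := hUt
    rw [hd1] at e
    have e' := congrArg (Int.cast : ℤ → ZMod 2) e
    rw [coeff_map, eq_intCast] at hb2 ⊢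
    push_cast at e'
    rw [hb2, h2] at e'
    generalize ((U.coeff 0 : ℤ) : ZMod 2) = z at *
    generalize (t : ZMod 2) = t at *
    generalize (d1 : ZMod 2) = d1 at *
    have e'' : t ^ 2 = - z := by
      rw [pow_add] at e'; linear_combination -e'
    clear e'
    revert z t; decide
  rw [hb0] at c0 c1 c2 c3 c4
  rw [hb1] at c1 c2 c3 c4 c5
  rw [hb2] at c2 c3 c4 c5 c6
  simp only [one_mul, zero_mul, add_zero, zero_add] at c1 c2 c3 c4 c5 c6
  obtain ⟨p1, p2⟩ := dec2 _ _ _ _ _ _ _ _ _ _ c0 c1 c2 c3 c4 c5 c6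
  have hVt : V.eval t = V.coeff 0 + V.coeff 1 * t + V.coeff 2 * t ^ 2 + V.coeff 3 * t ^ 3 := by
    conv_lhs => rw [deg3 hV]
    simp
  have hV't : V.derivative.eval t = V.coeff 1 + 2 * V.coeff 2 * t + 3 * V.coeff 3 * t ^ 2 := by
    conv_lhs => rw [deg3 hV]
    simp; ring
  have hWt : W.eval t = W.coeff 0 + W.coeff 1 * t + W.coeff 2 * t ^ 2 + W.coeff 3 * t ^ 3
      + W.coeff 4 * t ^ 4 := by
    conv_lhs => rw [deg4 hW]
    simp
  rcases p2 with ⟨p2, p3⟩ | ⟨r0, r1, s0, s1, s2, s3⟩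
  · simp only [coeff_map, eq_intCast] at p1 p2 p3
    have q1 : 2 ∣ V.eval t := by rw [hVt, ← cast_even]; push_cast; exact p1
    have q2 : ¬ 2 ∣ V.derivative.eval t := by
      rw [hV't, ← cast_even]; push_cast; rw [p2]; decide
    have q3 : ¬ 2 ∣ W.eval t := by
      rw [hWt, ← cast_even]; push_cast; rw [p3]; decide
    have E1 := congrArg (eval t) e1
    have E1' := congrArg (fun P => eval t (derivative P)) e1
    have E2 := congrArg (eval t) e2
    simp only [derivative_add, derivative_sub, derivative_mul, derivative_pow, derivative_C] at E1'
    simp at E1 E1' E2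
    refine arith r f (V.eval t + f * h.eval t) (V.derivative.eval t + f * h.derivative.eval t)
      (V.eval t) (V.derivative.eval t) (W.eval t) (h.eval t) (h.derivative.eval t) (q.eval t)
      (q.derivative.eval t) (L.eval t) rfl rfl q1 q2 q3 (hh t) ?_ ?_ ?_
    · exact ⟨d1 * W.eval t, by linear_combination E1 + W.eval t * hd1⟩
    · exact ⟨d1 * R.eval t, by linear_combination E2 + R.eval t * hd1⟩
    · refine ⟨d2 * 2 * W.eval t + d1 * W.derivative.eval t, ?_⟩
      refine mul_left_cancel₀ (two_ne_zero (α := ℤ)) ?_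
      rw [hU't] at E1'
      linear_combination E1' + 2 * W.eval t * hd2 + W.derivative.eval t * hd1
  · refine hm (mult_of_map U V (C r0 + C r1 * X) hU hV (by compute_degree) ?_)
    rw [deg3 (map_deg hV), deg2 (map_deg hU), s0, s1, s2, s3, hb0, hb1, hb2]
    simp only [C_mul, C_1, C_0]; ring

end N3M2

open Polynomial NumberField

namespace N3M2

lemma reflect_deg {P : ℤ[X]} {n : ℕ} (h : P.natDegree ≤ n) : (reflect n P).natDegree ≤ n :=
  natDegree_reflect_le.trans (max_le le_rfl h)

lemma hP_deg : (hP ℤ).natDegree ≤ 3 := by rw [hP]; compute_degree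

lemma qP_deg : (qP ℤ).natDegree ≤ 6 := by
  have : (qP ℤ).natDegree ≤ 2 := by rw [qP]; compute_degree
  omega

lemma hP_odd (t : ℤ) : ¬ 2 ∣ (hP ℤ).eval t := by
  rw [← cast_even, hP]
  simp
  generalize (t : ZMod 2) = t
  revert t; decide

lemma hP_coeffs : (hP ℤ).coeff 0 = -1 ∧ (hP ℤ).coeff 1 = 3 ∧ (hP ℤ).coeff 2 = -2 ∧
    (hP ℤ).coeff 3 = 1 := by
  have e : hP ℤ = C (-1) + C 3 * X + C (-2) * X ^ 2 + C 1 * X ^ 3 := by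
    rw [hP]; simp; ring
  rw [e]
  simp only [coeff_add, coeff_C_mul, coeff_X, coeff_C, coeff_X_pow]
  norm_num

lemma hP_odd' (t : ℤ) : ¬ 2 ∣ (reflect 3 (hP ℤ)).eval t := by
  have h1 : (reflect 3 (hP ℤ)).eval t = 1 - 2 * t + 3 * t ^ 2 - t ^ 3 := by
    rw [deg3 (reflect_deg hP_deg)]
    obtain ⟨c0, c1, c2, c3⟩ := hP_coeffs
    simp only [coeff_reflect, show revAt 3 0 = 3 from rfl, show revAt 3 1 = 2 from rfl,
      show revAt 3 2 = 1 from rfl, show revAt 3 3 = 0 from rfl, c0, c1, c2, c3]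
    simp; ring
  rw [← cast_even, h1]
  push_cast
  generalize (t : ZMod 2) = t
  revert t; decide

lemma core_both (r : ℕ) (f : ℤ) (U V W L R : ℤ[X]) (hU : U.natDegree ≤ 2) (hV : V.natDegree ≤ 3)
    (hW : W.natDegree ≤ 4) (hL : L.natDegree ≤ 1) (hR : R.natDegree ≤ 2) (hUp : U.IsPrimitive)
    (e1 : V ^ 2 + C (2 * f) * hP ℤ * V - C (2 * f) ^ 2 * qP ℤ = U * W)
    (e2 : L * (V + C f * hP ℤ) + C (2 ^ r) * W = U * R)
    (hu1 : 2 ∣ U.coeff 1) (hd : 2 ^ (r + 4) ∣ dsc U) (hm : ¬ Mult U V) :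
    False := by
  by_cases hu2 : 2 ∣ U.coeff 2
  · have hu0 : ¬ 2 ∣ U.coeff 0 := fun h => prim2 U hUp hU ⟨h, hu1, hu2⟩
    have hF : (V + C f * hP ℤ).natDegree ≤ 3 :=
      (natDegree_add_le _ _).trans (max_le hV ((natDegree_C_mul_le _ _).trans hP_deg))
    refine core r f (reflect 2 U) (reflect 3 V) (reflect 4 W) (reflect 1 L) (reflect 2 R)
      (reflect 3 (hP ℤ)) (reflect 6 (qP ℤ)) (reflect_deg hU) (reflect_deg hV) (reflect_deg hW)
      hP_odd' ?_ ?_ ?_ ?_ ?_ ?_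
    · have e : V * V + C (2 * f) * (hP ℤ * V) - C ((2 * f) ^ 2) * qP ℤ = U * W := by
        rw [C_pow]; linear_combination e1
      have e' := congrArg (reflect 6) e
      rw [reflect_sub, reflect_add, reflect_C_mul, reflect_C_mul, reflect_mul V V (F := 3) (G := 3) hV hV,
        reflect_mul (hP ℤ) V (F := 3) (G := 3) hP_deg hV, reflect_mul U W (F := 2) (G := 4) hU hW] at e'
      rw [C_pow] at e'
      linear_combination e'
    · have e' := congrArg (reflect 4) e2
      rw [reflect_add, reflect_C_mul, reflect_mul L _ (F := 1) (G := 3) hL hF,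
        reflect_mul U R (F := 2) (G := 2) hU hR, reflect_add, reflect_C_mul] at e'
      exact e'
    · rw [coeff_reflect, show revAt 2 1 = 1 from rfl]; exact hu1
    · rw [coeff_reflect, show revAt 2 2 = 0 from rfl]; exact hu0
    · rw [dsc, coeff_reflect, coeff_reflect, coeff_reflect, show revAt 2 2 = 0 from rfl,
        show revAt 2 1 = 1 from rfl, show revAt 2 0 = 2 from rfl]
      rw [dsc] at hd
      convert hd using 1; ring
    · rintro ⟨R', S', hR', hS'⟩
      apply hm
      refine ⟨reflect 1 R', reflect 3 S', reflect_deg hR', ?_⟩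
      have e' := congrArg (reflect 3) hS'
      rw [reflect_add, reflect_C_mul, reflect_mul (reflect 2 U) R' (F := 2) (G := 1) (reflect_deg hU) hR',
        reflect_reflect, reflect_reflect] at e'
      exact e'
  · exact core r f U V W L R (hP ℤ) (qP ℤ) hU hV hW hP_odd e1 e2 hu1 hu2 hd hm

/-- maximal choice of the power of two -/
lemma max_rho (U N L0 : ℤ[X]) (e : ℤ) (he : e ≠ 0) (hU : U.natDegree ≤ 2) :
    ∀ (n : ℕ) (r : ℕ) (e1 : ℤ) (L V L' : ℤ[X]), e1.natAbs = n → e = 2 ^ (r + 1) * e1 →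
      N = U * L + C (2 ^ (r + 1)) * V → L = L0 + C 2 * L' → L.natDegree ≤ 1 → V.natDegree ≤ 3 →
    ∃ (r : ℕ) (e1 : ℤ) (L V L' : ℤ[X]), e = 2 ^ (r + 1) * e1 ∧
      N = U * L + C (2 ^ (r + 1)) * V ∧ L = L0 + C 2 * L' ∧ L.natDegree ≤ 1 ∧ V.natDegree ≤ 3 ∧
      (¬ 2 ∣ e1 ∨ ¬ Mult U V) := by
  intro n
  induction' n using Nat.strong_induction_on with n ih
  intro r e1 L V L' h1 h2 h3 h4 h5 h6
  by_cases hc : 2 ∣ e1 ∧ Mult U V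
  · obtain ⟨⟨e2, rfl⟩, R, S, hR, hS⟩ := hc
    have he2 : e2 ≠ 0 := by rintro rfl; apply he; rw [h2]; ring
    have hSd : S.natDegree ≤ 3 := by
      rw [← natDegree_C_mul (a := (2 : ℤ)) (by norm_num),
        show C 2 * S = V - U * R by linear_combination -hS]
      exact (natDegree_sub_le _ _).trans (max_le h6 (natDegree_mul_le.trans (by omega)))
    refine ih e2.natAbs (by omega) (r + 1) e2 (L + C (2 ^ (r + 1)) * R) S (L' + C (2 ^ r) * R) rfl
      (by rw [h2]; ring) ?_ ?_ ?_ hSd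
    · rw [h3, hS]; simp only [C_pow]; ring
    · rw [h4]; simp only [C_pow]; ring
    · exact (natDegree_add_le _ _).trans (max_le h5 ((natDegree_C_mul_le _ _).trans hR))
  · exact ⟨r, e1, L, V, L', h2, h3, h4, h5, h6, by tauto⟩

/-- the objects of the descent -/
def Good (A : ℤ[X]) : Prop := A.natDegree ≤ 2 ∧ A.IsPrimitive ∧ dsc A ≠ 0 ∧
  ∃ (b : ℤ) (N Q : ℤ[X]), b ≠ 0 ∧ 2 ∣ b ∧ N.natDegree ≤ 3 ∧ Q.natDegree ≤ 4 ∧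
    N ^ 2 + C b * hP ℤ * N - C b ^ 2 * qP ℤ = A * Q ∧ ¬ Mult A N

lemma good_even (A : ℤ[X]) (b : ℤ) (N Q : ℤ[X]) (hA : A.natDegree ≤ 2) (hb : 2 ∣ b)
    (hN : N.natDegree ≤ 3) (hQ : Q.natDegree ≤ 4)
    (h : N ^ 2 + C b * hP ℤ * N - C b ^ 2 * qP ℤ = A * Q) (hm : ¬ Mult A N) : 2 ∣ A.coeff 1 := by
  obtain ⟨b', rfl⟩ := hb
  refine a1_even A N Q (C b' * hP ℤ * N - 2 * C b' ^ 2 * qP ℤ) hA hN hQ ?_ hm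
  rw [← h]; simp only [C_mul, map_ofNat]; ring

lemma C2_dvd_of_map (N : ℤ[X]) (h : N.map (Int.castRingHom (ZMod 2)) = 0) : C 2 ∣ N := by
  rw [C_dvd_iff_dvd_coeff]
  intro i
  have := congrArg (fun P => P.coeff i) h
  simpa [cast_even] using this

lemma two_zero : Int.castRingHom (ZMod 2) 2 = 0 := by decide

lemma z2_one : ∀ z : ZMod 2, ¬ z = 0 → z = 1 := by decide

lemma z2_sq : ∀ z : ZMod 2, z = z ^ 2 := by decide

lemma z2_two : (OfNat.ofNat 2 : ZMod 2) = 0 := by decide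

/-- square root modulo two -/
lemma sqrt_mod (A U N X0 : ℤ[X]) (k : ℤ) (hA : A.natDegree ≤ 2) (hU : U.natDegree ≤ 2)
    (hN : N.natDegree ≤ 3) (h1 : 2 ∣ A.coeff 1) (hN2 : ¬ C 2 ∣ N)
    (h : N ^ 2 + C 2 * X0 = C k * A * U ^ 2) :
    ¬ 2 ∣ k ∧ ∃ V : ℤ[X], V.natDegree ≤ 3 ∧
      N = U * (C (A.coeff 0) + C (A.coeff 2) * X) + C 2 * V := by
  have : Fact (Nat.Prime 2) := ⟨Nat.prime_two⟩
  have hs := map_sq_eq (C k * A) N (U ^ 2) X0 h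
  have hk : ¬ 2 ∣ k := by
    intro hk
    apply hN2
    apply C2_dvd_of_map
    rw [← cast_even] at hk
    rw [Polynomial.map_mul, map_C, eq_intCast, hk, C_0, zero_mul, zero_mul] at hs
    exact pow_eq_zero_iff (n := 2) (by norm_num) |>.1 hs
  refine ⟨hk, ?_⟩
  have hk1 : (k : ZMod 2) = 1 := by
    rw [← cast_even] at hk
    exact z2_one _ hk
  have hsq := z2_sq
  have hA' : A.map (Int.castRingHom (ZMod 2))
      = ((C (A.coeff 0) + C (A.coeff 2) * X : ℤ[X]).map (Int.castRingHom (ZMod 2))) ^ 2 := by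
    rw [deg2 (map_deg hA)]
    simp only [Polynomial.map_add, Polynomial.map_mul, map_C, map_X, coeff_map]
    have h10 : Int.castRingHom (ZMod 2) (A.coeff 1) = 0 := by
      rw [eq_intCast, cast_even]; exact h1
    rw [h10, add_sq]
    have h2 : (2 : (ZMod 2)[X]) = 0 := by
      rw [← C_ofNat, z2_two, C_0]
    rw [h2, mul_pow, ← C_pow, ← C_pow, ← hsq, ← hsq]; simp
  have hmap : N.map (Int.castRingHom (ZMod 2))
      = (U * (C (A.coeff 0) + C (A.coeff 2) * X)).map (Int.castRingHom (ZMod 2)) := by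
    rw [Polynomial.map_mul, map_C, eq_intCast, hk1, C_1, one_mul, hA', Polynomial.map_pow] at hs
    rw [Polynomial.map_mul]
    have : CharP (ZMod 2)[X] 2 := inferInstance
    have h0 : (N.map (Int.castRingHom (ZMod 2)) - U.map (Int.castRingHom (ZMod 2)) *
      (C (A.coeff 0) + C (A.coeff 2) * X : ℤ[X]).map (Int.castRingHom (ZMod 2))) ^ 2 = 0 := by
      rw [sub_pow_char, hs]; ring
    exact sub_eq_zero.1 (pow_eq_zero_iff (n := 2) (by norm_num) |>.1 h0)
  obtain ⟨V, hV, hV'⟩ := eq_of_map_eq 2 N _ 3 hN (by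
    refine natDegree_mul_le.trans ?_
    have : (C (A.coeff 0) + C (A.coeff 2) * X : ℤ[X]).natDegree ≤ 1 := by compute_degree
    omega) hmap
  exact ⟨V, hV, by exact_mod_cast hV'⟩

end N3M2

open Polynomial NumberField

namespace N3M2

lemma lin_contra (A U R Z : ℤ[X]) (hA : A.IsPrimitive) (hA2 : A.natDegree ≤ 2) (h1 : 2 ∣ A.coeff 1)
    (hU : U.IsPrimitive) (hU2 : U.natDegree ≤ 2) (hR : R.natDegree ≤ 2)
    (h : U * R = (C (A.coeff 0) + C (A.coeff 2) * X) * hP ℤ + C 2 * Z) : False := by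
  have hm := congrArg (Polynomial.map (Int.castRingHom (ZMod 2))) h
  have hh : (hP ℤ).map (Int.castRingHom (ZMod 2)) = X ^ 3 + X + 1 := by
    have e : hP ℤ = C 1 * X ^ 3 + C (-2) * X ^ 2 + C 3 * X + C (-1) := by
      rw [hP]; simp; ring
    rw [e]
    simp only [Polynomial.map_add, Polynomial.map_mul, Polynomial.map_pow, map_C, map_X]
    rw [show Int.castRingHom (ZMod 2) 1 = 1 by decide, show Int.castRingHom (ZMod 2) (-2) = 0 by decide,
      show Int.castRingHom (ZMod 2) 3 = 1 by decide, show Int.castRingHom (ZMod 2) (-1) = 1 by decide]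
    simp
  rw [Polynomial.map_add, Polynomial.map_mul, Polynomial.map_mul, Polynomial.map_mul, map_C, two_zero,
    hh, deg2 (map_deg hU2), deg2 (map_deg hR)] at hm
  simp only [Polynomial.map_add, Polynomial.map_mul, map_C, map_X, coeff_map, C_0,
    zero_mul, add_zero] at hm
  simp only [eq_intCast (Int.castRingHom (ZMod 2))] at hm
  generalize hu0 : ((U.coeff 0 : ℤ) : ZMod 2) = u0 at hm
  generalize hu1 : ((U.coeff 1 : ℤ) : ZMod 2) = u1 at hm
  generalize hu2 : ((U.coeff 2 : ℤ) : ZMod 2) = u2 at hm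
  generalize hr0 : ((R.coeff 0 : ℤ) : ZMod 2) = r0 at hm
  generalize hr1 : ((R.coeff 1 : ℤ) : ZMod 2) = r1 at hm
  generalize hr2 : ((R.coeff 2 : ℤ) : ZMod 2) = r2 at hm
  generalize ha0 : ((A.coeff 0 : ℤ) : ZMod 2) = a0 at hm
  generalize ha2 : ((A.coeff 2 : ℤ) : ZMod 2) = a2 at hm
  obtain ⟨c0, c1, c2, c3, c4, -⟩ := coeffs6 (a0 := u0 * r0) (a1 := u0 * r1 + u1 * r0)
    (a2 := u0 * r2 + u1 * r1 + u2 * r0) (a3 := u1 * r2 + u2 * r1) (a4 := u2 * r2) (a5 := 0) (a6 := 0)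
    (b0 := a0) (b1 := a0 + a2) (b2 := a2) (b3 := a0) (b4 := a2) (b5 := 0) (b6 := 0) (by
      simp only [C_add, C_mul, C_0]; linear_combination hm)
  rcases dec3 _ _ _ _ _ _ _ _ c0 c1 c2 c3 c4 with ⟨h0, h1', h2⟩ | ⟨h0, h2⟩
  · refine prim2 U hU hU2 ⟨?_, ?_, ?_⟩ <;> rw [← cast_even] <;> simp [hu0, hu1, hu2, h0, h1', h2]
  · refine prim2 A hA hA2 ⟨?_, h1, ?_⟩ <;> rw [← cast_even] <;> simp [ha0, ha2, h0, h2]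

lemma dsc_lift (A L R : ℤ[X]) (k : ℤ) (r : ℕ) (hA : A.natDegree ≤ 2) (hL : L.natDegree ≤ 1)
    (hR : R.natDegree ≤ 2) (hk : ¬ 2 ∣ k) (h : C k * A = L ^ 2 + C (2 ^ (r + 2)) * R) :
    2 ^ (r + 4) ∣ dsc A := by
  have h' := h
  rw [deg2 hA, deg1 hL, deg2 hR] at h'
  obtain ⟨c0, c1, c2, -⟩ := coeffs6 (a0 := k * A.coeff 0) (a1 := k * A.coeff 1)
    (a2 := k * A.coeff 2) (a3 := 0) (a4 := 0) (a5 := 0) (a6 := 0)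
    (b0 := L.coeff 0 ^ 2 + 2 ^ (r + 2) * R.coeff 0)
    (b1 := 2 * L.coeff 0 * L.coeff 1 + 2 ^ (r + 2) * R.coeff 1)
    (b2 := L.coeff 1 ^ 2 + 2 ^ (r + 2) * R.coeff 2) (b3 := 0) (b4 := 0) (b5 := 0) (b6 := 0) (by
      simp only [C_add, C_mul, C_0, C_pow, map_ofNat] at h' ⊢; linear_combination h')
  have h2 : (2 : ℤ) ^ (r + 4) ∣ k ^ 2 * dsc A := by
    refine ⟨L.coeff 0 * L.coeff 1 * R.coeff 1 + 2 ^ r * R.coeff 1 ^ 2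
      - (L.coeff 0 ^ 2 * R.coeff 2 + L.coeff 1 ^ 2 * R.coeff 0)
      - 4 * 2 ^ r * R.coeff 0 * R.coeff 2, ?_⟩
    rw [dsc, show k ^ 2 * (A.coeff 1 ^ 2 - 4 * A.coeff 0 * A.coeff 2)
      = (k * A.coeff 1) ^ 2 - 4 * (k * A.coeff 0) * (k * A.coeff 2) by ring, c0, c1, c2]
    ring
  refine IsCoprime.dvd_of_dvd_mul_left ?_ h2
  exact IsCoprime.pow ((Int.prime_two.coprime_iff_not_dvd).2 hk)

lemma step (A : ℤ[X]) (hG : Good A) : ∃ (U : ℤ[X]) (m : ℕ), Good U ∧ 2 ^ m ∣ dsc A ∧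
    ¬ 2 ^ m ∣ dsc U := by
  obtain ⟨hA2, hA, hd, b, N, Q, hb0, hb, hN, hQ, eN, hm⟩ := hG
  have h1 := good_even A b N Q hA2 hb hN hQ eN hm
  obtain ⟨k, e, U, N', T, he, hU, hUp, hN', hT, hne, e1, e2⟩ :=
    stepA A hA hA2 hd b hb0 N Q hN hQ eN h1
  obtain ⟨b', rfl⟩ := hb
  have he2 : 2 ∣ e := by
    by_contra hodd
    obtain ⟨j, rfl⟩ : ∃ j, e = 2 * j + 1 := ⟨e / 2, by omega⟩
    refine hm ⟨T, C b' * N' - C j * N, hT, ?_⟩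
    simp only [C_mul, C_add, C_1] at e2
    linear_combination -e2
  obtain ⟨e0, rfl⟩ := he2
  have hN2 : ¬ C 2 ∣ N' := fun h => hne ⟨Dvd.intro _ rfl, h⟩
  obtain ⟨hk, V0, hV0, eV0⟩ := sqrt_mod A U N' (C e0 * hP ℤ * N' - C 2 * C e0 ^ 2 * qP ℤ) k hA2 hU hN'
    h1 hN2 (by rw [← e1]; simp only [C_mul]; ring)
  obtain ⟨r, f1, L, V, L', g1, g2, g3, hL, hV, hmax⟩ := max_rho U N'
    (C (A.coeff 0) + C (A.coeff 2) * X) (2 * e0) he hU _ 0 e0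
    (C (A.coeff 0) + C (A.coeff 2) * X) V0 0 rfl (by ring) (by simpa using eV0) (by simp)
    (by compute_degree) hV0
  have hf1 : f1 ≠ 0 := by rintro rfl; apply he; rw [g1]; ring
  have hC0 (n : ℤ) (hn : n ≠ 0) : (C n : ℤ[X]) ≠ 0 := by rwa [Ne, C_eq_zero]
  have hc0 : (2 : ℤ) ^ (r + 1) ≠ 0 := by positivity
  have hU0 : U ≠ 0 := hUp.ne_zero
  have hFd : (2 * V + C f1 * hP ℤ).natDegree ≤ 3 :=
    (natDegree_add_le _ _).trans (max_le ((natDegree_C_mul_le 2 _).trans hV)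
      ((natDegree_C_mul_le _ _).trans hP_deg))
  -- step 4
  have k1 : C ((2 ^ (r + 1)) ^ 2) * (V ^ 2 + C f1 * hP ℤ * V - C f1 ^ 2 * qP ℤ)
      = U * (C k * A * U - U * L ^ 2 - C (2 ^ (r + 1)) * (L * (2 * V + C f1 * hP ℤ))) := by
    rw [g2, g1] at e1
    rw [C_mul (a := 2 ^ (r + 1)) (b := f1)] at e1
    rw [C_pow (a := 2 ^ (r + 1))]
    generalize (C (2 ^ (r + 1)) : ℤ[X]) = c at *
    linear_combination e1
  obtain ⟨W, hW⟩ := prim_cancel _ _ _ hUp _ k1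
  have hWU : V ^ 2 + C f1 * hP ℤ * V - C f1 ^ 2 * qP ℤ = U * W := by
    refine mul_left_cancel₀ (hC0 _ (pow_ne_zero 2 hc0)) ?_
    rw [k1, hW]; ring
  have hWd : W.natDegree ≤ 4 := by
    rw [← natDegree_C_mul (a := (2 ^ (r + 1)) ^ 2) (pow_ne_zero 2 hc0), ← hW]
    refine (natDegree_sub_le _ _).trans (max_le ((natDegree_sub_le _ _).trans (max_le ?_ ?_)) ?_)
    · refine natDegree_mul_le.trans ?_
      have := natDegree_C_mul_le k A
      omega
    · refine natDegree_mul_le.trans ?_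
      have := natDegree_pow_le (p := L) (n := 2)
      omega
    · refine (natDegree_C_mul_le _ _).trans (natDegree_mul_le.trans ?_)
      omega
  -- step 5
  have k2 : C (2 ^ (r + 1)) * (L * (2 * V + C f1 * hP ℤ) + C (2 ^ (r + 1)) * W)
      = U * (C k * A - L ^ 2) := by
    rw [C_pow (a := 2 ^ (r + 1))] at hW
    linear_combination -hW
  obtain ⟨R, hR⟩ := prim_cancel _ _ _ hUp _ k2
  have hRU : U * R = L * (2 * V + C f1 * hP ℤ) + C (2 ^ (r + 1)) * W := by
    refine mul_left_cancel₀ (hC0 _ hc0) ?_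
    rw [k2, hR]; ring
  have hRd : R.natDegree ≤ 2 := by
    rw [← natDegree_C_mul (a := 2 ^ (r + 1)) hc0, ← hR]
    refine (natDegree_sub_le _ _).trans (max_le ((natDegree_C_mul_le _ _).trans hA2) ?_)
    exact natDegree_pow_le.trans (by omega)
  -- step 6
  have hf2 : 2 ∣ f1 := by
    by_contra hodd
    obtain ⟨j, rfl⟩ : ∃ j, f1 = 2 * j + 1 := ⟨f1 / 2, by omega⟩
    refine lin_contra A U R (L * V + L * C j * hP ℤ + L' * hP ℤ + C (2 ^ r) * W) hA hA2 h1 hUp hU hRd ?_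
    rw [hRU]
    have e3 : (C 2 : ℤ[X]) = 2 := by simp
    have hL2 : L * hP ℤ = (C (A.coeff 0) + C (A.coeff 2) * X) * hP ℤ + C 2 * L' * hP ℤ := by
      rw [g3]; ring
    simp only [C_mul, C_add, C_1, C_pow, e3] at hL2 ⊢
    linear_combination hL2
  have hmU : ¬ Mult U V := hmax.resolve_left (fun h => h hf2)
  have hu1 := good_even U f1 V W hU hf2 hV hWd hWU hmU
  obtain ⟨f, rfl⟩ := hf2
  -- step 8
  have e3 : (C 2 : ℤ[X]) = 2 := by simp
  have k3 : C 2 * (L * (V + C f * hP ℤ) + C (2 ^ r) * W) = U * R := by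
    rw [hRU]; simp only [C_mul, C_pow, e3]; ring
  obtain ⟨R', rfl⟩ := prim_cancel _ _ _ hUp _ k3
  have k4 : L * (V + C f * hP ℤ) + C (2 ^ r) * W = U * R' := by
    refine mul_left_cancel₀ (hC0 2 (by norm_num)) ?_
    rw [k3]; ring
  have hRd' : R'.natDegree ≤ 2 := by
    rwa [natDegree_C_mul (a := (2 : ℤ)) (by norm_num)] at hRd
  have hnd : ¬ 2 ^ (r + 4) ∣ dsc U := fun h =>
    core_both r f U V W L R' hU hV hWd hL hRd' hUp hWU k4 hu1 h hmU
  refine ⟨U, r + 4, ⟨hU, hUp, ?_, 2 * f, V, W, hf1, Dvd.intro _ rfl, hV, hWd, hWU, hmU⟩, ?_, hnd⟩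
  · intro h; rw [h] at hnd; exact hnd (dvd_zero _)
  · refine dsc_lift A L R' k r hA2 hL hRd' hk ?_
    have : C k * A = L ^ 2 + C (2 ^ (r + 1)) * (C 2 * R') := by linear_combination hR
    rw [this]; simp only [C_pow]; ring

lemma descent : ∀ (n : ℕ) (A : ℤ[X]), Good A → ¬ 2 ^ n ∣ dsc A → False := by
  intro n
  induction' n with n ih
  · intro A _ h; exact h (by simp)
  · intro A hA h
    obtain ⟨U, m, hU, h1, h2⟩ := step A hA
    refine ih U hU (fun h3 => h2 ((pow_dvd_pow 2 ?_).trans h3))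
    by_contra hc
    exact h ((pow_dvd_pow 2 (by omega)).trans h1)

lemma no_good (A : ℤ[X]) (hA : Good A) : False := by
  refine descent (dsc A).natAbs A hA ?_
  intro h
  have h1 := Int.le_of_dvd (abs_pos.2 hA.2.2.1) ((dvd_abs _ _).2 h)
  have h2 : (dsc A).natAbs < 2 ^ (dsc A).natAbs := Nat.lt_two_pow_self
  have h3 : ((dsc A).natAbs : ℤ) < 2 ^ (dsc A).natAbs := by exact_mod_cast h2
  rw [Int.natCast_natAbs] at h3
  omega

end N3M2

open Polynomial NumberField

namespace N3M2

lemma start (w z s : ℤ) (hcop : IsCoprime w z) (hz : z ≠ 0) (hz2 : 2 ∣ z) (hw2 : ¬ 2 ∣ w)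
    (hs2 : 2 ∣ s)
    (hs : s * (s + (w ^ 3 - 2 * w ^ 2 * z + 3 * w * z ^ 2 - z ^ 3))
      = z ^ 4 * (w ^ 2 - w * z + z ^ 2)) : False := by
  obtain ⟨n2, n0, hn⟩ : ∃ n2 n0 : ℤ, n2 * w ^ 2 + n0 * z ^ 2 = s + w ^ 3 := by
    obtain ⟨a, b, hab⟩ := hcop.pow (m := 2) (n := 2)
    exact ⟨(s + w ^ 3) * a, (s + w ^ 3) * b, by linear_combination (s + w ^ 3) * hab⟩
  have hn2 : ¬ 2 ∣ n2 := by
    intro h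
    have h1 : (2 : ℤ) ∣ s + w ^ 3 := by
      rw [← hn]
      exact dvd_add (h.mul_right _) ((dvd_pow hz2 two_ne_zero).mul_left _)
    exact hw2 (Int.prime_two.dvd_of_dvd_pow ((dvd_add_right hs2).1 h1))
  set A : ℤ[X] := C (-w) + C z * X with hAdef
  have cA0 : A.coeff 0 = -w := by rw [hAdef]; simp
  have cA1 : A.coeff 1 = z := by
    rw [hAdef]
    simp only [coeff_add, coeff_C_mul, coeff_X, coeff_C]; norm_num
  have hA1 : A.natDegree ≤ 1 := by rw [hAdef]; compute_degree
  have cA2 : A.coeff 2 = 0 := coeff_eq_zero_of_natDegree_lt (by omega)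
  have hAp : A.IsPrimitive := by
    intro r hr
    rw [C_dvd_iff_dvd_coeff] at hr
    have h0 := hr 0
    have h1 := hr 1
    rw [cA0, dvd_neg] at h0
    rw [cA1] at h1
    exact hcop.isUnit_of_dvd' h0 h1
  set p5 := -2 * z * n2 + z * n2 + 2 * z ^ 2 with hp5
  set p4 := n2 ^ 2 - 2 * z * n2 - 3 * z ^ 2 with hp4
  set p3 := -2 * z * n0 + z * n0 + 3 * z * n2 + z ^ 2 with hp3
  set p2 := 2 * n2 * n0 - 2 * z * n0 - z * n2 - z ^ 2 with hp2
  set p1 := 3 * z * n0 + z ^ 2 with hp1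
  set p0 := n0 ^ 2 - z * n0 - z ^ 2 with hp0
  have hroot : p0 * z ^ 5 + p1 * w * z ^ 4 + p2 * w ^ 2 * z ^ 3 + p3 * w ^ 3 * z ^ 2
      + p4 * w ^ 4 * z + p5 * w ^ 5 = 0 := by
    refine mul_left_cancel₀ hz ?_
    rw [hp0, hp1, hp2, hp3, hp4, hp5]
    linear_combination (-z * w ^ 3 + z * (n2 * w ^ 2 + n0 * z ^ 2) + z * s
      + z * (w ^ 3 - 2 * w ^ 2 * z + 3 * w * z ^ 2 - z ^ 3)) * z * hn + z ^ 2 * hs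
  set N : ℤ[X] := C n0 + C n2 * X ^ 2 + C (-z) * X ^ 3 with hNdef
  set P : ℤ[X] := C p0 + C p1 * X + C p2 * X ^ 2 + C p3 * X ^ 3 + C p4 * X ^ 4 + C p5 * X ^ 5
    with hPdef
  have hNP : N ^ 2 + C z * hP ℤ * N - C z ^ 2 * qP ℤ = P := by
    rw [hNdef, hPdef, hP, qP, hp0, hp1, hp2, hp3, hp4, hp5]
    simp only [C_add, C_sub, C_mul, C_neg, C_pow, map_ofNat]
    ring
  have hrootC : C p0 * C z ^ 5 + C p1 * C w * C z ^ 4 + C p2 * C w ^ 2 * C z ^ 3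
      + C p3 * C w ^ 3 * C z ^ 2 + C p4 * C w ^ 4 * C z + C p5 * C w ^ 5 = (0 : ℤ[X]) := by
    rw [← C_0, ← hroot]; simp only [C_add, C_mul, C_pow]
  have hPd : P.natDegree ≤ 5 := by rw [hPdef]; compute_degree
  clear_value p0 p1 p2 p3 p4 p5
  have hdiv : C (z ^ 5) * P = A * (C p1 * C z ^ 4 + C p2 * C z ^ 3 * (C z * X + C w)
      + C p3 * C z ^ 2 * ((C z * X) ^ 2 + C z * X * C w + C w ^ 2)
      + C p4 * C z * ((C z * X) ^ 3 + (C z * X) ^ 2 * C w + C z * X * C w ^ 2 + C w ^ 3)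
      + C p5 * ((C z * X) ^ 4 + (C z * X) ^ 3 * C w + (C z * X) ^ 2 * C w ^ 2
        + C z * X * C w ^ 3 + C w ^ 4)) := by
    rw [hPdef, hAdef, C_pow, C_neg]
    linear_combination hrootC
  obtain ⟨Q, hQ⟩ := prim_cancel _ _ _ hAp _ hdiv
  have hPQ : P = A * Q := by
    have : (C (z ^ 5) : ℤ[X]) ≠ 0 := by
      rw [Ne, C_eq_zero]; exact pow_ne_zero 5 hz
    refine mul_left_cancel₀ this ?_
    rw [hdiv, hQ]; ring
  have hQd : Q.natDegree ≤ 4 := by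
    by_cases hQ0 : Q = 0
    · rw [hQ0]; simp
    have h1 : A.natDegree = 1 := by
      refine le_antisymm hA1 (le_natDegree_of_ne_zero ?_)
      rw [cA1]; exact hz
    rw [hPQ, natDegree_mul hAp.ne_zero hQ0, h1] at hPd
    omega
  refine no_good A ⟨by omega, hAp, ?_, z, N, Q, hz, hz2, ?_, hQd, by rw [hNP, hPQ], ?_⟩
  · rw [dsc, cA0, cA1, cA2]; simpa using hz
  · rw [hNdef]; compute_degree
  · rintro ⟨R, S, hR, hRS⟩
    have h2 := congrArg (fun P => P.coeff 2) hRS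
    have e : A * R = C (-w) * R + C z * (X * R) := by rw [hAdef]; ring
    have hN2 : N.coeff 2 = n2 := by
      rw [hNdef]
      simp only [coeff_add, coeff_C_mul, coeff_C, coeff_X_pow]; norm_num
    have hR2 : R.coeff 2 = 0 := coeff_eq_zero_of_natDegree_lt (by omega)
    simp only [e, coeff_add, coeff_C_mul, hN2, hR2, mul_zero, zero_add] at h2
    apply hn2
    rw [h2]
    exact dvd_add (hz2.mul_right _) (Dvd.intro _ rfl)

lemma par1 : ∀ w z : ZMod 2, ¬ (w = 0 ∧ z = 0) →
    w ^ 3 - 2 * w ^ 2 * z + 3 * w * z ^ 2 - z ^ 3 = 1 ∧ w ^ 2 - w * z + z ^ 2 = 1 := by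
  decide

lemma par2 : ∀ s : ZMod 2, s * (s + 1) = 0 := by decide

lemma no_point (x y : ℚ) (h : y ^ 2 = x ^ 6 - 4 * x ^ 5 + 10 * x ^ 4 - 14 * x ^ 3 + 17 * x ^ 2
    - 10 * x + 5) : False := by
  obtain ⟨w, z, hz, hcop, hx⟩ : ∃ w z : ℤ, z ≠ 0 ∧ IsCoprime w z ∧ x * z = w := by
    refine ⟨x.num, x.den, by exact_mod_cast x.den_nz, ?_, ?_⟩
    · exact Int.isCoprime_iff_gcd_eq_one.2 x.reduced
    · exact_mod_cast Rat.mul_den_eq_num x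
  set H : ℤ := w ^ 3 - 2 * w ^ 2 * z + 3 * w * z ^ 2 - z ^ 3 with hH
  set q : ℤ := w ^ 2 - w * z + z ^ 2 with hq
  have h1 : (y * z ^ 3) ^ 2 = ((H ^ 2 + 4 * z ^ 4 * q : ℤ) : ℚ) := by
    rw [hH, hq]
    push_cast
    rw [← hx, mul_pow, h]; ring
  obtain ⟨Y, hY⟩ : ∃ Y : ℤ, (Y : ℚ) = y * z ^ 3 := by
    have : IsIntegral ℤ ((y * z ^ 3) ^ 2) := by
      rw [h1]; exact isIntegral_algebraMap (R := ℤ) (A := ℚ)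
    obtain ⟨Y, hY⟩ := IsIntegrallyClosed.exists_algebraMap_eq_of_isIntegral_pow (n := 2) (by norm_num) this
    exact ⟨Y, by simpa using hY⟩
  have h2 : Y ^ 2 = H ^ 2 + 4 * z ^ 4 * q := by
    rw [← hY] at h1; exact_mod_cast h1
  have hnb : ¬ (((w : ℤ) : ZMod 2) = 0 ∧ ((z : ℤ) : ZMod 2) = 0) := by
    rintro ⟨hw, hz⟩
    rw [cast_even] at hw hz
    exact Int.prime_two.not_isUnit (hcop.isUnit_of_dvd' hw hz)
  obtain ⟨pH, pq⟩ := par1 _ _ hnb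
  have pH' : (H : ZMod 2) = 1 := by rw [hH]; push_cast; exact pH
  have pq' : (q : ZMod 2) = 1 := by rw [hq]; push_cast; exact pq
  obtain ⟨s, hs⟩ : ∃ s, Y = H + 2 * s := by
    have : (2 : ℤ) ∣ Y - H := by
      have h3 : (2 : ℤ) ∣ (Y - H) ^ 2 := ⟨2 * z ^ 4 * q + H ^ 2 - Y * H, by linear_combination h2⟩
      exact Int.prime_two.dvd_of_dvd_pow h3
    obtain ⟨s, hs⟩ := this
    exact ⟨s, by linear_combination hs⟩
  have h3 : s * (s + H) = z ^ 4 * q := by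
    rw [hs] at h2
    linarith
  have hz2 : 2 ∣ z := by
    have h4 := congrArg (Int.cast : ℤ → ZMod 2) h3
    push_cast at h4
    rw [pH', pq', par2, mul_one] at h4
    have h5 : (2 : ℤ) ∣ z ^ 4 := by
      rw [← cast_even]; push_cast; exact h4.symm
    exact Int.prime_two.dvd_of_dvd_pow h5
  have hw2 : ¬ 2 ∣ w := fun hw => Int.prime_two.not_isUnit (hcop.isUnit_of_dvd' hw hz2)
  by_cases hs2 : 2 ∣ s
  · exact start w z s hcop hz hz2 hw2 hs2 h3
  · have hHo : ¬ 2 ∣ H := by rw [← cast_even, pH']; decide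
    refine start w z (-s - H) hcop hz hz2 hw2 (by omega) ?_
    rw [← hH, ← hq, ← h3]; ring

end N3M2

/-- The only rational points on
`(-c² - c + 1)w³ + (c² + c - 1)w² + (-2c² + 1)w + c² - c = 0` are
`(0, 0)` and `(1, 0)` (graph N3M2). -/
theorem stmt_8 :
    {p : ℚ × ℚ |
        (-p.1 ^ 2 - p.1 + 1) * p.2 ^ 3 + (p.1 ^ 2 + p.1 - 1) * p.2 ^ 2 +
          (-2 * p.1 ^ 2 + 1) * p.2 + p.1 ^ 2 - p.1 = 0} =
      ({(0, 0), (1, 0)} : Set (ℚ × ℚ)) := by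
  ext ⟨c, w⟩
  simp only [Set.mem_setOf_eq, Set.mem_insert_iff, Set.mem_singleton_iff, Prod.mk.injEq]
  constructor
  · intro h
    by_cases hw : w = 0
    · subst hw
      have h1 : c * (c - 1) = 0 := by linear_combination h
      rcases mul_eq_zero.1 h1 with h2 | h2
      · exact Or.inl ⟨h2, rfl⟩
      · exact Or.inr ⟨by linear_combination h2, rfl⟩
    · exfalso
      refine N3M2.no_point (1 / w)
        ((2 * (-w ^ 3 + w ^ 2 - 2 * w + 1) * c + (-w ^ 3 + w ^ 2 - 1)) / w ^ 3) ?_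
      field_simp
      linear_combination 4 * (-w ^ 3 + w ^ 2 - 2 * w + 1) * h
  · rintro (⟨rfl, rfl⟩ | ⟨rfl, rfl⟩) <;> norm_num
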